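/- arXiv:2106.01660 — 3 statements merged into one kernel-verified Lean document; each statement's English description precedes it below -/
import Mathlib

section
/- There is a universal constant C > 0 such that for every dimension d ≥ 2, horizon n ≥ 2 and radius r ∈ [0,1], there exists a policy π such that for every parameter θ⋆ ∈ S^{d-1}_r, the expected regret satisfies R_n(π, θ⋆) ≤ C · d · √(n · log(n) · log(d)). -/
open MeasureTheory ProbabilityTheory
open scoped RealInnerProductSpace

/-- A (possibly randomized) policy for the bandit phase retrieval problem in dimension `d`
with horizon `n`: a random seed distribution `μW` on a seed space `W`, together with
measurable action maps.  The action at time `t` is a measurable function of the seed and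
the `t` previously observed rewards, taking values in the closed unit ball of `ℝ^d`. -/
structure Policy (d n : ℕ) (W : Type) [MeasurableSpace W] where
  /-- distribution of the random seed -/
  μW : Measure W
  probW : IsProbabilityMeasure μW
  /-- the action maps: `act t (w, x₁, …, x_t)` is the action played at time `t` -/
  act : (t : Fin n) → W × (Fin t → ℝ) → EuclideanSpace ℝ (Fin d)
  act_meas : ∀ t, Measurable (act t)
  act_mem : ∀ t p, ‖act t p‖ ≤ 1

namespace Policy

variable {d n : ℕ} {W : Type} [MeasurableSpace W]

/-- The reward sequence generated by the interaction of policy `π` with the phase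
retrieval bandit with parameter `θ`, as a function of the underlying sample
`ω = (seed, noise sequence)`:  `X t = ⟪A t, θ⟫² + η t` where
`A t = act t (seed, X₀, …, X_{t-1})` and `η t` is the `t`-th noise variable. -/
noncomputable def X (π : Policy d n W) (θ : EuclideanSpace ℝ (Fin d)) :
    ℕ → W × (Fin n → ℝ) → ℝ
  | t => fun ω =>
      if h : t < n then
        (⟪π.act ⟨t, h⟩ (ω.1, fun s : Fin t => X π θ s.val ω), θ⟫) ^ 2 + ω.2 ⟨t, h⟩
      else 0
  termination_by t => t
  decreasing_by exact s.isLt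

/-- The action played at time `t` against parameter `θ`. -/
noncomputable def A (π : Policy d n W) (θ : EuclideanSpace ℝ (Fin d)) (t : Fin n)
    (ω : W × (Fin n → ℝ)) : EuclideanSpace ℝ (Fin d) :=
  π.act t (ω.1, fun s : Fin t => π.X θ s.val ω)

/-- The underlying probability measure of the interaction: the product of the seed
distribution and of the law of the i.i.d. standard Gaussian noise sequence. -/
noncomputable def μ (π : Policy d n W) : Measure (W × (Fin n → ℝ)) :=
  π.μW.prod (Measure.pi fun _ : Fin n => gaussianReal 0 1)

/-- Expected regret of policy `π` against a parameter `θ` on the sphere of radius `r`: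
`R_n(π, θ) = n r² - E[∑_t ⟪A_t, θ⟫²]`. -/
noncomputable def regret (π : Policy d n W) (θ : EuclideanSpace ℝ (Fin d)) (r : ℝ) : ℝ :=
  n * r ^ 2 - ∫ ω, ∑ t : Fin n, (⟪π.A θ t ω, θ⟫) ^ 2 ∂π.μ

end Policy


namespace BanditPhaseRetrieval

/-- A linear combination of independent standard Gaussians is Gaussian. -/
lemma map_sum_mul_gaussian {Ω ι : Type*} [MeasurableSpace Ω] {P : Measure Ω}
    [IsProbabilityMeasure P] {X : ι → Ω → ℝ} (hX : ∀ i, Measurable (X i))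
    (hlaw : ∀ i, P.map (X i) = gaussianReal 0 1) (hind : iIndepFun X P)
    (c : ι → ℝ) (s : Finset ι) :
    P.map (fun ω => ∑ i ∈ s, c i * X i ω) = gaussianReal 0 (∑ i ∈ s, c i ^ 2).toNNReal := by
  classical
  induction s using Finset.induction_on with
  | empty =>
    simp [gaussianReal_zero_var]
  | insert i s hi ih =>
    have hind' : iIndepFun (fun i ω => c i * X i ω) P :=
      hind.comp (fun i x => c i * x) fun i => measurable_const_mul (c i)
    have hm : ∀ i, Measurable fun ω => c i * X i ω := fun i => (hX i).const_mul _
    have h1 : IndepFun (fun ω => c i * X i ω) (fun ω => ∑ j ∈ s, c j * X j ω) P := by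
      have := (hind'.indepFun_finsetSum_of_notMem hm hi).symm
      convert this using 1
      ext ω
      simp
    have h2 : P.map (fun ω => c i * X i ω) = gaussianReal 0 (c i ^ 2).toNNReal := by
      have := gaussianReal_map_const_mul (μ := 0) (v := 1) (c i)
      rw [← hlaw i, Measure.map_map (measurable_const_mul _) (hX i)] at this
      rw [mul_zero, mul_one] at this
      rw [Real.toNNReal_of_nonneg (sq_nonneg _)]
      exact this
    have := gaussianReal_add_gaussianReal_of_indepFun h1 h2 ih
    rw [Finset.sum_insert hi, Real.toNNReal_add (sq_nonneg _)
      (Finset.sum_nonneg fun _ _ => sq_nonneg _)]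
    convert this using 2
    · ext ω
      simp [Finset.sum_insert hi]
    · simp

/-- The law of the reward noise. -/
noncomputable abbrev noiseLaw (n : ℕ) : Measure (Fin n → ℝ) :=
  Measure.pi fun _ : Fin n => gaussianReal 0 1

/-- A finite noise vector, extended by zero to all times. -/
noncomputable def noise {n : ℕ} (η : Fin n → ℝ) (t : ℕ) : ℝ := if h : t < n then η ⟨t, h⟩ else 0

lemma measurable_noise {n : ℕ} (t : ℕ) : Measurable fun η : Fin n → ℝ => noise η t := by
  unfold noise
  by_cases h : t < n
  · simpa [h] using measurable_pi_apply _
  · simp [h]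

lemma map_sum_noise {n : ℕ} {ι : Type*} [Fintype ι] (e : ι → ℕ) (he : Function.Injective e)
    (hn : ∀ a, e a < n) (c : ι → ℝ) :
    (noiseLaw n).map (fun η => ∑ a, c a * noise η (e a)) =
      gaussianReal 0 (∑ a, c a ^ 2).toNNReal := by
  have hind : iIndepFun (fun (i : Fin n) (η : Fin n → ℝ) => η i) (noiseLaw n) :=
    iIndepFun_pi (X := fun _ => id) fun _ => aemeasurable_id
  have hinj : Function.Injective fun a => (⟨e a, hn a⟩ : Fin n) := by
    intro a b h
    exact he (by simpa using h)
  have := map_sum_mul_gaussian (P := noiseLaw n) (X := fun a η => η ⟨e a, hn a⟩)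
    (fun a => measurable_pi_apply _)
    (fun a => (measurePreserving_eval (fun _ : Fin n => gaussianReal 0 1) ⟨e a, hn a⟩).map_eq)
    (hind.precomp hinj) c Finset.univ
  simpa [noise, hn] using this

lemma integrable_sq_of_map_gaussian {Ω : Type*} [MeasurableSpace Ω] {P : Measure Ω}
    {Y : Ω → ℝ} (hY : Measurable Y) {v : NNReal} (h : P.map Y = gaussianReal 0 v) :
    Integrable (fun ω => Y ω ^ 2) P ∧ ∫ ω, Y ω ^ 2 ∂P = v := by
  have hmem : MemLp id 2 (gaussianReal 0 v) := memLp_id_gaussianReal 2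
  have hinteg : Integrable (fun x : ℝ => x ^ 2) (P.map Y) := by
    rw [h]
    simpa using hmem.integrable_sq
  refine ⟨hinteg.comp_measurable hY, ?_⟩
  have h1 : ∫ ω, Y ω ^ 2 ∂P = ∫ x, x ^ 2 ∂(P.map Y) :=
    (integral_map hY.aemeasurable
      (continuous_pow 2).aestronglyMeasurable).symm
  rw [h1, h]
  have := variance_eq_sub hmem
  rw [variance_id_gaussianReal] at this
  simpa using this.symm

lemma integrable_pow_four_of_map_gaussian {Ω : Type*} [MeasurableSpace Ω] {P : Measure Ω}
    {Y : Ω → ℝ} (hY : Measurable Y) {v : NNReal} (hv : 0 < v) (h : P.map Y = gaussianReal 0 v) :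
    Integrable (fun ω => Y ω ^ 4) P ∧ ∫ ω, Y ω ^ 4 ∂P ≤ 48 * (v : ℝ) ^ 2 := by
  have hmem : MemLp id 4 (gaussianReal 0 v) := memLp_id_gaussianReal 4
  have hinteg : Integrable (fun x : ℝ => x ^ 4) (gaussianReal 0 v) := by
    have := hmem.integrable_norm_pow (by norm_num)
    simpa [Even.pow_abs (show Even 4 by decide)] using this
  refine ⟨Integrable.comp_measurable (g := fun x : ℝ => x ^ 4) (by rwa [h]) hY, ?_⟩
  have h1 : ∫ ω, Y ω ^ 4 ∂P = ∫ x, x ^ 4 ∂(P.map Y) :=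
    (integral_map hY.aemeasurable
      (continuous_pow 4).aestronglyMeasurable).symm
  rw [h1, h]
  have hv' : (0 : ℝ) < v := by exact_mod_cast hv
  set l : ℝ := (√(v : ℝ))⁻¹ with hl
  have hlsq : l ^ 2 = (v : ℝ)⁻¹ := by
    rw [hl, inv_pow, Real.sq_sqrt hv'.le]
  have hexp : ∀ t : ℝ, Integrable (fun x => Real.exp (t * x)) (gaussianReal 0 v) :=
    fun t => integrable_exp_mul_gaussianReal t
  have hval : ∀ t : ℝ, t ^ 2 = (v : ℝ)⁻¹ →
      ∫ x, Real.exp (t * x) ∂(gaussianReal 0 v) = Real.exp (1 / 2) := by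
    intro t ht
    have := congrFun (mgf_id_gaussianReal (μ := 0) (v := v)) t
    simp only [mgf, id, zero_mul, zero_add] at this
    rw [this, ht]
    congr 1
    field_simp
  have hle : ∀ x : ℝ, x ^ 4 ≤ (v : ℝ) ^ 2 * (12 * (Real.exp (l * x) + Real.exp (-l * x))) := by
    intro x
    have hc : (l * x) ^ 4 ≤ 12 * (Real.exp (l * x) + Real.exp (-l * x)) := by
      have key : ∀ y : ℝ, 0 ≤ y → y ^ 4 ≤ 24 * Real.exp y := by
        intro y hy
        have := Real.pow_div_factorial_le_exp y hy 4
        norm_num [Nat.factorial] at this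
        linarith
      have key2 : ∀ y : ℝ, 0 ≤ y → y ^ 4 ≤ 12 * (Real.exp y + Real.exp (-y)) := by
        intro y hy
        have h2 := Real.cosh_eq y
        have h3 : 1 + y ^ 2 / 2 + y ^ 4 / 24 ≤ Real.cosh y := by
          have := Real.hasSum_cosh y
          have h4 := sum_le_hasSum (Finset.range 3) (fun i _ => by
            rw [pow_mul]; positivity) this
          norm_num [Finset.sum_range_succ, Nat.factorial] at h4
          linarith
        nlinarith [sq_nonneg y]
      rcases le_total 0 (l * x) with h0 | h0
      · simpa using key2 _ h0
      · have := key2 (-(l * x)) (by linarith)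
        rw [neg_neg, Even.neg_pow (by decide)] at this
        rw [neg_mul]
        linarith
    have : (v : ℝ) ^ 2 * (l * x) ^ 4 = x ^ 4 := by
      rw [mul_pow, show l ^ 4 = (l ^ 2) ^ 2 by ring, hlsq]
      field_simp
    rw [← this]
    gcongr
  calc ∫ x, x ^ 4 ∂(gaussianReal 0 v)
      ≤ ∫ x, (v : ℝ) ^ 2 * (12 * (Real.exp (l * x) + Real.exp (-l * x))) ∂(gaussianReal 0 v) :=
        integral_mono hinteg ((((hexp l).add (hexp (-l))).const_mul 12).const_mul _) hle
    _ = (v : ℝ) ^ 2 * (12 * (Real.exp (1 / 2) + Real.exp (1 / 2))) := by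
        rw [integral_const_mul, integral_const_mul, integral_add (hexp l) (hexp (-l)),
          hval l hlsq, hval (-l) (by rw [neg_sq, hlsq])]
    _ ≤ 48 * (v : ℝ) ^ 2 := by
        have : Real.exp (1 / 2) ≤ 2 := by
          have h1 : Real.exp (1 / 2) ^ 2 = Real.exp 1 := by
            rw [← Real.exp_nat_mul]; norm_num
          have := Real.exp_one_lt_d9
          nlinarith [Real.exp_pos (1 / 2)]
        nlinarith [sq_nonneg (v : ℝ)]

lemma integral_sum_noise_sq {n : ℕ} {ι : Type*} [Fintype ι] (e : ι → ℕ)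
    (he : Function.Injective e) (hn : ∀ a, e a < n) (c : ι → ℝ) :
    Integrable (fun η => (∑ a, c a * noise η (e a)) ^ 2) (noiseLaw n) ∧
      ∫ η, (∑ a, c a * noise η (e a)) ^ 2 ∂(noiseLaw n) = ∑ a, c a ^ 2 := by
  have hm : Measurable fun η : Fin n → ℝ => ∑ a, c a * noise η (e a) :=
    Finset.measurable_sum _ fun a _ => (measurable_noise _).const_mul _
  have := integrable_sq_of_map_gaussian hm (map_sum_noise e he hn c)
  rwa [Real.coe_toNNReal _ (Finset.sum_nonneg fun _ _ => sq_nonneg _)] at this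

/-- Anti-concentration of a centred Gaussian. -/
lemma gaussian_small_ball {v : ℝ} (hv : 0 < v) :
    gaussianReal 0 v.toNNReal {x | x ^ 2 < v / 16} ≤ 1 / 4 := by
  have hv' : v.toNNReal ≠ 0 := by simpa using hv
  have hset : {x : ℝ | x ^ 2 < v / 16} ⊆ Set.Ioo (-(√v / 4)) (√v / 4) := by
    intro x hx
    have hx : x ^ 2 < v / 16 := hx
    have h1 : x ^ 2 < (√v / 4) ^ 2 := by
      rw [div_pow, Real.sq_sqrt hv.le]; linarith
    exact abs_lt.1 (abs_lt_of_sq_lt_sq h1 (by positivity))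
  refine (measure_mono hset).trans ?_
  rw [gaussianReal_apply _ hv']
  have hpdf : ∀ x, gaussianPDF 0 v.toNNReal x ≤ ENNReal.ofReal ((2 * √v)⁻¹) := by
    intro x
    rw [gaussianPDF]
    apply ENNReal.ofReal_le_ofReal
    rw [gaussianPDFReal, Real.coe_toNNReal _ hv.le]
    have h1 : Real.exp (-(x - 0) ^ 2 / (2 * v)) ≤ 1 := by
      rw [Real.exp_le_one_iff]
      apply div_nonpos_of_nonpos_of_nonneg <;> nlinarith [sq_nonneg (x - 0)]
    have h2 : 2 * √v ≤ √(2 * Real.pi * v) := by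
      apply Real.le_sqrt_of_sq_le
      rw [mul_pow, Real.sq_sqrt hv.le]
      nlinarith [Real.pi_gt_three]
    have h3 : (√(2 * Real.pi * v))⁻¹ ≤ (2 * √v)⁻¹ := by
      apply inv_anti₀ (by positivity) h2
    calc _ ≤ (√(2 * Real.pi * v))⁻¹ * 1 := by gcongr
      _ ≤ _ := by simpa using h3
  calc _ ≤ ∫⁻ x in Set.Ioo (-(√v / 4)) (√v / 4), ENNReal.ofReal ((2 * √v)⁻¹) :=
        lintegral_mono fun x => hpdf x
    _ = ENNReal.ofReal ((2 * √v)⁻¹) * ENNReal.ofReal (√v / 2) := by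
        rw [setLIntegral_const, Real.volume_Ioo]
        congr 2
        ring
    _ = ENNReal.ofReal (1 / 4) := by
        rw [← ENNReal.ofReal_mul (by positivity)]
        congr 1
        have : √v ≠ 0 := by positivity
        field_simp
        norm_num
    _ = 1 / 4 := by
        rw [ENNReal.ofReal_div_of_pos (by norm_num)]
        simp

/-- The exploratory direction obtained from a Gaussian seed. -/
noncomputable def seedDir {d : ℕ} (g : Fin d → ℝ) : EuclideanSpace ℝ (Fin d) :=
  if ∑ i, g i ^ 2 ≤ 4 * d then (2 * √d)⁻¹ • WithLp.toLp 2 g else 0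

lemma measurable_seedDir {d : ℕ} : Measurable (seedDir (d := d)) := by
  unfold seedDir
  refine Measurable.ite (measurableSet_le (by fun_prop) measurable_const) ?_ measurable_const
  exact (WithLp.measurable_toLp 2 (Fin d → ℝ)).const_smul ((2 * √(d : ℝ))⁻¹)

lemma norm_seedDir_le {d : ℕ} (g : Fin d → ℝ) : ‖seedDir g‖ ≤ 1 := by
  unfold seedDir
  split_ifs with h
  · have h1 : ‖WithLp.toLp 2 g‖ ≤ 2 * √d := by
      rw [EuclideanSpace.norm_eq]
      apply Real.sqrt_le_iff.2
      refine ⟨by positivity, ?_⟩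
      rw [mul_pow, Real.sq_sqrt (Nat.cast_nonneg d)]
      simp only [Real.norm_eq_abs, sq_abs]
      linarith
    rw [norm_smul, Real.norm_of_nonneg (by positivity)]
    exact inv_mul_le_one_of_le₀ h1 (by positivity)
  · simp

lemma seedDir_bad {d : ℕ} (hd : 0 < d) {θ : EuclideanSpace ℝ (Fin d)} {r : ℝ} (hr : 0 < r)
    (hθ : ‖θ‖ = r) :
    noiseLaw d {g | ⟪seedDir g, θ⟫ ^ 2 < r ^ 2 / (64 * d)} ≤ 1 / 2 := by
  have hd' : (0 : ℝ) < d := by exact_mod_cast hd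
  have hinj : Function.Injective fun i : Fin d => (i : ℕ) := Fin.val_injective
  have hθsq : ∑ i, θ i ^ 2 = r ^ 2 := by
    rw [← hθ, EuclideanSpace.norm_sq_eq]
    simp
  have hlaw := map_sum_noise (n := d) (fun i : Fin d => (i : ℕ)) hinj (fun i => i.2) fun i => θ i
  rw [hθsq] at hlaw
  simp only [noise, Fin.is_lt, dite_true, Fin.eta] at hlaw
  have hm : Measurable fun g : Fin d → ℝ => ∑ i, θ i * g i := by fun_prop
  have hS : noiseLaw d {g | (∑ i, θ i * g i) ^ 2 < r ^ 2 / 16} ≤ 1 / 4 := by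
    refine le_trans (le_of_eq ?_) (gaussian_small_ball (v := r ^ 2) (by positivity))
    rw [← hlaw, Measure.map_apply hm]
    · rfl
    · exact measurableSet_lt (by fun_prop) measurable_const
  have hsq : ∀ i : Fin d, Integrable (fun g : Fin d → ℝ => g i ^ 2) (noiseLaw d) ∧
      ∫ g, g i ^ 2 ∂(noiseLaw d) = 1 := by
    intro i
    have := integrable_sq_of_map_gaussian (P := noiseLaw d) (Y := fun g => g i)
      (measurable_pi_apply i) (measurePreserving_eval (fun _ : Fin d => gaussianReal 0 1) i).map_eq
    simpa using this
  have hN : noiseLaw d {g | 4 * (d : ℝ) ≤ ∑ i, g i ^ 2} ≤ 1 / 4 := by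
    have hinteg : Integrable (fun g : Fin d → ℝ => ∑ i, g i ^ 2) (noiseLaw d) :=
      integrable_finsetSum _ fun i _ => (hsq i).1
    have := mul_meas_ge_le_integral_of_nonneg
      (ae_of_all _ fun g : Fin d → ℝ => Finset.sum_nonneg fun i _ => sq_nonneg (g i)) hinteg
      (4 * (d : ℝ))
    rw [integral_finsetSum _ fun i _ => (hsq i).1] at this
    simp only [(hsq _).2, Finset.sum_const, Finset.card_univ, Fintype.card_fin, nsmul_eq_mul,
      mul_one] at this
    have h2 : (noiseLaw d).real {g | 4 * (d : ℝ) ≤ ∑ i, g i ^ 2} ≤ 1 / 4 := by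
      rw [le_div_iff₀ (by norm_num)]
      have h3 := (mul_le_mul_iff_right₀ hd').1
        (show (d : ℝ) * ((noiseLaw d).real {g | 4 * (d : ℝ) ≤ ∑ i, g i ^ 2} * 4) ≤ d * 1 by
          linarith)
      exact h3
    rw [← ENNReal.ofReal_toReal (measure_ne_top (noiseLaw d) _)]
    refine (ENNReal.ofReal_le_ofReal h2).trans ?_
    rw [ENNReal.ofReal_div_of_pos (by norm_num)]
    simp
  have hsub : {g : Fin d → ℝ | ⟪seedDir g, θ⟫ ^ 2 < r ^ 2 / (64 * d)} ⊆
      {g | (∑ i, θ i * g i) ^ 2 < r ^ 2 / 16} ∪ {g | 4 * (d : ℝ) ≤ ∑ i, g i ^ 2} := by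
    intro g hg
    by_cases h : ∑ i, g i ^ 2 ≤ 4 * d
    · left
      have hg : ⟪seedDir g, θ⟫ ^ 2 < r ^ 2 / (64 * d) := hg
      have h1 : ⟪seedDir g, θ⟫ = (2 * √d)⁻¹ * ∑ i, θ i * g i := by
        rw [seedDir, if_pos h, real_inner_smul_left]
        simp [PiLp.inner_apply]
      rw [h1, mul_pow, inv_pow, mul_pow, Real.sq_sqrt hd'.le] at hg
      change (∑ i, θ i * g i) ^ 2 < r ^ 2 / 16
      rw [inv_mul_lt_iff₀ (by positivity)] at hg
      refine hg.trans_le (le_of_eq ?_)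
      field_simp
      norm_num
    · right
      exact (not_le.1 h).le
  refine (measure_mono hsub).trans ((measure_union_le _ _).trans ((add_le_add hS hN).trans ?_))
  rw [← ENNReal.toReal_le_toReal (by finiteness) (by finiteness),
    ENNReal.toReal_add (by finiteness) (by finiteness)]
  norm_num

lemma seedDir_all_bad {d L : ℕ} (hd : 0 < d) {θ : EuclideanSpace ℝ (Fin d)} {r : ℝ} (hr : 0 < r)
    (hθ : ‖θ‖ = r) :
    (Measure.pi fun _ : Fin L => noiseLaw d).real
      {w | ∀ j, ⟪seedDir (w j), θ⟫ ^ 2 < r ^ 2 / (64 * d)} ≤ (1 / 2) ^ L := by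
  have h : {w : Fin L → Fin d → ℝ | ∀ j, ⟪seedDir (w j), θ⟫ ^ 2 < r ^ 2 / (64 * d)} =
      Set.univ.pi fun _ => {g | ⟪seedDir g, θ⟫ ^ 2 < r ^ 2 / (64 * d)} := by
    ext w
    simp
  rw [h, Measure.real, Measure.pi_pi, ENNReal.toReal_prod, Finset.prod_const, Finset.card_univ,
    Fintype.card_fin]
  refine pow_le_pow_left₀ ENNReal.toReal_nonneg ?_ L
  have := ENNReal.toReal_mono (by finiteness) (seedDir_bad hd hr hθ)
  simpa using this

lemma measurableSet_all_bad {d L : ℕ} (θ : EuclideanSpace ℝ (Fin d)) (c : ℝ) :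
    MeasurableSet {w : Fin L → Fin d → ℝ | ∀ j, ⟪seedDir (w j), θ⟫ ^ 2 < c} := by
  simp only [Set.ofPred_forall]
  refine MeasurableSet.iInter fun j => measurableSet_lt ?_ measurable_const
  exact ((measurable_seedDir.comp (measurable_pi_apply j)).inner_const).pow_const 2

section Geometry

variable {E : Type*} [NormedAddCommGroup E] [InnerProductSpace ℝ E]

/-- The unit vector in the direction of `v`, or `0` if `v = 0`. -/
noncomputable def unitize (v : E) : E := ‖v‖⁻¹ • v

lemma norm_unitize_le (v : E) : ‖unitize v‖ ≤ 1 := by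
  rw [unitize, norm_smul, norm_inv, norm_norm]
  exact inv_mul_le_one

/-- One noisy power iteration doubles the squared correlation with `θ`. -/
lemma two_mul_le_inner_unitize_sq {A θ Z : E} {r s : ℝ} (hr : 0 < r) (hθ : ‖θ‖ = r)
    (hs0 : 0 ≤ s) (hs : s ≤ 1 / 32) (hA : s * r ^ 2 ≤ ⟪A, θ⟫ ^ 2) (hZ : ‖Z‖ ^ 2 ≤ r ^ 4 / 32)
    (hZθ : ⟪Z, θ⟫ ^ 2 ≤ s * r ^ 6 / 4) :
    2 * s * r ^ 2 ≤ ⟪unitize (⟪A, θ⟫ • θ + Z), θ⟫ ^ 2 := by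
  set c := ⟪A, θ⟫ with hc
  set v := c • θ + Z with hv
  have hD : ⟪v, θ⟫ = c * r ^ 2 + ⟪Z, θ⟫ := by
    rw [hv, inner_add_left, real_inner_smul_left, real_inner_self_eq_norm_sq, hθ]
  set z := ⟪Z, θ⟫
  have hz : z ^ 2 ≤ (c * r ^ 2 / 2) ^ 2 := by
    have := mul_le_mul_of_nonneg_right hA (by positivity : 0 ≤ r ^ 4 / 4)
    nlinarith
  have hDsq : (c * r ^ 2 / 2) ^ 2 ≤ ⟪v, θ⟫ ^ 2 := by
    rw [hD]
    have := sq_le_sq.1 hz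
    apply sq_le_sq.2
    have h1 : |c * r ^ 2 / 2| + |c * r ^ 2 / 2| = |c * r ^ 2| := by
      rw [abs_div, abs_two]; ring
    have h2 := abs_sub_abs_le_abs_add (c * r ^ 2) z
    linarith
  have hvn : ‖v‖ ^ 2 ≤ 2 * (c ^ 2 * r ^ 2) + 2 * ‖Z‖ ^ 2 := by
    have h1 := norm_add_le (c • θ) Z
    rw [norm_smul, hθ, Real.norm_eq_abs] at h1
    have h2 : ‖v‖ ^ 2 ≤ (|c| * r + ‖Z‖) ^ 2 := by gcongr
    nlinarith [sq_nonneg (|c| * r - ‖Z‖), sq_abs c]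
  have hkey : 2 * s * r ^ 2 * ‖v‖ ^ 2 ≤ ⟪v, θ⟫ ^ 2 := by
    refine le_trans ?_ hDsq
    have h1 : 2 * s * r ^ 2 * ‖v‖ ^ 2 ≤
        2 * s * r ^ 2 * (2 * (c ^ 2 * r ^ 2) + 2 * (r ^ 4 / 32)) := by
      gcongr
      linarith
    have h2 : s * (c ^ 2 * r ^ 4) ≤ 1 / 32 * (c ^ 2 * r ^ 4) := by gcongr
    have h3 := mul_le_mul_of_nonneg_right hA (by positivity : 0 ≤ r ^ 4)
    nlinarith
  by_cases hv0 : v = 0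
  · have hc0 : c ^ 2 = 0 := by
      rw [hv0, inner_zero_left] at hDsq
      have : 0 < r ^ 4 := by positivity
      nlinarith [sq_nonneg c]
    rw [hc0] at hA
    nlinarith [sq_nonneg ⟪unitize v, θ⟫]
  · have hvp : 0 < ‖v‖ := norm_pos_iff.2 hv0
    rw [unitize, real_inner_smul_left, mul_pow, inv_pow, le_inv_mul_iff₀ (by positivity)]
    linarith

/-- The squared sine of the angle between `θ` and a noisy copy of a multiple of `θ`. -/
lemma sub_le_inner_unitize_sq {A θ Z : E} {r : ℝ} (hθ : ‖θ‖ = r) (hA : ⟪A, θ⟫ ≠ 0) :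
    r ^ 2 - ‖Z‖ ^ 2 / ⟪A, θ⟫ ^ 2 ≤ ⟪unitize (⟪A, θ⟫ • θ + Z), θ⟫ ^ 2 := by
  set c := ⟪A, θ⟫
  set v := c • θ + Z with hv
  have h1 : ‖Z‖ ^ 2 / c ^ 2 = ‖θ - c⁻¹ • v‖ ^ 2 := by
    have : θ - c⁻¹ • v = -(c⁻¹ • Z) := by
      rw [hv, smul_add, smul_smul, inv_mul_cancel₀ hA, one_smul]
      abel
    rw [this, norm_neg, norm_smul, mul_pow, Real.norm_eq_abs, sq_abs]
    field_simp
  have h2 : v = ‖v‖ • unitize v := by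
    by_cases hv0 : v = 0
    · simp [hv0]
    · rw [unitize, smul_smul, mul_inv_cancel₀ (norm_ne_zero_iff.2 hv0), one_smul]
  have h3 : ‖θ - c⁻¹ • v‖ ^ 2 = r ^ 2 - 2 * (c⁻¹ * ‖v‖ * ⟪unitize v, θ⟫) + (c⁻¹ * ‖v‖) ^ 2 := by
    rw [norm_sub_sq_real, hθ, real_inner_smul_right, norm_smul, Real.norm_eq_abs, mul_pow,
      sq_abs, real_inner_comm, ← mul_pow]
    nth_rewrite 1 [h2]
    rw [real_inner_smul_left]
    ring
  rw [h1, h3]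
  nlinarith [sq_nonneg (c⁻¹ * ‖v‖ - ⟪unitize v, θ⟫)]

lemma inner_half_add_sq_sub (A e θ : E) :
    ⟪(1 / 2 : ℝ) • (A + e), θ⟫ ^ 2 - ⟪(1 / 2 : ℝ) • (A - e), θ⟫ ^ 2 = ⟪A, θ⟫ * ⟪e, θ⟫ := by
  rw [real_inner_smul_left, real_inner_smul_left, inner_add_left, inner_sub_left]
  ring

end Geometry

section Algorithm

variable {d : ℕ}

/-- The average of `x` over the `j`-th block of length `M₀`. -/
noncomputable def blockMean (M₀ : ℕ) (x : ℕ → ℝ) (j : ℕ) : ℝ :=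
  (∑ p ∈ Finset.range M₀, x (j * M₀ + p)) / M₀

/-- The vector of averaged paired differences of `x` over a round starting at time `b`. -/
noncomputable def diffMean (d M : ℕ) (x : ℕ → ℝ) (b : ℕ) : EuclideanSpace ℝ (Fin d) :=
  WithLp.toLp 2 fun i : Fin d =>
    (∑ p ∈ Finset.range M, (x (b + 2 * (p * d + i)) - x (b + 2 * (p * d + i) + 1))) / M

lemma coordVec_eq (m : ℕ) (i : Fin d) (h : m % d = i) :
    (WithLp.toLp 2 fun j : Fin d => if (j : ℕ) = m % d then (1 : ℝ) else 0) =
      EuclideanSpace.single i 1 := by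
  ext j
  simp [h, Fin.val_inj]

lemma norm_coordVec_le (m : ℕ) :
    ‖(WithLp.toLp 2 fun j : Fin d => if (j : ℕ) = m % d then (1 : ℝ) else 0)‖ ≤ 1 := by
  rcases Nat.eq_zero_or_pos d with rfl | hd
  · rw [EuclideanSpace.norm_eq]
    simp
  · rw [coordVec_eq m ⟨m % d, Nat.mod_lt _ hd⟩ rfl]
    simp

lemma slot_lt {M p : ℕ} (hp : p < M) (i : Fin d) : p * d + i < M * d := by
  have : (p + 1) * d ≤ M * d := Nat.mul_le_mul_right d hp
  rw [add_mul] at this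
  omega

lemma measurable_diffMean {α : Type*} [MeasurableSpace α] {x : α → ℕ → ℝ}
    (hx : ∀ s, Measurable fun z => x z s) (M b : ℕ) :
    Measurable fun z => diffMean d M (x z) b := by
  unfold diffMean
  refine (WithLp.measurable_toLp 2 (Fin d → ℝ)).comp (measurable_pi_lambda _ fun i => ?_)
  exact (Finset.measurable_sum _ fun p _ => (hx _).sub (hx _)).div_const _

/-- The parameters of the exploration schedule: `L` candidate directions played `M₀` times each,
acceptance threshold `τ`, then rounds `0, …, R` of `2 * d * M` plays each. -/
structure Schedule where
  /-- number of candidate initial directions -/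
  L : ℕ
  /-- number of plays of each candidate -/
  M₀ : ℕ
  /-- number of plays of each direction in a round -/
  M : ℕ
  /-- index of the last round -/
  R : ℕ
  /-- acceptance threshold for the candidates -/
  τ : ℝ

namespace Schedule

variable (S : Schedule)

/-- The last of the first `m` candidates whose estimated reward is at least `τ`. -/
noncomputable def pick (a : ℕ → EuclideanSpace ℝ (Fin d)) (x : ℕ → ℝ) :
    ℕ → EuclideanSpace ℝ (Fin d)
  | 0 => 0
  | m + 1 => if S.τ ≤ blockMean S.M₀ x m then a m else pick a x m

/-- The first time step of round `k`. -/
def start (d k : ℕ) : ℕ := S.L * S.M₀ + 2 * (k * S.M * d)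

/-- The base direction used in round `k`. -/
noncomputable def base (a : ℕ → EuclideanSpace ℝ (Fin d)) (x : ℕ → ℝ) :
    ℕ → EuclideanSpace ℝ (Fin d)
  | 0 => S.pick a x S.L
  | k + 1 => unitize (diffMean d S.M x (S.start d k))

/-- The action at time `t`, given candidates `a` and rewards `x`. -/
noncomputable def action (a : ℕ → EuclideanSpace ℝ (Fin d)) (x : ℕ → ℝ) (t : ℕ) :
    EuclideanSpace ℝ (Fin d) :=
  if t < S.L * S.M₀ then a (t / S.M₀)
  else
    let q := (t - S.L * S.M₀) / 2
    let k := q / d / S.M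
    let e : EuclideanSpace ℝ (Fin d) := WithLp.toLp 2 fun i => if (i : ℕ) = q % d then 1 else 0
    if k ≤ S.R then
      (1 / 2 : ℝ) •
        if (t - S.L * S.M₀) % 2 = 0 then S.base a x k + e else S.base a x k - e
    else S.base a x (S.R + 1)

lemma norm_pick_le {a : ℕ → EuclideanSpace ℝ (Fin d)} (ha : ∀ j, ‖a j‖ ≤ 1) (x : ℕ → ℝ) (m : ℕ) :
    ‖S.pick a x m‖ ≤ 1 := by
  induction m with
  | zero => simp [pick]
  | succ m ih =>
    rw [pick]
    split_ifs
    exacts [ha m, ih]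

lemma norm_base_le {a : ℕ → EuclideanSpace ℝ (Fin d)} (ha : ∀ j, ‖a j‖ ≤ 1) (x : ℕ → ℝ) (k : ℕ) :
    ‖S.base a x k‖ ≤ 1 := by
  cases k with
  | zero => exact S.norm_pick_le ha x _
  | succ k => exact norm_unitize_le _

lemma norm_action_le {a : ℕ → EuclideanSpace ℝ (Fin d)} (ha : ∀ j, ‖a j‖ ≤ 1) (x : ℕ → ℝ)
    (t : ℕ) : ‖S.action a x t‖ ≤ 1 := by
  have hb := S.norm_base_le ha x
  rw [action]
  by_cases h : t < S.L * S.M₀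
  · rw [if_pos h]
    exact ha _
  · rw [if_neg h]
    extract_lets q k e
    have he : ‖e‖ ≤ 1 := norm_coordVec_le _
    split_ifs
    · rw [norm_smul]
      have := norm_add_le (S.base a x k) e
      norm_num
      linarith [hb k]
    · rw [norm_smul]
      have := norm_sub_le (S.base a x k) e
      norm_num
      linarith [hb k]
    · exact hb _

lemma pick_congr (a : ℕ → EuclideanSpace ℝ (Fin d)) {x y : ℕ → ℝ} {T m : ℕ}
    (h : ∀ s < T, x s = y s) (hm : m * S.M₀ ≤ T) : S.pick a x m = S.pick a y m := by
  induction m with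
  | zero => rfl
  | succ m ih =>
    have h1 : blockMean S.M₀ x m = blockMean S.M₀ y m := by
      unfold blockMean
      congr 1
      refine Finset.sum_congr rfl fun p hp => h _ ?_
      have := Finset.mem_range.1 hp
      rw [add_mul] at hm
      omega
    rw [pick, pick, h1, ih (le_trans (Nat.mul_le_mul_right _ (Nat.le_succ m)) hm)]

lemma base_congr (a : ℕ → EuclideanSpace ℝ (Fin d)) {x y : ℕ → ℝ} {T k : ℕ}
    (h : ∀ s < T, x s = y s) (hk : S.start d k ≤ T) : S.base a x k = S.base a y k := by
  cases k with
  | zero => exact S.pick_congr a h (by simpa [start] using hk)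
  | succ k =>
    rw [base, base]
    congr 1
    unfold diffMean
    congr 1
    ext i
    congr 1
    refine Finset.sum_congr rfl fun p hp => ?_
    have h1 := slot_lt (Finset.mem_range.1 hp) i
    have h2 : S.start d k + 2 * (S.M * d) ≤ T := by
      refine le_trans (le_of_eq ?_) hk
      simp only [start]
      ring
    rw [h _ (by omega), h _ (by omega)]

lemma action_congr (a : ℕ → EuclideanSpace ℝ (Fin d)) {x y : ℕ → ℝ} {t : ℕ}
    (h : ∀ s < t, x s = y s) : S.action a x t = S.action a y t := by
  rw [action, action]
  by_cases h0 : t < S.L * S.M₀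
  · rw [if_pos h0, if_pos h0]
  · rw [if_neg h0, if_neg h0]
    have key : ∀ k, k ≤ (t - S.L * S.M₀) / 2 / d / S.M → S.base a x k = S.base a y k := by
      intro k hk
      refine S.base_congr a h ?_
      have h1 := Nat.mul_le_of_le_div _ _ _ hk
      have h2 := Nat.mul_le_of_le_div _ _ _ h1
      simp only [start]
      omega
    extract_lets q k e
    split_ifs with hk
    · rw [key k le_rfl]
    · rw [key k le_rfl]
    · exact key _ (Nat.succ_le_of_lt (not_le.1 hk))

lemma measurable_pick {α : Type*} [MeasurableSpace α] {a : α → ℕ → EuclideanSpace ℝ (Fin d)}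
    {x : α → ℕ → ℝ} (ha : ∀ j, Measurable fun z => a z j) (hx : ∀ s, Measurable fun z => x z s)
    (m : ℕ) : Measurable fun z => S.pick (a z) (x z) m := by
  induction m with
  | zero => exact measurable_const
  | succ m ih =>
    simp only [pick]
    refine Measurable.ite (measurableSet_le measurable_const ?_) (ha m) ih
    unfold blockMean
    exact (Finset.measurable_sum _ fun p _ => hx _).div_const _

lemma measurable_base {α : Type*} [MeasurableSpace α] {a : α → ℕ → EuclideanSpace ℝ (Fin d)}
    {x : α → ℕ → ℝ} (ha : ∀ j, Measurable fun z => a z j) (hx : ∀ s, Measurable fun z => x z s)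
    (k : ℕ) : Measurable fun z => S.base (a z) (x z) k := by
  cases k with
  | zero => exact S.measurable_pick ha hx _
  | succ k =>
    have := measurable_diffMean (d := d) hx S.M (S.start d k)
    exact this.norm.inv.smul this

lemma measurable_action {α : Type*} [MeasurableSpace α] {a : α → ℕ → EuclideanSpace ℝ (Fin d)}
    {x : α → ℕ → ℝ} (ha : ∀ j, Measurable fun z => a z j) (hx : ∀ s, Measurable fun z => x z s)
    (t : ℕ) : Measurable fun z => S.action (a z) (x z) t := by
  have hb := S.measurable_base ha hx
  unfold action
  extract_lets q k e
  split_ifs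
  · exact ha _
  · exact ((hb k).add_const e).const_smul (1 / 2 : ℝ)
  · exact ((hb k).sub_const e).const_smul (1 / 2 : ℝ)
  · exact hb _

lemma action_of_lt (a : ℕ → EuclideanSpace ℝ (Fin d)) (x : ℕ → ℝ) {j p : ℕ} (hj : j < S.L)
    (hp : p < S.M₀) : S.action a x (j * S.M₀ + p) = a j := by
  have h1 : j * S.M₀ + p < S.L * S.M₀ := by
    have : (j + 1) * S.M₀ ≤ S.L * S.M₀ := Nat.mul_le_mul_right _ hj
    rw [add_mul] at this
    omega
  rw [action, if_pos h1]
  congr 1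
  rw [mul_comm, Nat.mul_add_div (by omega), Nat.div_eq_of_lt hp, add_zero]

lemma slot_div_mod {k p : ℕ} (hp : p < S.M) (i : Fin d) :
    (k * S.M * d + (p * d + i)) % d = i ∧ (k * S.M * d + (p * d + i)) / d / S.M = k := by
  have hd : 0 < d := i.pos
  have h : k * S.M * d + (p * d + i) = d * (k * S.M + p) + i := by ring
  rw [h]
  constructor
  · rw [Nat.mul_add_mod, Nat.mod_eq_of_lt i.2]
  · rw [Nat.mul_add_div hd, Nat.div_eq_of_lt i.2, add_zero, mul_comm,
      Nat.mul_add_div (by omega), Nat.div_eq_of_lt hp, add_zero]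

lemma action_round_even (a : ℕ → EuclideanSpace ℝ (Fin d)) (x : ℕ → ℝ) {k p : ℕ} (hk : k ≤ S.R)
    (hp : p < S.M) (i : Fin d) :
    S.action a x (S.start d k + 2 * (p * d + i)) =
      (1 / 2 : ℝ) • (S.base a x k + EuclideanSpace.single i 1) := by
  obtain ⟨h1, h2⟩ := S.slot_div_mod (k := k) hp i
  have h3 : S.start d k + 2 * (p * d + i) - S.L * S.M₀ = 2 * (k * S.M * d + (p * d + i)) := by
    simp only [start]
    omega
  rw [action, if_neg (by simp only [start]; omega)]
  simp only [h3, Nat.mul_div_cancel_left _ (show 0 < 2 by norm_num), h2, if_pos hk,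
    Nat.mul_mod_right, if_true, coordVec_eq _ i h1]

lemma action_round_odd (a : ℕ → EuclideanSpace ℝ (Fin d)) (x : ℕ → ℝ) {k p : ℕ} (hk : k ≤ S.R)
    (hp : p < S.M) (i : Fin d) :
    S.action a x (S.start d k + 2 * (p * d + i) + 1) =
      (1 / 2 : ℝ) • (S.base a x k - EuclideanSpace.single i 1) := by
  obtain ⟨h1, h2⟩ := S.slot_div_mod (k := k) hp i
  have h3 : S.start d k + 2 * (p * d + i) + 1 - S.L * S.M₀ =
      2 * (k * S.M * d + (p * d + i)) + 1 := by
    simp only [start]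
    omega
  have h4 : ∀ m : ℕ, (2 * m + 1) / 2 = m := by omega
  have h5 : ∀ m : ℕ, ¬ (2 * m + 1) % 2 = 0 := by omega
  rw [action, if_neg (by simp only [start]; omega)]
  simp only [h3, h4, h2, if_pos hk, h5, if_false, coordVec_eq _ i h1]

lemma action_commit (a : ℕ → EuclideanSpace ℝ (Fin d)) (x : ℕ → ℝ) {t : ℕ} (hd : 0 < d)
    (hM : 0 < S.M) (ht : S.start d (S.R + 1) ≤ t) : S.action a x t = S.base a x (S.R + 1) := by
  simp only [start] at ht
  have h : S.R + 1 ≤ (t - S.L * S.M₀) / 2 / d / S.M := by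
    rw [Nat.le_div_iff_mul_le hM, Nat.le_div_iff_mul_le hd]
    omega
  rw [action, if_neg (by omega)]
  exact if_neg (by omega)

lemma start_le (d : ℕ) {k : ℕ} (hk : k ≤ S.R) :
    S.start d k + 2 * (S.M * d) ≤ S.start d (S.R + 1) := by
  have : (k + 1) * S.M * d ≤ (S.R + 1) * S.M * d := by gcongr
  simp only [start]
  nlinarith

end Schedule

end Algorithm

namespace Schedule

variable {d : ℕ} (S : Schedule) {a : ℕ → EuclideanSpace ℝ (Fin d)} {x z : ℕ → ℝ}
  {θ : EuclideanSpace ℝ (Fin d)}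

lemma blockMean_reward (hx : ∀ s < S.start d (S.R + 1), x s = ⟪S.action a x s, θ⟫ ^ 2 + z s)
    (hM₀ : 0 < S.M₀) {j : ℕ} (hj : j < S.L) :
    blockMean S.M₀ x j = ⟪a j, θ⟫ ^ 2 + blockMean S.M₀ z j := by
  have hM' : (S.M₀ : ℝ) ≠ 0 := by positivity
  have h : ∀ p ∈ Finset.range S.M₀, x (j * S.M₀ + p) = ⟪a j, θ⟫ ^ 2 + z (j * S.M₀ + p) := by
    intro p hp
    have hp := Finset.mem_range.1 hp
    have h1 : (j + 1) * S.M₀ ≤ S.L * S.M₀ := Nat.mul_le_mul_right _ hj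
    rw [add_mul] at h1
    rw [hx _ (by simp only [start]; omega), S.action_of_lt a x hj hp]
  rw [blockMean, Finset.sum_congr rfl h, Finset.sum_add_distrib, add_div, blockMean]
  simp [hM']

lemma diffMean_reward (hx : ∀ s < S.start d (S.R + 1), x s = ⟪S.action a x s, θ⟫ ^ 2 + z s)
    (hM : 0 < S.M) {k : ℕ} (hk : k ≤ S.R) :
    diffMean d S.M x (S.start d k) =
      ⟪S.base a x k, θ⟫ • θ + diffMean d S.M z (S.start d k) := by
  have hM' : (S.M : ℝ) ≠ 0 := by positivity
  ext i
  have h : ∀ p ∈ Finset.range S.M,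
      x (S.start d k + 2 * (p * d + i)) - x (S.start d k + 2 * (p * d + i) + 1) =
        ⟪S.base a x k, θ⟫ * θ i +
          (z (S.start d k + 2 * (p * d + i)) - z (S.start d k + 2 * (p * d + i) + 1)) := by
    intro p hp
    have hp := Finset.mem_range.1 hp
    have h1 := slot_lt hp i
    have h2 := S.start_le d hk
    have h3 := inner_half_add_sq_sub (S.base a x k) (EuclideanSpace.single i 1) θ
    rw [EuclideanSpace.inner_single_left] at h3
    simp only [map_one, one_mul] at h3
    rw [hx _ (by omega), hx _ (by omega), S.action_round_even a x hk hp i,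
      S.action_round_odd a x hk hp i]
    linarith
  simp only [diffMean, PiLp.add_apply, PiLp.smul_apply, smul_eq_mul]
  rw [Finset.sum_congr rfl h, Finset.sum_add_distrib, add_div]
  simp [hM']

lemma le_inner_pick_sq {c : ℝ}
    (hest : ∀ j < S.L, blockMean S.M₀ x j = ⟪a j, θ⟫ ^ 2 + blockMean S.M₀ z j)
    (hτ : S.τ = 3 * c) (hz : ∀ j < S.L, |blockMean S.M₀ z j| ≤ c)
    (hgood : ∃ j < S.L, 4 * c ≤ ⟪a j, θ⟫ ^ 2) :
    2 * c ≤ ⟪S.pick a x S.L, θ⟫ ^ 2 := by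
  have key : ∀ m ≤ S.L, (∃ j < m, 4 * c ≤ ⟪a j, θ⟫ ^ 2) → 2 * c ≤ ⟪S.pick a x m, θ⟫ ^ 2 := by
    intro m
    induction m with
    | zero =>
      rintro - ⟨j, hj, -⟩
      omega
    | succ m ih =>
      rintro hm ⟨j, hj, hcj⟩
      rw [pick]
      have h1 := hest m (by omega)
      have h2 := abs_le.1 (hz m (by omega))
      split_ifs with h
      · rw [h1, hτ] at h
        linarith
      · rcases Nat.lt_succ_iff_lt_or_eq.1 hj with hj' | rfl
        · exact ih (by omega) ⟨j, hj', hcj⟩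
        · rw [h1, hτ] at h
          linarith
  exact key S.L le_rfl hgood

/-- On the good noise event the committed direction is nearly optimal. -/
lemma le_inner_base_sq {r : ℝ}
    (hx : ∀ s < S.start d (S.R + 1), x s = ⟪S.action a x s, θ⟫ ^ 2 + z s)
    (hr : 0 < r) (hθ : ‖θ‖ = r) (hd : 0 < d) (hM₀ : 0 < S.M₀) (hM : 0 < S.M)
    (hR : 2 ^ S.R ≤ d) (hR' : d < 2 ^ (S.R + 1)) (hτ : S.τ = 3 * (r ^ 2 / (256 * d)))
    (hz : ∀ j < S.L, |blockMean S.M₀ z j| ≤ r ^ 2 / (256 * d))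
    (hgood : ∃ j < S.L, r ^ 2 / (64 * d) ≤ ⟪a j, θ⟫ ^ 2)
    (hZ : ∀ k < S.R, ‖diffMean d S.M z (S.start d k)‖ ^ 2 ≤ r ^ 4 / 32)
    (hZθ : ∀ k < S.R, ⟪diffMean d S.M z (S.start d k), θ⟫ ^ 2 ≤ r ^ 6 / (512 * d)) :
    r ^ 2 - 256 / r ^ 2 * ‖diffMean d S.M z (S.start d S.R)‖ ^ 2 ≤
      ⟪S.base a x (S.R + 1), θ⟫ ^ 2 := by
  have hd' : (0 : ℝ) < d := by exact_mod_cast hd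
  have hRr : (2 : ℝ) ^ S.R ≤ d := by exact_mod_cast hR
  have hRr' : (d : ℝ) < 2 ^ (S.R + 1) := by exact_mod_cast hR'
  have h4 : 4 * (r ^ 2 / (256 * d)) = r ^ 2 / (64 * d) := by
    field_simp
    norm_num
  have key : ∀ k ≤ S.R, 2 ^ k / (128 * (d : ℝ)) * r ^ 2 ≤ ⟪S.base a x k, θ⟫ ^ 2 := by
    intro k
    induction k with
    | zero =>
      intro _
      have := S.le_inner_pick_sq (c := r ^ 2 / (256 * d))
        (fun j hj => S.blockMean_reward hx hM₀ hj) hτ hz (by rwa [h4])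
      refine le_trans (le_of_eq ?_) this
      field_simp
      norm_num
    | succ k ih =>
      intro hk
      have hkd : (2 : ℝ) ^ k ≤ d :=
        (pow_le_pow_right₀ (by norm_num) (by omega)).trans hRr
      have h1 : (1 : ℝ) ≤ 2 ^ k := one_le_pow₀ (by norm_num)
      have := two_mul_le_inner_unitize_sq (A := S.base a x k)
        (Z := diffMean d S.M z (S.start d k)) (s := 2 ^ k / (128 * (d : ℝ))) hr hθ (by positivity)
        (by rw [div_le_div_iff₀ (by positivity) (by norm_num)]; linarith)
        (ih (by omega)) (hZ k (by omega)) ?_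
      · rw [base, S.diffMean_reward hx hM (by omega)]
        refine le_trans (le_of_eq ?_) this
        rw [pow_succ]
        ring
      · refine (hZθ k (by omega)).trans ?_
        have h2 : 1 / (128 * (d : ℝ)) * r ^ 6 / 4 ≤ 2 ^ k / (128 * (d : ℝ)) * r ^ 6 / 4 := by
          gcongr
        refine le_trans (le_of_eq ?_) h2
        field_simp
        norm_num
  have hlast := key S.R le_rfl
  have hlow : r ^ 2 / 256 ≤ ⟪S.base a x S.R, θ⟫ ^ 2 := by
    refine le_trans ?_ hlast
    have h1 : (1 : ℝ) / 256 ≤ 2 ^ S.R / (128 * d) := by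
      rw [div_le_div_iff₀ (by norm_num) (by positivity)]
      rw [pow_succ] at hRr'
      linarith
    have := mul_le_mul_of_nonneg_right h1 (sq_nonneg r)
    linarith
  have hne : ⟪S.base a x S.R, θ⟫ ≠ 0 := by
    intro h
    rw [h] at hlow
    have : 0 < r ^ 2 := by positivity
    norm_num at hlow
    linarith
  rw [base, S.diffMean_reward hx hM le_rfl]
  refine le_trans ?_ (sub_le_inner_unitize_sq hθ hne)
  have h1 : ‖diffMean d S.M z (S.start d S.R)‖ ^ 2 / ⟪S.base a x S.R, θ⟫ ^ 2 ≤
      ‖diffMean d S.M z (S.start d S.R)‖ ^ 2 / (r ^ 2 / 256) := by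
    gcongr
  have h2 : ‖diffMean d S.M z (S.start d S.R)‖ ^ 2 / (r ^ 2 / 256) =
      256 / r ^ 2 * ‖diffMean d S.M z (S.start d S.R)‖ ^ 2 := by
    field_simp
  linarith

/-- A nonnegative functional of the noise which is at least `1` outside the good noise event. -/
noncomputable def penalty (θ : EuclideanSpace ℝ (Fin d)) (r : ℝ) (z : ℕ → ℝ) : ℝ :=
  (∑ j ∈ Finset.range S.L, (256 * d / r ^ 2) ^ 4 * blockMean S.M₀ z j ^ 4) +
    ∑ k ∈ Finset.range S.R, (32 / r ^ 4 * ‖diffMean d S.M z (S.start d k)‖ ^ 2 +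
      512 * d / r ^ 6 * ⟪diffMean d S.M z (S.start d k), θ⟫ ^ 2)

lemma penalty_nonneg (θ : EuclideanSpace ℝ (Fin d)) (r : ℝ) (z : ℕ → ℝ) :
    0 ≤ S.penalty θ r z := by
  unfold penalty
  have : ∀ y : ℝ, 0 ≤ y ^ 4 := fun y => by positivity
  have : ∀ y : ℝ, 0 ≤ y ^ 6 := fun y => by positivity
  positivity

open Classical in
/-- The per-step regret after committing, with the bad events paid for by the penalty. -/
lemma le_inner_base_sq_of_penalty {r : ℝ}
    (hx : ∀ s < S.start d (S.R + 1), x s = ⟪S.action a x s, θ⟫ ^ 2 + z s)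
    (hr : 0 < r) (hθ : ‖θ‖ = r) (hd : 0 < d) (hM₀ : 0 < S.M₀) (hM : 0 < S.M)
    (hR : 2 ^ S.R ≤ d) (hR' : d < 2 ^ (S.R + 1)) (hτ : S.τ = 3 * (r ^ 2 / (256 * d))) :
    r ^ 2 - 256 / r ^ 2 * ‖diffMean d S.M z (S.start d S.R)‖ ^ 2 - r ^ 2 * S.penalty θ r z -
        r ^ 2 * (if ∀ j < S.L, ⟪a j, θ⟫ ^ 2 < r ^ 2 / (64 * d) then 1 else 0) ≤
      ⟪S.base a x (S.R + 1), θ⟫ ^ 2 := by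
  have hd' : (0 : ℝ) < d := by exact_mod_cast hd
  have hpen := S.penalty_nonneg θ r z
  have hr2 : 0 < r ^ 2 := by positivity
  have hnn : 0 ≤ 256 / r ^ 2 * ‖diffMean d S.M z (S.start d S.R)‖ ^ 2 := by positivity
  have hsq := sq_nonneg ⟪S.base a x (S.R + 1), θ⟫
  by_cases hgood : ∀ j < S.L, ⟪a j, θ⟫ ^ 2 < r ^ 2 / (64 * d)
  · rw [if_pos hgood]
    have := mul_nonneg hr2.le hpen
    linarith
  rw [if_neg hgood]
  by_cases h1 : 1 ≤ S.penalty θ r z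
  · have := mul_le_mul_of_nonneg_left h1 hr2.le
    linarith
  have h1 := not_le.1 h1
  have hA : ∀ j ∈ Finset.range S.L, 0 ≤ (256 * d / r ^ 2) ^ 4 * blockMean S.M₀ z j ^ 4 :=
    fun j _ => by positivity
  have hB : ∀ k ∈ Finset.range S.R, 0 ≤ 32 / r ^ 4 * ‖diffMean d S.M z (S.start d k)‖ ^ 2 +
      512 * d / r ^ 6 * ⟪diffMean d S.M z (S.start d k), θ⟫ ^ 2 := fun k _ => by positivity
  have hA' := Finset.sum_nonneg hA
  have hB' := Finset.sum_nonneg hB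
  unfold penalty at h1
  have hkB : ∀ k < S.R, 32 / r ^ 4 * ‖diffMean d S.M z (S.start d k)‖ ^ 2 +
      512 * d / r ^ 6 * ⟪diffMean d S.M z (S.start d k), θ⟫ ^ 2 ≤ 1 := by
    intro k hk
    have := Finset.single_le_sum hB (Finset.mem_range.2 hk)
    linarith
  have := S.le_inner_base_sq hx hr hθ hd hM₀ hM hR hR' hτ ?_ ?_ ?_ ?_
  · have := mul_nonneg hr2.le hpen
    linarith
  · intro j hj
    have h2 := Finset.single_le_sum hA (Finset.mem_range.2 hj)
    have h3 : (256 * d / r ^ 2 * |blockMean S.M₀ z j|) ^ 4 ≤ 1 ^ 4 := by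
      rw [mul_pow, Even.pow_abs (by decide)]
      linarith
    have h4 := le_of_pow_le_pow_left₀ (by norm_num) zero_le_one h3
    rw [le_div_iff₀ (by positivity)]
    rw [div_mul_eq_mul_div, div_le_one hr2] at h4
    linarith
  · push Not at hgood
    exact hgood
  · intro k hk
    have h2 := hkB k hk
    have h3 : 0 ≤ 512 * d / r ^ 6 * ⟪diffMean d S.M z (S.start d k), θ⟫ ^ 2 := by positivity
    have h4 : 32 / r ^ 4 * ‖diffMean d S.M z (S.start d k)‖ ^ 2 ≤ 1 := by linarith
    rw [div_mul_eq_mul_div, div_le_one (by positivity)] at h4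
    linarith
  · intro k hk
    have h2 := hkB k hk
    have h3 : 0 ≤ 32 / r ^ 4 * ‖diffMean d S.M z (S.start d k)‖ ^ 2 := by positivity
    have h4 : 512 * d / r ^ 6 * ⟪diffMean d S.M z (S.start d k), θ⟫ ^ 2 ≤ 1 := by linarith
    rw [div_mul_eq_mul_div, div_le_one (by positivity)] at h4
    rw [le_div_iff₀ (by positivity)]
    linarith

end Schedule

section Moments

variable {n d : ℕ}

lemma integral_blockMean_pow_four {M₀ j : ℕ} (hM₀ : 0 < M₀) (hn : (j + 1) * M₀ ≤ n) :
    Integrable (fun η => blockMean M₀ (noise η) j ^ 4) (noiseLaw n) ∧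
      ∫ η, blockMean M₀ (noise η) j ^ 4 ∂(noiseLaw n) ≤ 48 / (M₀ : ℝ) ^ 2 := by
  have hM' : (0 : ℝ) < M₀ := by exact_mod_cast hM₀
  rw [add_mul] at hn
  have hlaw := map_sum_noise (n := n) (fun p : Fin M₀ => j * M₀ + p)
    (fun p q h => Fin.ext (by simpa using h)) (fun p => by have := p.2; omega)
    (fun _ => (M₀ : ℝ)⁻¹)
  have heq : (fun η : Fin n → ℝ => ∑ p : Fin M₀, (M₀ : ℝ)⁻¹ * noise η (j * M₀ + p)) =
      fun η => blockMean M₀ (noise η) j := by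
    ext η
    rw [blockMean, ← Finset.mul_sum, ← Fin.sum_univ_eq_sum_range fun p => noise η (j * M₀ + p)]
    ring
  have hsum : ∑ _ : Fin M₀, ((M₀ : ℝ)⁻¹) ^ 2 = (M₀ : ℝ)⁻¹ := by
    rw [Finset.sum_const, Finset.card_univ, Fintype.card_fin, nsmul_eq_mul]
    field_simp
  rw [heq, hsum] at hlaw
  have hm : Measurable fun η : Fin n → ℝ => blockMean M₀ (noise η) j := by
    rw [← heq]
    exact Finset.measurable_sum _ fun p _ => (measurable_noise _).const_mul _
  have := integrable_pow_four_of_map_gaussian hm (by simpa using hM₀) hlaw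
  rw [Real.coe_toNNReal _ (by positivity), inv_pow] at this
  exact this

lemma inner_diffMean (M : ℕ) (z : ℕ → ℝ) (b : ℕ) (u : EuclideanSpace ℝ (Fin d)) :
    ⟪diffMean d M z b, u⟫ = ∑ q : Fin M × Fin d × Fin 2,
      ((if q.2.2 = 0 then u q.2.1 else -u q.2.1) / M) * z (b + 2 * (q.1 * d + q.2.1) + q.2.2) := by
  rw [Fintype.sum_prod_type, PiLp.inner_apply]
  simp only [Fintype.sum_prod_type]
  rw [Finset.sum_comm]
  refine Finset.sum_congr rfl fun i _ => ?_
  simp only [diffMean, Fin.sum_univ_two]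
  rw [← Fin.sum_univ_eq_sum_range
    fun p => z (b + 2 * (p * d + i)) - z (b + 2 * (p * d + i) + 1)]
  simp only [RCLike.inner_apply, conj_trivial]
  rw [Finset.sum_div, Finset.mul_sum]
  refine Finset.sum_congr rfl fun p _ => ?_
  simp
  ring

lemma injective_slot (M b : ℕ) : Function.Injective
    fun q : Fin M × Fin d × Fin 2 => b + 2 * ((q.1 : ℕ) * d + q.2.1) + q.2.2 := by
  rintro ⟨p, i, s⟩ ⟨p', i', s'⟩ h
  simp only at h
  have hd : 0 < d := i.pos
  have h1 : (p : ℕ) * d + i = p' * d + i' := by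
    have := s.2
    have := s'.2
    omega
  have h2 : (s : ℕ) = s' := by omega
  have h3 : (i : ℕ) = i' := by
    have := congrArg (· % d) h1
    simpa [Nat.mul_add_mod', Nat.mod_eq_of_lt] using this
  have h4 : (p : ℕ) = p' := by
    rw [h3] at h1
    exact Nat.eq_of_mul_eq_mul_right hd (Nat.add_right_cancel h1)
  simp [Fin.ext_iff, h2, h3, h4]

lemma integral_inner_diffMean_sq {M b : ℕ} (hM : 0 < M) (hn : b + 2 * (M * d) ≤ n)
    (u : EuclideanSpace ℝ (Fin d)) :
    Integrable (fun η => ⟪diffMean d M (noise η) b, u⟫ ^ 2) (noiseLaw n) ∧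
      ∫ η, ⟪diffMean d M (noise η) b, u⟫ ^ 2 ∂(noiseLaw n) = 2 * ‖u‖ ^ 2 / M := by
  have hM' : (M : ℝ) ≠ 0 := by positivity
  have := integral_sum_noise_sq (n := n)
    (fun q : Fin M × Fin d × Fin 2 => b + 2 * ((q.1 : ℕ) * d + q.2.1) + q.2.2)
    (injective_slot M b)
    (fun q => by
      have h1 := slot_lt q.1.2 q.2.1
      have h2 := q.2.2.2
      omega)
    (fun q => (if q.2.2 = 0 then u q.2.1 else -u q.2.1) / M)
  simp only [← inner_diffMean] at this
  refine ⟨this.1, this.2.trans ?_⟩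
  simp only [Fintype.sum_prod_type, Fin.sum_univ_two]
  rw [EuclideanSpace.norm_sq_eq]
  simp only [Fin.isValue, if_true, one_ne_zero, if_false, div_pow, neg_sq, Finset.sum_const,
    Finset.card_univ, Fintype.card_fin, nsmul_eq_mul, ← two_mul, Real.norm_eq_abs,
    sq_abs]
  rw [Finset.mul_sum, Finset.mul_sum, Finset.sum_div]
  refine Finset.sum_congr rfl fun i _ => ?_
  field_simp

lemma integral_norm_diffMean_sq {M b : ℕ} (hM : 0 < M) (hn : b + 2 * (M * d) ≤ n) :
    Integrable (fun η => ‖diffMean d M (noise η) b‖ ^ 2) (noiseLaw n) ∧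
      ∫ η, ‖diffMean d M (noise η) b‖ ^ 2 ∂(noiseLaw n) = 2 * d / M := by
  have h : ∀ η : Fin n → ℝ, ‖diffMean d M (noise η) b‖ ^ 2 =
      ∑ i : Fin d, ⟪diffMean d M (noise η) b, EuclideanSpace.single i 1⟫ ^ 2 := by
    intro η
    rw [EuclideanSpace.norm_sq_eq]
    refine Finset.sum_congr rfl fun i _ => ?_
    rw [EuclideanSpace.inner_single_right]
    simp
  have hi := fun i : Fin d => integral_inner_diffMean_sq hM hn (EuclideanSpace.single i (1 : ℝ))
  simp only [h]
  refine ⟨integrable_finsetSum _ fun i _ => (hi i).1, ?_⟩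
  rw [integral_finsetSum _ fun i _ => (hi i).1]
  simp only [fun i => (hi i).2]
  simp
  ring

lemma Schedule.integral_penalty_le (S : Schedule) {θ : EuclideanSpace ℝ (Fin d)} {r : ℝ}
    (hr : 0 < r) (hθ : ‖θ‖ = r) (hM₀ : 0 < S.M₀) (hM : 0 < S.M)
    (hn : S.start d (S.R + 1) ≤ n) :
    Integrable (fun η => S.penalty θ r (noise η)) (noiseLaw n) ∧
      ∫ η, S.penalty θ r (noise η) ∂(noiseLaw n) ≤
        S.L * ((256 * d / r ^ 2) ^ 4 * (48 / (S.M₀ : ℝ) ^ 2)) +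
          S.R * (1088 * d / (r ^ 4 * S.M)) := by
  have hblock : ∀ j ∈ Finset.range S.L, Integrable
      (fun η => (256 * d / r ^ 2) ^ 4 * blockMean S.M₀ (noise η) j ^ 4) (noiseLaw n) ∧
      ∫ η, (256 * d / r ^ 2) ^ 4 * blockMean S.M₀ (noise η) j ^ 4 ∂(noiseLaw n) ≤
        (256 * d / r ^ 2) ^ 4 * (48 / (S.M₀ : ℝ) ^ 2) := by
    intro j hj
    have h1 : (j + 1) * S.M₀ ≤ S.L * S.M₀ := Nat.mul_le_mul_right _ (Finset.mem_range.1 hj)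
    have := integral_blockMean_pow_four (n := n) (j := j) hM₀
      (h1.trans ((Nat.le_add_right _ _).trans hn))
    refine ⟨this.1.const_mul _, ?_⟩
    rw [integral_const_mul]
    exact mul_le_mul_of_nonneg_left this.2 (by positivity)
  have hround : ∀ k ∈ Finset.range S.R, Integrable
      (fun η => 32 / r ^ 4 * ‖diffMean d S.M (noise η) (S.start d k)‖ ^ 2 +
        512 * d / r ^ 6 * ⟪diffMean d S.M (noise η) (S.start d k), θ⟫ ^ 2) (noiseLaw n) ∧
      ∫ η, (32 / r ^ 4 * ‖diffMean d S.M (noise η) (S.start d k)‖ ^ 2 +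
        512 * d / r ^ 6 * ⟪diffMean d S.M (noise η) (S.start d k), θ⟫ ^ 2) ∂(noiseLaw n) =
        1088 * d / (r ^ 4 * S.M) := by
    intro k hk
    have h1 := (S.start_le d (Finset.mem_range.1 hk).le).trans hn
    have h2 := integral_norm_diffMean_sq hM h1
    have h3 := integral_inner_diffMean_sq hM h1 θ
    refine ⟨(h2.1.const_mul _).add (h3.1.const_mul _), ?_⟩
    rw [integral_add (h2.1.const_mul _) (h3.1.const_mul _), integral_const_mul,
      integral_const_mul, h2.2, h3.2, hθ]
    field_simp
    ring
  have hi1 := integrable_finsetSum _ fun j hj => (hblock j hj).1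
  have hi2 := integrable_finsetSum _ fun k hk => (hround k hk).1
  unfold penalty
  refine ⟨hi1.add hi2, ?_⟩
  rw [integral_add hi1 hi2, integral_finsetSum _ fun j hj => (hblock j hj).1,
    integral_finsetSum _ fun k hk => (hround k hk).1]
  refine add_le_add ?_ (le_of_eq ?_)
  · refine (Finset.sum_le_card_nsmul _ _ _ fun j hj => (hblock j hj).2).trans (le_of_eq ?_)
    simp
  · rw [Finset.sum_congr rfl fun k hk => (hround k hk).2]
    simp

end Moments

section Regret

variable {d n : ℕ}

lemma X_of_lt {W : Type} [MeasurableSpace W] (π : Policy d n W) (θ : EuclideanSpace ℝ (Fin d))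
    {t : ℕ} (ht : t < n) (ω : W × (Fin n → ℝ)) :
    π.X θ t ω = ⟪π.A θ ⟨t, ht⟩ ω, θ⟫ ^ 2 + noise ω.2 t := by
  rw [Policy.X]
  simp only [Policy.A, noise, dif_pos ht]

lemma measurable_X {W : Type} [MeasurableSpace W] (π : Policy d n W)
    (θ : EuclideanSpace ℝ (Fin d)) (t : ℕ) : Measurable (π.X θ t) := by
  induction t using Nat.strong_induction_on with
  | _ t ih =>
    by_cases ht : t < n
    · have hA : Measurable fun ω => π.A θ ⟨t, ht⟩ ω :=
        (π.act_meas ⟨t, ht⟩).comp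
          (measurable_fst.prodMk (measurable_pi_lambda _ fun s => ih s s.2))
      rw [funext fun ω => X_of_lt π θ ht ω]
      exact ((hA.inner_const).pow_const 2).add ((measurable_noise t).comp measurable_snd)
    · have : π.X θ t = fun _ => 0 := by
        rw [Policy.X]
        simp [ht]
      rw [this]
      exact measurable_const

lemma measurable_A {W : Type} [MeasurableSpace W] (π : Policy d n W)
    (θ : EuclideanSpace ℝ (Fin d)) (t : Fin n) : Measurable (π.A θ t) :=
  (π.act_meas t).comp (measurable_fst.prodMk (measurable_pi_lambda _ fun s => measurable_X π θ s))

lemma regret_le_mul_sq {W : Type} [MeasurableSpace W] (π : Policy d n W)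
    (θ : EuclideanSpace ℝ (Fin d)) (r : ℝ) : π.regret θ r ≤ n * r ^ 2 :=
  sub_le_self _ (integral_nonneg fun _ => Finset.sum_nonneg fun _ _ => sq_nonneg _)

instance isProbabilityMeasure_μ {W : Type} [MeasurableSpace W] (π : Policy d n W) :
    IsProbabilityMeasure π.μ := by
  have := π.probW
  unfold Policy.μ
  infer_instance

lemma integrable_sum_inner_A_sq {W : Type} [MeasurableSpace W] (π : Policy d n W)
    (θ : EuclideanSpace ℝ (Fin d)) :
    Integrable (fun ω => ∑ t : Fin n, ⟪π.A θ t ω, θ⟫ ^ 2) π.μ := by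
  refine integrable_finsetSum _ fun t _ => ?_
  refine Integrable.of_bound (((measurable_A π θ t).inner_const).pow_const 2).aestronglyMeasurable
    (‖θ‖ ^ 2) (ae_of_all _ fun ω => ?_)
  rw [norm_pow]
  refine pow_le_pow_left₀ (norm_nonneg _) ((norm_inner_le_norm _ _).trans ?_) 2
  exact mul_le_of_le_one_left (norm_nonneg _) (π.act_mem _ _)

namespace Schedule

variable (S : Schedule)

/-- The candidate directions built from a Gaussian seed. -/
noncomputable def candidates (w : Fin S.L → Fin d → ℝ) (j : ℕ) : EuclideanSpace ℝ (Fin d) :=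
  if h : j < S.L then seedDir (w ⟨j, h⟩) else 0

lemma norm_candidates_le (w : Fin S.L → Fin d → ℝ) (j : ℕ) : ‖S.candidates w j‖ ≤ 1 := by
  unfold candidates
  split_ifs
  · exact norm_seedDir_le _
  · simp

lemma measurable_candidates (j : ℕ) :
    Measurable fun w : Fin S.L → Fin d → ℝ => S.candidates w j := by
  unfold candidates
  split_ifs
  · exact measurable_seedDir.comp (measurable_pi_apply _)
  · exact measurable_const

/-- The policy following the schedule, with Gaussian candidate directions. -/
noncomputable def policy (d n : ℕ) : Policy d n (Fin S.L → Fin d → ℝ) where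
  μW := Measure.pi fun _ => noiseLaw d
  probW := inferInstance
  act t p := S.action (S.candidates p.1) (fun s => if h : s < t then p.2 ⟨s, h⟩ else 0) t
  act_meas t := by
    refine S.measurable_action (fun j => (S.measurable_candidates j).comp measurable_fst)
      (fun s => ?_) t
    split_ifs
    · exact (measurable_pi_apply _).comp measurable_snd
    · exact measurable_const
  act_mem t p := S.norm_action_le (S.norm_candidates_le p.1) _ t

lemma policy_A (θ : EuclideanSpace ℝ (Fin d)) (t : Fin n)
    (ω : (Fin S.L → Fin d → ℝ) × (Fin n → ℝ)) :
    (S.policy d n).A θ t ω =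
      S.action (S.candidates ω.1) (fun s => (S.policy d n).X θ s ω) t :=
  S.action_congr _ fun s hs => by simp [hs]

lemma policy_X (θ : EuclideanSpace ℝ (Fin d)) {t : ℕ} (ht : t < n)
    (ω : (Fin S.L → Fin d → ℝ) × (Fin n → ℝ)) :
    (S.policy d n).X θ t ω =
      ⟪S.action (S.candidates ω.1) (fun s => (S.policy d n).X θ s ω) t, θ⟫ ^ 2 +
        noise ω.2 t := by
  rw [X_of_lt _ θ ht, policy_A]

lemma regret_policy_le {θ : EuclideanSpace ℝ (Fin d)} {r : ℝ} (hr : 0 < r) (hθ : ‖θ‖ = r)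
    (hd : 0 < d) (hM₀ : 0 < S.M₀) (hM : 0 < S.M) (hR : 2 ^ S.R ≤ d) (hR' : d < 2 ^ (S.R + 1))
    (hτ : S.τ = 3 * (r ^ 2 / (256 * d))) (hn : S.start d (S.R + 1) ≤ n) :
    (S.policy d n).regret θ r ≤ S.start d (S.R + 1) * r ^ 2 +
      n * (512 * d / (r ^ 2 * S.M) +
        r ^ 2 * (S.L * ((256 * d / r ^ 2) ^ 4 * (48 / (S.M₀ : ℝ) ^ 2)) +
          S.R * (1088 * d / (r ^ 4 * S.M))) + r ^ 2 * (1 / 2) ^ S.L) := by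
  have hr2 : 0 < r ^ 2 := by positivity
  set N := S.start d (S.R + 1) with hN
  let B : Set (Fin S.L → Fin d → ℝ) := {w | ∀ j, ⟪seedDir (w j), θ⟫ ^ 2 < r ^ 2 / (64 * d)}
  have hB : MeasurableSet B := measurableSet_all_bad θ _
  let f : (Fin n → ℝ) → ℝ := fun η => r ^ 2 -
    256 / r ^ 2 * ‖diffMean d S.M (noise η) (S.start d S.R)‖ ^ 2 -
      r ^ 2 * S.penalty θ r (noise η)
  let g : (Fin S.L → Fin d → ℝ) → ℝ := B.indicator fun _ => r ^ 2
  have hpen := S.integral_penalty_le hr hθ hM₀ hM hn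
  have hdiff := integral_norm_diffMean_sq hM ((S.start_le d le_rfl).trans hn)
  have hf₀ : Integrable (fun η => r ^ 2 -
      256 / r ^ 2 * ‖diffMean d S.M (noise η) (S.start d S.R)‖ ^ 2) (noiseLaw n) :=
    (integrable_const _).sub (hdiff.1.const_mul _)
  have hf : Integrable f (noiseLaw n) := hf₀.sub (hpen.1.const_mul _)
  have hg : Integrable g (Measure.pi fun _ : Fin S.L => noiseLaw d) :=
    (integrable_const _).indicator hB
  have hf' : ∫ η, f η ∂(noiseLaw n) ≥ r ^ 2 - 512 * d / (r ^ 2 * S.M) -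
      r ^ 2 * (S.L * ((256 * d / r ^ 2) ^ 4 * (48 / (S.M₀ : ℝ) ^ 2)) +
          S.R * (1088 * d / (r ^ 4 * S.M))) := by
    simp only [f]
    rw [integral_sub hf₀ (hpen.1.const_mul _),
      integral_sub (integrable_const _) (hdiff.1.const_mul _), integral_const_mul,
      integral_const_mul, hdiff.2]
    have h1 := mul_le_mul_of_nonneg_left hpen.2 hr2.le
    have h2 : 256 / r ^ 2 * (2 * d / S.M) = 512 * d / (r ^ 2 * S.M) := by
      field_simp
      norm_num
    simp only [integral_const, probReal_univ, one_smul]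
    linarith
  have hg' : ∫ w, g w ∂(Measure.pi fun _ : Fin S.L => noiseLaw d) ≤ r ^ 2 * (1 / 2) ^ S.L := by
    simp only [g]
    rw [integral_indicator_const _ hB, smul_eq_mul, mul_comm]
    exact mul_le_mul_of_nonneg_left (seedDir_all_bad hd hr hθ) hr2.le
  have hpt : ∀ ω : (Fin S.L → Fin d → ℝ) × (Fin n → ℝ),
      ((n : ℝ) - N) * (f ω.2 - g ω.1) ≤ ∑ t : Fin n, ⟪(S.policy d n).A θ t ω, θ⟫ ^ 2 := by
    intro ω
    let x : ℕ → ℝ := fun s => (S.policy d n).X θ s ω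
    have h1 := S.le_inner_base_sq_of_penalty (a := S.candidates ω.1) (x := x) (z := noise ω.2)
      (fun s hs => S.policy_X θ (hs.trans_le hn) ω) hr hθ hd hM₀ hM hR hR' hτ
    have h2 : f ω.2 - g ω.1 ≤ ⟪S.base (S.candidates ω.1) x (S.R + 1), θ⟫ ^ 2 := by
      refine le_trans (le_of_eq ?_) h1
      have h3 : (∀ j < S.L, ⟪S.candidates ω.1 j, θ⟫ ^ 2 < r ^ 2 / (64 * d)) ↔ ω.1 ∈ B := by
        constructor
        · intro h j
          have := h j j.2
          rwa [candidates, dif_pos j.2] at this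
        · intro h j hj
          rw [candidates, dif_pos hj]
          exact h _
      by_cases h4 : ω.1 ∈ B
      · simp [f, g, h3, h4]
      · simp [f, g, h3, h4]
    have h5 : ∑ t : Fin n, ⟪(S.policy d n).A θ t ω, θ⟫ ^ 2 =
        ∑ t ∈ Finset.range n, ⟪S.action (S.candidates ω.1) x t, θ⟫ ^ 2 := by
      rw [← Fin.sum_univ_eq_sum_range (fun t => ⟪S.action (S.candidates ω.1) x t, θ⟫ ^ 2)]
      exact Finset.sum_congr rfl fun t _ => by rw [policy_A]
    rw [h5]
    have h6 : ∑ t ∈ Finset.Ico N n, ⟪S.action (S.candidates ω.1) x t, θ⟫ ^ 2 ≤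
        ∑ t ∈ Finset.range n, ⟪S.action (S.candidates ω.1) x t, θ⟫ ^ 2 := by
      refine Finset.sum_le_sum_of_subset_of_nonneg ?_ fun _ _ _ => sq_nonneg _
      intro t ht
      exact Finset.mem_range.2 (Finset.mem_Ico.1 ht).2
    refine le_trans ?_ h6
    have h7 := Finset.card_nsmul_le_sum (Finset.Ico N n)
      (fun t => ⟪S.action (S.candidates ω.1) x t, θ⟫ ^ 2) (f ω.2 - g ω.1) fun t ht => by
        rw [S.action_commit _ x hd hM (Finset.mem_Ico.1 ht).1]
        exact h2
    rwa [Nat.card_Ico, nsmul_eq_mul, Nat.cast_sub hn] at h7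
  have hμ : (S.policy d n).μ =
      (Measure.pi fun _ : Fin S.L => noiseLaw d).prod (noiseLaw n) := rfl
  have hfi : Integrable (fun ω : (Fin S.L → Fin d → ℝ) × (Fin n → ℝ) => f ω.2)
      (S.policy d n).μ := by
    rw [hμ]
    exact hf.comp_snd _
  have hgi : Integrable (fun ω : (Fin S.L → Fin d → ℝ) × (Fin n → ℝ) => g ω.1)
      (S.policy d n).μ := by
    rw [hμ]
    exact hg.comp_fst _
  have hinteg := integral_mono ((hfi.sub hgi).const_mul ((n : ℝ) - N))
    (integrable_sum_inner_A_sq (S.policy d n) θ) hpt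
  have hfe : ∫ ω, f ω.2 ∂(S.policy d n).μ = ∫ η, f η ∂(noiseLaw n) := by
    rw [hμ, integral_fun_snd f]
    simp
  have hge : ∫ ω, g ω.1 ∂(S.policy d n).μ =
      ∫ w, g w ∂(Measure.pi fun _ : Fin S.L => noiseLaw d) := by
    rw [hμ, integral_fun_fst g]
    simp
  simp only [Pi.sub_apply] at hinteg
  rw [integral_const_mul, integral_sub hfi hgi, hfe, hge] at hinteg
  have hnN : (0 : ℝ) ≤ (n : ℝ) - N := sub_nonneg.2 (by exact_mod_cast hn)
  set δ := 512 * d / (r ^ 2 * S.M) +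
        r ^ 2 * (S.L * ((256 * d / r ^ 2) ^ 4 * (48 / (S.M₀ : ℝ) ^ 2)) +
          S.R * (1088 * d / (r ^ 4 * S.M))) + r ^ 2 * (1 / 2) ^ S.L with hδ
  have hδ0 : 0 ≤ δ := by positivity
  have h8 : ((n : ℝ) - N) * (r ^ 2 - δ) ≤ _ :=
    (mul_le_mul_of_nonneg_left (by linarith) hnN).trans hinteg
  have h9 : 0 ≤ (N : ℝ) * δ := by positivity
  rw [Policy.regret]
  nlinarith

end Schedule

end Regret

section Tuning

lemma exists_cube_between {K : ℝ} (hK : 1 ≤ K) :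
    ∃ L : ℕ, 0 < L ∧ K ≤ (L : ℝ) ^ 3 ∧ (L : ℝ) ^ 3 ≤ 8 * K := by
  classical
  have hex : ∃ L : ℕ, K ≤ (L : ℝ) ^ 3 := by
    obtain ⟨L, hL⟩ := exists_nat_ge K
    refine ⟨L, hL.trans ?_⟩
    have h1 : (1 : ℝ) ≤ L := hK.trans hL
    exact le_self_pow₀ h1 (by norm_num)
  have h1 := Nat.find_spec hex
  have h2 := fun m => Nat.find_min hex (m := m)
  set L := Nat.find hex
  have hL : 0 < L := by
    rcases Nat.eq_zero_or_pos L with h | h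
    · rw [h] at h1
      norm_num at h1
      linarith
    · exact h
  refine ⟨L, hL, h1, ?_⟩
  obtain ⟨m, hm⟩ : ∃ m, L = m + 1 := ⟨L - 1, by omega⟩
  have h3 := not_le.1 (h2 m (by omega))
  rw [hm]
  push_cast
  rcases Nat.eq_zero_or_pos m with rfl | hm'
  · norm_num
    linarith
  · have h4 : (1 : ℝ) ≤ m := by exact_mod_cast hm'
    have h5 : ((m : ℝ) + 1) ^ 3 ≤ (2 * m) ^ 3 := by gcongr; linarith
    have h6 : (2 * (m : ℝ)) ^ 3 = 8 * m ^ 3 := by ring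
    linarith

lemma cube_le_four_mul_two_pow (L : ℕ) : L ^ 3 ≤ 4 * 2 ^ L := by
  rcases lt_or_ge L 4 with h | h
  · interval_cases L <;> norm_num
  · induction L, h using Nat.le_induction with
    | base => norm_num
    | succ L hL ih =>
      have h1 : (L + 1) ^ 3 ≤ 2 * L ^ 3 := by nlinarith [Nat.mul_le_mul hL hL]
      rw [pow_succ 2 L]
      omega

lemma half_pow_le (L : ℕ) (hL : 0 < L) : ((1 : ℝ) / 2) ^ L ≤ 4 / (L : ℝ) ^ 3 := by
  have h : (L : ℝ) ^ 3 ≤ 4 * 2 ^ L := by exact_mod_cast cube_le_four_mul_two_pow L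
  rw [one_div_pow, div_le_div_iff₀ (by positivity) (by positivity)]
  linarith

lemma log_add_one_le {d : ℕ} (hd : 2 ≤ d) : (Nat.log 2 d : ℝ) + 1 ≤ 3 * Real.log d := by
  have h1 : (Nat.log 2 d : ℝ) * Real.log 2 ≤ Real.log d := by
    rw [← Real.log_pow]
    refine Real.log_le_log (by positivity) ?_
    exact_mod_cast Nat.pow_log_le_self 2 (by omega)
  have h2 : Real.log 2 ≤ Real.log d := Real.log_le_log (by norm_num) (by exact_mod_cast hd)
  have h3 := Real.log_two_gt_d9
  nlinarith

lemma schedule_cost_le {d L M₀ M N K r : ℝ} {R : ℕ} (hd : 1 ≤ d) (hr : 0 < r) (hr1 : r ≤ 1)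
    (hK : 1 ≤ K) (hL : 1 ≤ L) (hL₂ : L ^ 3 ≤ 8 * K)
    (hM₀' : M₀ ≤ K * d ^ 2 / (r ^ 4 * L) + 1) (hM' : M ≤ K * d / r ^ 4 + 1)
    (hN : N = L * M₀ + 2 * ((R + 1) * M * d)) :
    N * r ^ 2 ≤ 13 * ((R + 1) * (K * d ^ 2 / r ^ 2)) := by
  have hr4 : 0 < r ^ 4 := by positivity
  have hr4' : r ^ 4 ≤ 1 := pow_le_one₀ hr.le hr1
  have hK0 : 0 < K := by linarith
  have hL0 : 0 < L := by linarith
  have hd0 : 0 < d := by linarith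
  have h1 : K ≤ K * d / r ^ 4 := by
    rw [le_div_iff₀ hr4]
    nlinarith
  have h2 : K * d / r ^ 4 ≤ K * d ^ 2 / r ^ 4 := by
    gcongr
    nlinarith
  have h3 : L ≤ 8 * K := (le_self_pow₀ hL (by norm_num)).trans hL₂
  have h4 : L * M₀ ≤ 9 * (K * d ^ 2 / r ^ 4) := by
    have h5 := mul_le_mul_of_nonneg_left hM₀' hL0.le
    have h6 : L * (K * d ^ 2 / (r ^ 4 * L) + 1) = K * d ^ 2 / r ^ 4 + L := by
      field_simp
    linarith
  have h7 : M * d ≤ 2 * (K * d ^ 2 / r ^ 4) := by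
    have h8 : M * d ≤ 2 * (K * d / r ^ 4) * d := by
      gcongr
      linarith
    refine h8.trans (le_of_eq ?_)
    ring
  have h9 : (0 : ℝ) ≤ R := by positivity
  have h10 : N ≤ 13 * ((R + 1) * (K * d ^ 2 / r ^ 4)) := by
    have : (R + 1) * (M * d) ≤ (R + 1) * (2 * (K * d ^ 2 / r ^ 4)) := by gcongr
    have h11 : 0 ≤ (R : ℝ) * (K * d ^ 2 / r ^ 4) := by positivity
    rw [hN]
    nlinarith
  calc N * r ^ 2 ≤ 13 * ((R + 1) * (K * d ^ 2 / r ^ 4)) * r ^ 2 := by gcongr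
    _ = 13 * ((R + 1) * (K * d ^ 2 / r ^ 2)) := by
      field_simp

lemma schedule_gap_le {d M₀ M K r : ℝ} {L R : ℕ} (hd : 1 ≤ d) (hr : 0 < r)
    (hK : 1 ≤ K) (hL : 0 < L) (hL₁ : K ≤ (L : ℝ) ^ 3) (hL₂ : (L : ℝ) ^ 3 ≤ 8 * K)
    (hM₀ : K * d ^ 2 / (r ^ 4 * L) ≤ M₀) (hM : K * d / r ^ 4 ≤ M) :
    512 * d / (r ^ 2 * M) +
        r ^ 2 * (L * ((256 * d / r ^ 2) ^ 4 * (48 / M₀ ^ 2)) + R * (1088 * d / (r ^ 4 * M))) +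
        r ^ 2 * (1 / 2) ^ L ≤
      (1604 + 384 * 256 ^ 4) * ((R + 1) * (r ^ 2 / K)) := by
  have hK0 : 0 < K := by linarith
  have hL0 : (0 : ℝ) < L := by exact_mod_cast hL
  have hd0 : 0 < d := by linarith
  have hA : 512 * d / (r ^ 2 * M) ≤ 512 * (r ^ 2 / K) := by
    calc 512 * d / (r ^ 2 * M) ≤ 512 * d / (r ^ 2 * (K * d / r ^ 4)) := by gcongr
      _ = 512 * (r ^ 2 / K) := by field_simp
  have hB : 1088 * d / (r ^ 4 * M) ≤ 1088 * (1 / K) := by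
    calc 1088 * d / (r ^ 4 * M) ≤ 1088 * d / (r ^ 4 * (K * d / r ^ 4)) := by gcongr
      _ = 1088 * (1 / K) := by field_simp
  have hC : L * ((256 * d / r ^ 2) ^ 4 * (48 / M₀ ^ 2)) ≤ 384 * 256 ^ 4 * (1 / K) := by
    calc L * ((256 * d / r ^ 2) ^ 4 * (48 / M₀ ^ 2))
        ≤ L * ((256 * d / r ^ 2) ^ 4 * (48 / (K * d ^ 2 / (r ^ 4 * L)) ^ 2)) := by gcongr
      _ = 48 * 256 ^ 4 * ((L : ℝ) ^ 3 / K ^ 2) := by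
        field_simp
      _ ≤ 48 * 256 ^ 4 * (8 * K / K ^ 2) := by gcongr
      _ = 384 * 256 ^ 4 * (1 / K) := by
        field_simp
        norm_num
  have hD : ((1 : ℝ) / 2) ^ L ≤ 4 * (1 / K) := by
    calc ((1 : ℝ) / 2) ^ L ≤ 4 / (L : ℝ) ^ 3 := half_pow_le L hL
      _ ≤ 4 / K := by gcongr
      _ = 4 * (1 / K) := by ring
  have hR : (0 : ℝ) ≤ R := by positivity
  have hq : r ^ 2 * (1 / K) = r ^ 2 / K := by ring
  have hq0 : 0 ≤ r ^ 2 / K := by positivity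
  have hB' := mul_le_mul_of_nonneg_left hB hR
  have h1 : r ^ 2 * (L * ((256 * d / r ^ 2) ^ 4 * (48 / M₀ ^ 2)) +
      R * (1088 * d / (r ^ 4 * M))) ≤
      r ^ 2 * (384 * 256 ^ 4 * (1 / K) + R * (1088 * (1 / K))) := by gcongr
  have h2 : r ^ 2 * (1 / 2) ^ L ≤ r ^ 2 * (4 * (1 / K)) := by gcongr
  have h3 : r ^ 2 * (384 * 256 ^ 4 * (1 / K) + R * (1088 * (1 / K))) =
      384 * 256 ^ 4 * (r ^ 2 / K) + 1088 * (R * (r ^ 2 / K)) := by ring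
  have h4 : r ^ 2 * (4 * (1 / K)) = 4 * (r ^ 2 / K) := by ring
  have h5 : 0 ≤ (R : ℝ) * (r ^ 2 / K) := by positivity
  rw [add_mul (R : ℝ), one_mul]
  generalize (R : ℝ) * (r ^ 2 / K) = u at *
  generalize r ^ 2 / K = v at *
  linarith

lemma exists_schedule_regret_le {d n : ℕ} {r : ℝ} (hd : 2 ≤ d) (hr : 0 < r) (hr1 : r ≤ 1)
    (hK : (d : ℝ) ≤ r ^ 2 * √n) :
    ∃ S : Schedule, ∀ θ : EuclideanSpace ℝ (Fin d), ‖θ‖ = r →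
      (S.policy d n).regret θ r ≤
        (1617 + 384 * 256 ^ 4) * ((Nat.log 2 d + 1) * (d * √n)) := by
  have hd0 : (0 : ℝ) < d := by positivity
  have hd1 : (1 : ℝ) ≤ d := by exact_mod_cast (by omega : 1 ≤ d)
  have hs : 0 < √(n : ℝ) := by
    by_contra h
    have : √(n : ℝ) = 0 := le_antisymm (not_lt.1 h) (Real.sqrt_nonneg _)
    rw [this] at hK
    linarith
  obtain ⟨K, hKdef⟩ : ∃ K : ℝ, K = r ^ 2 * √n / d := ⟨_, rfl⟩
  have hK1 : 1 ≤ K := by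
    rw [hKdef, one_le_div hd0]
    exact hK
  have hK0 : 0 < K := by linarith
  obtain ⟨L, hL, hL₁, hL₂⟩ := exists_cube_between hK1
  have hL0 : (0 : ℝ) < L := by exact_mod_cast hL
  let S : Schedule :=
    { L := L
      M₀ := ⌈K * d ^ 2 / (r ^ 4 * L)⌉₊
      M := ⌈K * d / r ^ 4⌉₊
      R := Nat.log 2 d
      τ := 3 * (r ^ 2 / (256 * d)) }
  have hpos₀ : 0 < K * d ^ 2 / (r ^ 4 * L) := by positivity
  have hpos : 0 < K * d / r ^ 4 := by positivity
  have hM₀ : K * d ^ 2 / (r ^ 4 * L) ≤ S.M₀ := Nat.le_ceil _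
  have hM₀' : S.M₀ ≤ K * d ^ 2 / (r ^ 4 * L) + 1 := (Nat.ceil_lt_add_one hpos₀.le).le
  have hM : K * d / r ^ 4 ≤ S.M := Nat.le_ceil _
  have hM' : S.M ≤ K * d / r ^ 4 + 1 := (Nat.ceil_lt_add_one hpos.le).le
  have hcost := schedule_cost_le (N := (S.start d (S.R + 1) : ℝ)) (R := Nat.log 2 d) hd1 hr hr1
    hK1 (by exact_mod_cast hL) hL₂ hM₀' hM' (by simp [Schedule.start, S])
  have hcostK : K * d ^ 2 / r ^ 2 = d * √n := by
    rw [hKdef]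
    field_simp
  rw [hcostK] at hcost
  have hu : 0 ≤ ((Nat.log 2 d : ℝ) + 1) * (d * √n) := by positivity
  refine ⟨S, fun θ hθ => ?_⟩
  rcases le_total (S.start d (S.R + 1)) n with hn | hn
  · refine (S.regret_policy_le hr hθ (by omega) (Nat.ceil_pos.2 hpos₀) (Nat.ceil_pos.2 hpos)
      (Nat.pow_log_le_self 2 (by omega)) (Nat.lt_pow_succ_log_self (by norm_num) d) rfl hn).trans ?_
    have hgap := mul_le_mul_of_nonneg_left (schedule_gap_le (R := Nat.log 2 d) hd1 hr hK1 hL hL₁ hL₂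
      hM₀ hM) (Nat.cast_nonneg (α := ℝ) n)
    have hgapK : (n : ℝ) * (r ^ 2 / K) = d * √n := by
      have : (n : ℝ) = √n * √n := (Real.mul_self_sqrt (Nat.cast_nonneg n)).symm
      rw [hKdef]
      field_simp
      rw [sq]
      exact this
    have h1 : (n : ℝ) * ((1604 + 384 * 256 ^ 4) * ((Nat.log 2 d + 1) * (r ^ 2 / K))) =
        (1604 + 384 * 256 ^ 4) * ((Nat.log 2 d + 1) * (d * √n)) := by
      rw [← hgapK]
      ring
    rw [h1] at hgap
    refine (add_le_add hcost hgap).trans (le_of_eq ?_)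
    ring
  · have h1 : (n : ℝ) * r ^ 2 ≤ S.start d (S.R + 1) * r ^ 2 := by gcongr
    have h2 := regret_le_mul_sq (S.policy d n) θ r
    linarith

end Tuning

end BanditPhaseRetrieval

/-- **Minimax cumulative regret upper bound.**  There is a universal constant `C > 0` such
that for every dimension `d ≥ 2`, horizon `n ≥ 2` and radius `r ∈ [0,1]`, there exists a
policy `π` such that for every parameter `θ⋆` on the sphere of radius `r`, the expected
regret satisfies `R_n(π, θ⋆) ≤ C · d · √(n · log n · log d)`. -/
theorem bandit_phase_retrieval_regret_upper_bound :
    ∃ C : ℝ, 0 < C ∧ ∀ d n : ℕ, 2 ≤ d → 2 ≤ n → ∀ r ∈ Set.Icc (0 : ℝ) 1,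
      ∃ (W : Type) (_ : MeasurableSpace W) (π : Policy d n W),
        ∀ θstar : EuclideanSpace ℝ (Fin d), ‖θstar‖ = r →
          π.regret θstar r ≤ C * d * Real.sqrt (n * Real.log n * Real.log d) := by
  refine ⟨3 * (1617 + 384 * 256 ^ 4), by norm_num, ?_⟩
  rintro d n hd hn r ⟨hr0, hr1⟩
  have hlog2 := Real.log_two_gt_d9
  have hlogd : Real.log 2 ≤ Real.log d := Real.log_le_log (by norm_num) (by exact_mod_cast hd)
  have hlogn : Real.log 2 ≤ Real.log n := Real.log_le_log (by norm_num) (by exact_mod_cast hn)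
  have hd0 : (0 : ℝ) < d := by positivity
  have hss : √(n : ℝ) * √n = n := Real.mul_self_sqrt (Nat.cast_nonneg n)
  have hs1 : 1 ≤ √(n : ℝ) := Real.one_le_sqrt.2 (by exact_mod_cast (by omega : 1 ≤ n))
  have hsplit : √((n : ℝ) * Real.log n * Real.log d) = √n * √(Real.log n * Real.log d) := by
    rw [mul_assoc, Real.sqrt_mul (Nat.cast_nonneg n)]
  rw [hsplit]
  rcases le_or_gt (d : ℝ) (r ^ 2 * √n) with hK | hK
  · have hr : 0 < r := by
      rcases hr0.eq_or_lt with h | h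
      · rw [← h] at hK
        norm_num at hK
        omega
      · exact h
    obtain ⟨S, hS⟩ := BanditPhaseRetrieval.exists_schedule_regret_le hd hr hr1 hK
    refine ⟨_, _, S.policy d n, fun θ hθ => (hS θ hθ).trans ?_⟩
    have hdn : (d : ℝ) ≤ n := by
      have h1 : r ^ 2 ≤ 1 := pow_le_one₀ hr0 hr1
      nlinarith
    have hmono : Real.log d ≤ Real.log n := Real.log_le_log hd0 hdn
    have h2 : Real.log d ≤ √(Real.log n * Real.log d) := by
      refine Real.le_sqrt_of_sq_le ?_
      rw [sq]
      exact mul_le_mul_of_nonneg_right hmono (by linarith)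
    have h3 : (Nat.log 2 d : ℝ) + 1 ≤ 3 * √(Real.log n * Real.log d) :=
      (BanditPhaseRetrieval.log_add_one_le hd).trans (by linarith)
    calc (1617 + 384 * 256 ^ 4) * (((Nat.log 2 d : ℝ) + 1) * (d * √n))
        ≤ (1617 + 384 * 256 ^ 4) * ((3 * √(Real.log n * Real.log d)) * (d * √n)) := by gcongr
      _ = 3 * (1617 + 384 * 256 ^ 4) * d * (√n * √(Real.log n * Real.log d)) := by ring
  · let S : BanditPhaseRetrieval.Schedule := ⟨0, 0, 0, 0, 0⟩
    refine ⟨_, _, S.policy d n, fun θ _ =>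
      (BanditPhaseRetrieval.regret_le_mul_sq _ θ r).trans ?_⟩
    have h1 : (n : ℝ) * r ^ 2 ≤ d * √n := by nlinarith
    have h2 : 1 / 2 ≤ √(Real.log n * Real.log d) := by
      refine Real.le_sqrt_of_sq_le ?_
      nlinarith
    calc (n : ℝ) * r ^ 2 ≤ d * √n := h1
      _ = 2 * d * (√n * (1 / 2)) := by ring
      _ ≤ 3 * (1617 + 384 * 256 ^ 4) * d * (√n * √(Real.log n * Real.log d)) := by
        gcongr
        norm_num
end

section
/- There exist a universal constant c > 0 and a threshold d₀ such that for every dimension d ≥ d₀ there is an n₀(d) with the following property: for every horizon n ≥ n₀(d) there exists a radius r ∈ [0,1] (one may take r² = √((d² + 2d)/(96·e·n))) such that for every policy π there is a parameter θ⋆ ∈ S^{d-1}_r with expected regret R_n(π, θ⋆) ≥ c · d · √n. -/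
open MeasureTheory ProbabilityTheory
open scoped RealInnerProductSpace

lemma sum_sign_sq (d : ℕ) (a : Fin d → ℝ) :
    ∑ e : Fin d → Bool, (∑ i, a i * (if e i then 1 else -1)) ^ 2 = 2 ^ d * ∑ i, a i ^ 2 := by
  induction d with
  | zero => simp
  | succ d ih =>
    rw [← (Fin.consEquiv fun _ => Bool).sum_comp, Fintype.sum_prod_type]
    simp only [Fintype.sum_bool, Fin.sum_univ_succ, Fin.consEquiv_apply, Fin.cons_zero,
      Fin.cons_succ, ← Finset.sum_add_distrib]
    have h := ih fun i => a i.succ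
    calc _ = ∑ e : Fin d → Bool, (2 * a 0 ^ 2 +
          2 * (∑ i, a i.succ * (if e i then 1 else -1)) ^ 2) :=
          Finset.sum_congr rfl fun e _ => by simp only [if_true, Bool.false_eq_true, if_false]; ring
      _ = _ := by
        rw [Finset.sum_add_distrib, ← Finset.mul_sum, ← Finset.mul_sum, h]
        simp
        ring

lemma sum_sign_pow_four_le (d : ℕ) (a : Fin d → ℝ) :
    ∑ e : Fin d → Bool, (∑ i, a i * (if e i then 1 else -1)) ^ 4 ≤
      3 * 2 ^ d * (∑ i, a i ^ 2) ^ 2 := by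
  induction d with
  | zero => simp
  | succ d ih =>
    rw [← (Fin.consEquiv fun _ => Bool).sum_comp, Fintype.sum_prod_type]
    simp only [Fintype.sum_bool, Fin.sum_univ_succ, Fin.consEquiv_apply, Fin.cons_zero,
      Fin.cons_succ, ← Finset.sum_add_distrib]
    have h := ih fun i => a i.succ
    have h2 := sum_sign_sq d fun i => a i.succ
    calc _ = ∑ e : Fin d → Bool, (2 * a 0 ^ 4 +
          12 * a 0 ^ 2 * (∑ i, a i.succ * (if e i then 1 else -1)) ^ 2 +
          2 * (∑ i, a i.succ * (if e i then 1 else -1)) ^ 4) :=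
          Finset.sum_congr rfl fun e _ => by simp only [if_true, Bool.false_eq_true, if_false]; ring
      _ = 2 * 2 ^ d * a 0 ^ 4 + 12 * a 0 ^ 2 * (2 ^ d * ∑ i : Fin d, a i.succ ^ 2) +
          2 * ∑ e : Fin d → Bool, (∑ i, a i.succ * (if e i then 1 else -1)) ^ 4 := by
        simp only [Finset.sum_add_distrib, ← Finset.mul_sum, h2, Finset.sum_const]
        simp
        ring
      _ ≤ _ := by
        have : (0 : ℝ) ≤ 2 ^ d * a 0 ^ 4 := by positivity
        rw [pow_succ 2 d]
        nlinarith

/-- The first `t` entries of a finite sequence. -/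
abbrev past {n : ℕ} (x : Fin n → ℝ) (t : Fin n) : Fin t → ℝ := fun s => x (s.castLE t.2.le)

/-- The observations `x t = m t (x 0, …, x (t - 1)) + η t` produced by the noise sequence `η`
and the predictable drift `m`. -/
noncomputable def observe (m : ∀ t : ℕ, (Fin t → ℝ) → ℝ) : ∀ n : ℕ, (Fin n → ℝ) → Fin n → ℝ
  | 0, η => η
  | n + 1, η => Fin.snoc (α := fun _ => ℝ) (observe m n (Fin.init η))
      (m n (observe m n (Fin.init η)) + η (Fin.last n))

/-- The martingale part `∑ t, m t (x 0, …, x (t - 1)) * x t` of the log-likelihood ratio. -/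
noncomputable def scoreSum (m : ∀ t : ℕ, (Fin t → ℝ) → ℝ) (n : ℕ) (x : Fin n → ℝ) : ℝ :=
  ∑ t : Fin n, m t (past x t) * x t

/-- The quadratic variation `∑ t, m t (x 0, …, x (t - 1)) ^ 2`. -/
noncomputable def driftEnergy (m : ∀ t : ℕ, (Fin t → ℝ) → ℝ) (n : ℕ) (x : Fin n → ℝ) : ℝ :=
  ∑ t : Fin n, m t (past x t) ^ 2

/-- The law of a sequence of `n` independent standard Gaussian variables. -/
noncomputable abbrev stdGaussianSeq (n : ℕ) : Measure (Fin n → ℝ) :=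
  Measure.pi fun _ : Fin n => gaussianReal 0 1

lemma past_snoc_castSucc {n : ℕ} (x : Fin n → ℝ) (y : ℝ) (t : Fin n) :
    past (Fin.snoc (α := fun _ => ℝ) x y) t.castSucc = past x t := by
  funext s
  have : (Fin.castLE t.castSucc.2.le s) = (Fin.castLE t.2.le s).castSucc := rfl
  simp only [past]
  rw [this, Fin.snoc_castSucc]

lemma past_snoc_last {n : ℕ} (x : Fin n → ℝ) (y : ℝ) :
    past (Fin.snoc (α := fun _ => ℝ) x y) (Fin.last n) = x := by
  funext s
  exact Fin.snoc_castSucc (α := fun _ => ℝ) y x s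

lemma scoreSum_snoc (m : ∀ t : ℕ, (Fin t → ℝ) → ℝ) (n : ℕ) (x : Fin n → ℝ) (y : ℝ) :
    scoreSum m (n + 1) (Fin.snoc (α := fun _ => ℝ) x y) = scoreSum m n x + m n x * y := by
  unfold scoreSum
  rw [Fin.sum_univ_castSucc]
  congr 1
  · refine Finset.sum_congr rfl fun t _ => ?_
    rw [past_snoc_castSucc, Fin.snoc_castSucc]
    rfl
  · rw [past_snoc_last, Fin.snoc_last]
    rfl

lemma driftEnergy_snoc (m : ∀ t : ℕ, (Fin t → ℝ) → ℝ) (n : ℕ) (x : Fin n → ℝ) (y : ℝ) :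
    driftEnergy m (n + 1) (Fin.snoc (α := fun _ => ℝ) x y) = driftEnergy m n x + m n x ^ 2 := by
  unfold driftEnergy
  rw [Fin.sum_univ_castSucc]
  congr 1
  · refine Finset.sum_congr rfl fun t _ => ?_
    rw [past_snoc_castSucc]
    rfl
  · rw [past_snoc_last]
    rfl

lemma measurable_snoc (n : ℕ) :
    Measurable fun p : (Fin n → ℝ) × ℝ => Fin.snoc (α := fun _ => ℝ) p.1 p.2 := by
  refine measurable_pi_iff.2 fun i => ?_
  refine Fin.lastCases ?_ (fun i => ?_) i
  · simpa only [Fin.snoc_last] using measurable_snd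
  · simp only [Fin.snoc_castSucc]
    fun_prop

lemma measurable_past {n : ℕ} (t : Fin n) : Measurable fun x : Fin n → ℝ => past x t := by
  unfold past
  fun_prop

lemma measurable_observe {m : ∀ t : ℕ, (Fin t → ℝ) → ℝ} (hm : ∀ t, Measurable (m t)) (n : ℕ) :
    Measurable (observe m n) := by
  induction n with
  | zero => exact measurable_id
  | succ n ih =>
    have hi : Measurable fun η : Fin (n + 1) → ℝ => observe m n (Fin.init η) :=
      ih.comp (by unfold Fin.init; fun_prop)
    exact (measurable_snoc n).comp (hi.prodMk (((hm n).comp hi).add (measurable_pi_apply _)))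

lemma measurable_scoreSum {m : ∀ t : ℕ, (Fin t → ℝ) → ℝ} (hm : ∀ t, Measurable (m t)) (n : ℕ) :
    Measurable (scoreSum m n) :=
  Finset.measurable_sum _ fun t _ => ((hm t).comp (measurable_past t)).mul (measurable_pi_apply t)

lemma measurable_driftEnergy {m : ∀ t : ℕ, (Fin t → ℝ) → ℝ} (hm : ∀ t, Measurable (m t))
    (n : ℕ) : Measurable (driftEnergy m n) :=
  Finset.measurable_sum _ fun t _ => ((hm t).comp (measurable_past t)).pow_const 2

lemma driftEnergy_nonneg (m : ∀ t : ℕ, (Fin t → ℝ) → ℝ) (n : ℕ) (x : Fin n → ℝ) :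
    0 ≤ driftEnergy m n x :=
  Finset.sum_nonneg fun _ _ => sq_nonneg _

lemma integrable_driftEnergy {m : ∀ t : ℕ, (Fin t → ℝ) → ℝ} (hm : ∀ t, Measurable (m t))
    {B : ℝ} (hB : ∀ t x, |m t x| ≤ B) (n : ℕ) :
    Integrable (driftEnergy m n) (stdGaussianSeq n) := by
  refine Integrable.of_bound (measurable_driftEnergy hm n).aestronglyMeasurable (n * B ^ 2)
    (ae_of_all _ fun x => ?_)
  rw [Real.norm_of_nonneg (driftEnergy_nonneg m n x)]
  calc driftEnergy m n x ≤ ∑ _t : Fin n, B ^ 2 :=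
        Finset.sum_le_sum fun t _ => sq_le_sq' (abs_le.1 (hB _ _)).1 (abs_le.1 (hB _ _)).2
    _ = _ := by simp

lemma lintegral_stdGaussianSeq_succ (n : ℕ) {F : (Fin (n + 1) → ℝ) → ENNReal}
    (hF : Measurable F) :
    ∫⁻ x, F x ∂stdGaussianSeq (n + 1) =
      ∫⁻ x, ∫⁻ y, F (Fin.snoc (α := fun _ => ℝ) x y) ∂gaussianReal 0 1 ∂stdGaussianSeq n := by
  have h := (measurePreserving_piFinSuccAbove (fun _ : Fin (n + 1) => gaussianReal 0 1)
    (Fin.last n)).symm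
  rw [← h.lintegral_comp hF, lintegral_prod_symm]
  · refine lintegral_congr fun x => lintegral_congr fun y => ?_
    congr 1
    exact Fin.insertNth_last' y x
  · exact (hF.comp h.measurable).aemeasurable

lemma lintegral_gaussianReal_add (c : ℝ) {g : ℝ → ENNReal} (hg : Measurable g) :
    ∫⁻ y, g (c + y) ∂gaussianReal 0 1 =
      ∫⁻ y, ENNReal.ofReal (Real.exp (c * y - c ^ 2 / 2)) * g y ∂gaussianReal 0 1 := by
  have h : gaussianReal c 1 = (gaussianReal 0 1).map (fun y => c + y) := by
    rw [gaussianReal_map_const_add, zero_add]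
  rw [← lintegral_map hg (measurable_const_add c), ← h,
    gaussianReal_of_var_ne_zero _ one_ne_zero, gaussianReal_of_var_ne_zero _ one_ne_zero,
    lintegral_withDensity_eq_lintegral_mul _ (measurable_gaussianPDF _ _) hg,
    lintegral_withDensity_eq_lintegral_mul _ (measurable_gaussianPDF _ _) (by fun_prop)]
  refine lintegral_congr fun y => ?_
  simp only [Pi.mul_apply, gaussianPDF]
  rw [← mul_assoc, ← ENNReal.ofReal_mul (gaussianPDFReal_nonneg _ _ _)]
  congr 2
  simp only [gaussianPDFReal, mul_assoc, ← Real.exp_add]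
  congr 3
  simp
  ring

/-- Girsanov's formula for predictable drifts. -/
lemma lintegral_comp_observe {m : ∀ t : ℕ, (Fin t → ℝ) → ℝ} (hm : ∀ t, Measurable (m t))
    (n : ℕ) {g : (Fin n → ℝ) → ENNReal} (hg : Measurable g) :
    ∫⁻ η, g (observe m n η) ∂stdGaussianSeq n =
      ∫⁻ x, ENNReal.ofReal (Real.exp (scoreSum m n x - driftEnergy m n x / 2)) * g x
        ∂stdGaussianSeq n := by
  induction n with
  | zero => simp [observe, scoreSum, driftEnergy]
  | succ n ih =>
    have hs := measurable_snoc n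
    have hS := measurable_scoreSum hm
    have hD := measurable_driftEnergy hm
    have h1 : Measurable fun p : (Fin n → ℝ) × ℝ => g (Fin.snoc (α := fun _ => ℝ) p.1 p.2) :=
      hg.comp hs
    rw [lintegral_stdGaussianSeq_succ n (F := fun η => g (observe m (n + 1) η))
        (hg.comp (measurable_observe hm _)),
      lintegral_stdGaussianSeq_succ n (by fun_prop)]
    set G : (Fin n → ℝ) → ENNReal := fun x =>
      ∫⁻ y, g (Fin.snoc (α := fun _ => ℝ) x (m n x + y)) ∂gaussianReal 0 1 with hGdef
    have hG : Measurable G := by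
      refine Measurable.lintegral_prod_right' (f := fun p : (Fin n → ℝ) × ℝ =>
        g (Fin.snoc (α := fun _ => ℝ) p.1 (m n p.1 + p.2))) ?_
      exact h1.comp (measurable_fst.prodMk (((hm n).comp measurable_fst).add measurable_snd))
    calc _ = ∫⁻ η, G (observe m n η) ∂stdGaussianSeq n := by
          simp only [hGdef, observe, Fin.init_snoc, Fin.snoc_last]
      _ = _ := by
        rw [ih hG]
        refine lintegral_congr fun x => ?_
        rw [hGdef]
        simp only
        rw [lintegral_gaussianReal_add (m n x)
          (g := fun y => g (Fin.snoc (α := fun _ => ℝ) x y)) (h1.comp measurable_prodMk_left),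
          ← lintegral_const_mul]
        · refine lintegral_congr fun y => ?_
          rw [← mul_assoc, ← ENNReal.ofReal_mul (Real.exp_nonneg _), ← Real.exp_add,
            scoreSum_snoc, driftEnergy_snoc]
          congr 3
          ring_nf
        · exact Measurable.mul (by fun_prop) (h1.comp measurable_prodMk_left)

lemma lintegral_gaussianReal_sq (z c : ℝ) :
    ∫⁻ y, ENNReal.ofReal ((z + c * y) ^ 2) ∂gaussianReal 0 1 = ENNReal.ofReal (z ^ 2 + c ^ 2) := by
  have h2 : MemLp (id : ℝ → ℝ) 2 (gaussianReal 0 1) := memLp_id_gaussianReal 2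
  have hi1 : Integrable (fun y : ℝ => y) (gaussianReal 0 1) := h2.integrable one_le_two
  have hi2 : Integrable (fun y : ℝ => y ^ 2) (gaussianReal 0 1) := h2.integrable_sq
  have hv : ∫ y : ℝ, y ^ 2 ∂gaussianReal 0 1 = 1 := by
    have := variance_id_gaussianReal (μ := 0) (v := 1)
    rw [variance_eq_sub h2] at this
    simpa using this
  have he : (fun y : ℝ => (z + c * y) ^ 2) = fun y => z ^ 2 + 2 * z * c * y + c ^ 2 * y ^ 2 := by
    funext y; ring
  have hl : Integrable (fun y : ℝ => z ^ 2 + 2 * z * c * y) (gaussianReal 0 1) :=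
    (integrable_const _).add (hi1.const_mul _)
  have hi : Integrable (fun y : ℝ => (z + c * y) ^ 2) (gaussianReal 0 1) := by
    rw [he]
    exact hl.add (hi2.const_mul _)
  rw [← ofReal_integral_eq_lintegral_ofReal hi (ae_of_all _ fun y => sq_nonneg _), he,
    integral_add hl (hi2.const_mul _),
    integral_add (integrable_const _) (hi1.const_mul _), integral_const_mul, integral_const_mul,
    hv, integral_id_gaussianReal]
  simp

/-- The Itô isometry for predictable integrands. -/
lemma lintegral_scoreSum_sq {m : ∀ t : ℕ, (Fin t → ℝ) → ℝ} (hm : ∀ t, Measurable (m t)) (n : ℕ) :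
    ∫⁻ x, ENNReal.ofReal (scoreSum m n x ^ 2) ∂stdGaussianSeq n =
      ∫⁻ x, ENNReal.ofReal (driftEnergy m n x) ∂stdGaussianSeq n := by
  induction n with
  | zero => simp [scoreSum, driftEnergy]
  | succ n ih =>
    have hS := measurable_scoreSum hm
    have hD := measurable_driftEnergy hm
    rw [lintegral_stdGaussianSeq_succ n ((hS _).pow_const 2).ennreal_ofReal,
      lintegral_stdGaussianSeq_succ n (hD _).ennreal_ofReal]
    simp only [scoreSum_snoc, driftEnergy_snoc, lintegral_gaussianReal_sq, lintegral_const,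
      measure_univ, mul_one]
    simp only [ENNReal.ofReal_add (sq_nonneg _) (sq_nonneg _),
      ENNReal.ofReal_add (driftEnergy_nonneg m n _) (sq_nonneg _)]
    rw [lintegral_add_left ((hS n).pow_const 2).ennreal_ofReal,
      lintegral_add_left (hD n).ennreal_ofReal, ih]

/-- Changing the drift from `0` to `m` changes the mean of a `[0, 1]`-valued statistic by an
amount controlled by the expected drift energy under the driftless law. -/
lemma integral_comp_observe_le {m : ∀ t : ℕ, (Fin t → ℝ) → ℝ} (hm : ∀ t, Measurable (m t))
    {B : ℝ} (hB : ∀ t x, |m t x| ≤ B) (n : ℕ) {f : (Fin n → ℝ) → ℝ} (hf : Measurable f)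
    (hf0 : ∀ x, 0 ≤ f x) (hf1 : ∀ x, f x ≤ 1) :
    ∫ η, f (observe m n η) ∂stdGaussianSeq n ≤
      ∫ x, f x ∂stdGaussianSeq n + 1 / 4 + 3 / 2 * ∫ x, driftEnergy m n x ∂stdGaussianSeq n := by
  have hS := measurable_scoreSum hm n
  have hD := measurable_driftEnergy hm n
  have hD0 := driftEnergy_nonneg m n
  have hDi := integrable_driftEnergy hm hB n
  have hfi : Integrable f (stdGaussianSeq n) :=
    Integrable.of_bound hf.aestronglyMeasurable 1 (ae_of_all _ fun x => by
      rw [Real.norm_of_nonneg (hf0 x)]; exact hf1 x)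
  have hTi : Integrable (fun η => f (observe m n η)) (stdGaussianSeq n) :=
    Integrable.of_bound (hf.comp (measurable_observe hm n)).aestronglyMeasurable 1
      (ae_of_all _ fun x => by rw [Real.norm_of_nonneg (hf0 _)]; exact hf1 _)
  have hf' : Integrable (fun x => 1 - f x) (stdGaussianSeq n) := (integrable_const _).sub hfi
  have hT' : Integrable (fun η => 1 - f (observe m n η)) (stdGaussianSeq n) :=
    (integrable_const _).sub hTi
  have hpt : ∀ x, ENNReal.ofReal (1 - f x) ≤
      ENNReal.ofReal (Real.exp (scoreSum m n x - driftEnergy m n x / 2)) * ENNReal.ofReal (1 - f x)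
        + (ENNReal.ofReal (1 / 4) + ENNReal.ofReal (driftEnergy m n x / 2) +
          ENNReal.ofReal (scoreSum m n x ^ 2)) := by
    intro x
    have h0 := hD0 x
    have h1 : 0 ≤ 1 - f x := sub_nonneg.2 (hf1 x)
    rw [← ENNReal.ofReal_mul (Real.exp_nonneg _), ← ENNReal.ofReal_add (by norm_num) (by linarith),
      ← ENNReal.ofReal_add (by linarith) (sq_nonneg _),
      ← ENNReal.ofReal_add (mul_nonneg (Real.exp_nonneg _) h1) (by positivity)]
    refine ENNReal.ofReal_le_ofReal ?_
    have he := Real.add_one_le_exp (scoreSum m n x - driftEnergy m n x / 2)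
    have h2 := mul_le_mul_of_nonneg_right he h1
    nlinarith [hf0 x, mul_nonneg (hf0 x) h0, sq_nonneg (scoreSum m n x + (1 - f x) / 2),
      mul_nonneg (hf0 x) h1]
  have hle := lintegral_mono (μ := stdGaussianSeq n) hpt
  have hmf : Measurable fun x => ENNReal.ofReal (1 - f x) :=
    (measurable_const.sub hf).ennreal_ofReal
  rw [lintegral_add_right _ (by fun_prop),
    ← lintegral_comp_observe hm n (g := fun x => ENNReal.ofReal (1 - f x)) hmf,
    lintegral_add_right _ (by fun_prop), lintegral_add_right _ (by fun_prop),
    lintegral_scoreSum_sq hm,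
    ← ofReal_integral_eq_lintegral_ofReal hf' (ae_of_all _ fun x => sub_nonneg.2 (hf1 x)),
    ← ofReal_integral_eq_lintegral_ofReal hT' (ae_of_all _ fun x => sub_nonneg.2 (hf1 _)),
    ← ofReal_integral_eq_lintegral_ofReal hDi (ae_of_all _ hD0),
    ← ofReal_integral_eq_lintegral_ofReal (hDi.div_const 2)
      (ae_of_all _ fun x => div_nonneg (hD0 x) zero_le_two),
    lintegral_const, measure_univ, mul_one] at hle
  have hI0 : 0 ≤ ∫ x, driftEnergy m n x ∂stdGaussianSeq n := integral_nonneg hD0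
  have hI1 : 0 ≤ ∫ x, driftEnergy m n x / 2 ∂stdGaussianSeq n :=
    integral_nonneg fun x => div_nonneg (hD0 x) zero_le_two
  have hT0 : 0 ≤ ∫ η, (1 - f (observe m n η)) ∂stdGaussianSeq n :=
    integral_nonneg fun x => sub_nonneg.2 (hf1 _)
  rw [← ENNReal.ofReal_add (by norm_num) hI1, ← ENNReal.ofReal_add (by positivity) hI0,
    ← ENNReal.ofReal_add hT0 (by positivity),
    ENNReal.ofReal_le_ofReal_iff (by positivity), integral_div,
    integral_sub (integrable_const _) hfi, integral_sub (integrable_const _) hTi] at hle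
  simp only [integral_const, probReal_univ, smul_eq_mul, mul_one] at hle
  linarith

/-- The vector of norm `r` with all coordinates equal to `± r / √d`, with signs given by `e`. -/
noncomputable def signVector (d : ℕ) (r : ℝ) (e : Fin d → Bool) : EuclideanSpace ℝ (Fin d) :=
  WithLp.toLp 2 fun i => r / √d * (if e i then 1 else -1)

lemma norm_signVector {d : ℕ} (hd : 0 < d) {r : ℝ} (hr : 0 ≤ r) (e : Fin d → Bool) :
    ‖signVector d r e‖ = r := by
  have hd' : (0 : ℝ) < d := by exact_mod_cast hd
  rw [EuclideanSpace.norm_eq, Real.sqrt_eq_iff_mul_self_eq (by positivity) hr]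
  have : ∀ i, ‖signVector d r e i‖ ^ 2 = r ^ 2 / d := fun i => by
    simp only [signVector, Real.norm_eq_abs, sq_abs]
    split_ifs <;> simp [div_pow, Real.sq_sqrt hd'.le]
  simp only [this, Finset.sum_const, Finset.card_univ, Fintype.card_fin, nsmul_eq_mul]
  field_simp

lemma inner_signVector {d : ℕ} (r : ℝ) (e : Fin d → Bool) (a : EuclideanSpace ℝ (Fin d)) :
    ⟪a, signVector d r e⟫ = r / √d * ∑ i, a i * (if e i then 1 else -1) := by
  rw [PiLp.inner_apply, Finset.mul_sum]
  refine Finset.sum_congr rfl fun i _ => ?_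
  simp only [signVector, RCLike.inner_apply, conj_trivial]
  ring

lemma sum_inner_signVector_sq_le {d : ℕ} (r : ℝ) {a : EuclideanSpace ℝ (Fin d)} (ha : ‖a‖ ≤ 1) :
    ∑ e, ⟪a, signVector d r e⟫ ^ 2 ≤ 2 ^ d * (r ^ 2 / d) := by
  have hn : ∑ i, a i ^ 2 ≤ 1 := by
    rw [← EuclideanSpace.real_norm_sq_eq]
    exact pow_le_one₀ (norm_nonneg _) ha
  simp only [inner_signVector, mul_pow, ← Finset.mul_sum, sum_sign_sq, div_pow,
    Real.sq_sqrt (Nat.cast_nonneg d)]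
  calc r ^ 2 / d * (2 ^ d * ∑ i, a i ^ 2) ≤ r ^ 2 / d * (2 ^ d * 1) := by gcongr
    _ = _ := by ring

lemma sum_inner_signVector_pow_four_le {d : ℕ} (r : ℝ) {a : EuclideanSpace ℝ (Fin d)}
    (ha : ‖a‖ ≤ 1) :
    ∑ e, (⟪a, signVector d r e⟫ ^ 2) ^ 2 ≤ 3 * 2 ^ d * (r ^ 2 / d) ^ 2 := by
  have hn : ∑ i, a i ^ 2 ≤ 1 := by
    rw [← EuclideanSpace.real_norm_sq_eq]
    exact pow_le_one₀ (norm_nonneg _) ha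
  have hn0 : 0 ≤ ∑ i, a i ^ 2 := Finset.sum_nonneg fun _ _ => sq_nonneg _
  have h4 := sum_sign_pow_four_le d fun i => a i
  calc ∑ e, (⟪a, signVector d r e⟫ ^ 2) ^ 2
      = (r ^ 2 / d) ^ 2 * ∑ e : Fin d → Bool, (∑ i, a i * (if e i then 1 else -1)) ^ 4 := by
        rw [Finset.mul_sum]
        refine Finset.sum_congr rfl fun e _ => ?_
        rw [inner_signVector, mul_pow, mul_pow, div_pow, Real.sq_sqrt (Nat.cast_nonneg d)]
        ring
    _ ≤ (r ^ 2 / d) ^ 2 * (3 * 2 ^ d * 1) := by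
        refine mul_le_mul_of_nonneg_left (h4.trans ?_) (sq_nonneg _)
        gcongr
        exact pow_le_one₀ hn0 hn
    _ = _ := by ring

namespace Policy

variable {d n : ℕ} {W : Type} [MeasurableSpace W]

/-- The mean reward of the action of `π` as a function of the past rewards, for a fixed seed. -/
noncomputable def drift (π : Policy d n W) (w : W) (θ : EuclideanSpace ℝ (Fin d)) (t : ℕ)
    (x : Fin t → ℝ) : ℝ :=
  if h : t < n then ⟪π.act ⟨t, h⟩ (w, x), θ⟫ ^ 2 else 0

lemma measurable_drift (π : Policy d n W) (w : W) (θ : EuclideanSpace ℝ (Fin d)) (t : ℕ) :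
    Measurable (π.drift w θ t) := by
  unfold drift
  split_ifs with h
  · have := (π.act_meas ⟨t, h⟩).comp (measurable_prodMk_left (x := w))
    exact (this.inner_const).pow_const 2
  · exact measurable_const

lemma inner_act_sq_le (π : Policy d n W) (t : Fin n) (p : W × (Fin t → ℝ))
    (θ : EuclideanSpace ℝ (Fin d)) : ⟪π.act t p, θ⟫ ^ 2 ≤ ‖θ‖ ^ 2 := by
  rw [← sq_abs]
  gcongr
  calc |⟪π.act t p, θ⟫| ≤ ‖π.act t p‖ * ‖θ‖ := abs_real_inner_le_norm _ _
    _ ≤ 1 * ‖θ‖ := by gcongr; exact π.act_mem t p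
    _ = _ := one_mul _

lemma abs_drift_le (π : Policy d n W) (w : W) (θ : EuclideanSpace ℝ (Fin d)) (t : ℕ)
    (x : Fin t → ℝ) : |π.drift w θ t x| ≤ ‖θ‖ ^ 2 := by
  unfold drift
  split_ifs with h
  · rw [abs_of_nonneg (sq_nonneg _)]
    exact π.inner_act_sq_le _ _ _
  · simp

lemma drift_past (π : Policy d n W) (w : W) (θ : EuclideanSpace ℝ (Fin d)) (t : Fin n)
    (x : Fin n → ℝ) : π.drift w θ t (past x t) = ⟪π.act t (w, past x t), θ⟫ ^ 2 := by
  simp [drift]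

lemma X_of_lt (π : Policy d n W) (θ : EuclideanSpace ℝ (Fin d)) {t : ℕ} (h : t < n)
    (ω : W × (Fin n → ℝ)) :
    π.X θ t ω = ⟪π.act ⟨t, h⟩ (ω.1, fun s : Fin t => π.X θ s.val ω), θ⟫ ^ 2 + ω.2 ⟨t, h⟩ := by
  rw [X]
  simp only [dif_pos h]

lemma X_eq_observe (π : Policy d n W) (θ : EuclideanSpace ℝ (Fin d)) (w : W) (η : Fin n → ℝ)
    (t : ℕ) (ht : t ≤ n) :
    (fun s : Fin t => π.X θ s.val (w, η)) =
      observe (π.drift w θ) t fun s => η (s.castLE ht) := by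
  induction t with
  | zero => exact funext fun s => s.elim0
  | succ t ih =>
    have ih := ih (by omega)
    have ht' : t < n := ht
    funext s
    rw [observe]
    refine Fin.lastCases ?_ (fun s => ?_) s
    · rw [Fin.snoc_last, Fin.val_last, π.X_of_lt θ ht', drift, dif_pos ht', ih]
      rfl
    · rw [Fin.snoc_castSucc]
      exact congrFun ih s

lemma inner_A_sq (π : Policy d n W) (θ : EuclideanSpace ℝ (Fin d)) (w : W) (η : Fin n → ℝ)
    (t : Fin n) :
    ⟪π.A θ t (w, η), θ⟫ ^ 2 = π.drift w θ t (past (observe (π.drift w θ) n η) t) := by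
  rw [drift_past, ← show _ = observe (π.drift w θ) n η from π.X_eq_observe θ w η n le_rfl]
  rfl

lemma measurable_X (π : Policy d n W) (θ : EuclideanSpace ℝ (Fin d)) (t : ℕ) :
    Measurable (π.X θ t) := by
  induction t using Nat.strong_induction_on with
  | _ t ih =>
    by_cases h : t < n
    · rw [funext (π.X_of_lt θ h)]
      have hp : Measurable fun ω : W × (Fin n → ℝ) =>
          (ω.1, fun s : Fin t => π.X θ s.val ω) :=
        measurable_fst.prodMk (measurable_pi_iff.2 fun s => ih s s.2)
      exact ((((π.act_meas ⟨t, h⟩).comp hp).inner_const).pow_const 2).add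
        ((measurable_pi_apply _).comp measurable_snd)
    · have : π.X θ t = fun _ => 0 := by
        rw [X]
        simp only [dif_neg h]
      rw [this]
      exact measurable_const

lemma measurable_A (π : Policy d n W) (θ : EuclideanSpace ℝ (Fin d)) (t : Fin n) :
    Measurable (π.A θ t) :=
  (π.act_meas t).comp
    (measurable_fst.prodMk (measurable_pi_iff.2 fun s => π.measurable_X θ s.val))

lemma sum_inner_A_sq_le (π : Policy d n W) (θ : EuclideanSpace ℝ (Fin d))
    (ω : W × (Fin n → ℝ)) : ∑ t, ⟪π.A θ t ω, θ⟫ ^ 2 ≤ n * ‖θ‖ ^ 2 := by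
  calc ∑ t, ⟪π.A θ t ω, θ⟫ ^ 2 ≤ ∑ _t : Fin n, ‖θ‖ ^ 2 :=
        Finset.sum_le_sum fun t _ => π.inner_act_sq_le t _ θ
    _ = _ := by simp

lemma integrable_sum_inner_A_sq (π : Policy d n W) (θ : EuclideanSpace ℝ (Fin d)) :
    Integrable (fun ω => ∑ t, ⟪π.A θ t ω, θ⟫ ^ 2) π.μ := by
  have := π.probW
  have hp : IsProbabilityMeasure π.μ := by unfold μ; infer_instance
  refine Integrable.of_bound (C := n * ‖θ‖ ^ 2) ?_ (ae_of_all _ fun ω => ?_)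
  · exact (Finset.measurable_sum _ fun t _ =>
      ((π.measurable_A θ t).inner_const).pow_const 2).aestronglyMeasurable
  · rw [Real.norm_of_nonneg (Finset.sum_nonneg fun _ _ => sq_nonneg _)]
    exact π.sum_inner_A_sq_le θ ω

/-- For a fixed seed, the expected cumulative reward averaged over the sign vectors of norm `r` is
bounded away from its maximal value `n * r ^ 2`. -/
lemma sum_integral_reward_le (π : Policy d n W) (w : W) (hd : 4 ≤ d) (hn : 0 < n) {r : ℝ}
    (hr : 0 < r) (hrn : 36 * n * (r ^ 2) ^ 2 = d ^ 2) :
    ∑ e : Fin d → Bool, ∫ η, ∑ t, ⟪π.A (signVector d r e) t (w, η), signVector d r e⟫ ^ 2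
      ∂stdGaussianSeq n ≤ 2 ^ d * (5 / 8 * (n * r ^ 2)) := by
  have hd0 : (0 : ℝ) < d := by exact_mod_cast (show 0 < d by omega)
  have hn0 : (0 : ℝ) < n := by exact_mod_cast hn
  set M : ℝ := n * r ^ 2 with hM
  have hM0 : 0 < M := by positivity
  set m : (Fin d → Bool) → ∀ t : ℕ, (Fin t → ℝ) → ℝ := fun e => π.drift w (signVector d r e)
    with hmdef
  set f : (Fin d → Bool) → (Fin n → ℝ) → ℝ := fun e x => (∑ t : Fin n, m e t (past x t)) / M
    with hfdef
  have hm : ∀ e t, Measurable (m e t) := fun e t => π.measurable_drift w _ t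
  have hmB : ∀ e t x, |m e t x| ≤ r ^ 2 := fun e t x => by
    simpa only [norm_signVector (show 0 < d by omega) hr.le] using
      π.abs_drift_le w (signVector d r e) t x
  have hm0 : ∀ e (t : Fin n) x, 0 ≤ m e t (past x t) := fun e t x => by
    simp only [hmdef, drift_past]
    positivity
  have hf : ∀ e, Measurable (f e) := fun e => (Finset.measurable_sum _ fun (t : Fin n) _ =>
    (hm e t).comp (measurable_past t)).div_const M
  have hf0 : ∀ e x, 0 ≤ f e x := fun e x =>
    div_nonneg (Finset.sum_nonneg fun t _ => hm0 e t x) hM0.le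
  have hf1 : ∀ e x, f e x ≤ 1 := fun e x => by
    rw [hfdef]
    simp only
    rw [div_le_one hM0]
    calc ∑ t : Fin n, m e t (past x t) ≤ ∑ _t : Fin n, r ^ 2 :=
          Finset.sum_le_sum fun t _ => (abs_le.1 (hmB e t _)).2
      _ = M := by simp [hM]
  have hfi : ∀ e, Integrable (f e) (stdGaussianSeq n) := fun e =>
    Integrable.of_bound (hf e).aestronglyMeasurable 1 (ae_of_all _ fun x => by
      rw [Real.norm_of_nonneg (hf0 e x)]; exact hf1 e x)
  have hDi := fun e => integrable_driftEnergy (hm e) (hmB e) n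
  have hF : ∑ e, ∫ x, f e x ∂stdGaussianSeq n ≤ 2 ^ d * (1 / 4) := by
    rw [← integral_finsetSum _ fun e _ => hfi e]
    calc ∫ x, ∑ e, f e x ∂stdGaussianSeq n ≤ ∫ _x, 2 ^ d * (1 / 4) ∂stdGaussianSeq n := by
          refine integral_mono (integrable_finsetSum _ fun e _ => hfi e) (integrable_const _)
            fun x => ?_
          simp only [hfdef, hmdef, drift_past]
          rw [← Finset.sum_div, Finset.sum_comm, div_le_iff₀ hM0]
          calc _ ≤ ∑ _t : Fin n, 2 ^ d * (r ^ 2 / d) :=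
                Finset.sum_le_sum fun t _ => sum_inner_signVector_sq_le r (π.act_mem t _)
            _ = 2 ^ d * (1 / d) * M := by simp [hM]; ring
            _ ≤ _ := by gcongr; exact_mod_cast hd
      _ = _ := by simp
  have hQ : ∑ e, ∫ x, driftEnergy (m e) n x ∂stdGaussianSeq n ≤ 2 ^ d * (1 / 12) := by
    rw [← integral_finsetSum _ fun e _ => hDi e]
    calc ∫ x, ∑ e, driftEnergy (m e) n x ∂stdGaussianSeq n
        ≤ ∫ _x, 2 ^ d * (1 / 12) ∂stdGaussianSeq n := by
          refine integral_mono (integrable_finsetSum _ fun e _ => hDi e) (integrable_const _)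
            fun x => ?_
          simp only [driftEnergy, hmdef, drift_past]
          rw [Finset.sum_comm]
          calc _ ≤ ∑ _t : Fin n, 3 * 2 ^ d * (r ^ 2 / d) ^ 2 :=
                Finset.sum_le_sum fun t _ => sum_inner_signVector_pow_four_le r (π.act_mem t _)
            _ = 2 ^ d * (1 / 12) * (36 * n * (r ^ 2) ^ 2 / d ^ 2) := by simp; ring
            _ = _ := by rw [hrn, div_self (by positivity), mul_one]
      _ = _ := by simp
  have hE : ∀ e, ∫ η, ∑ t, ⟪π.A (signVector d r e) t (w, η), signVector d r e⟫ ^ 2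
      ∂stdGaussianSeq n = M * ∫ η, f e (observe (m e) n η) ∂stdGaussianSeq n := fun e => by
    rw [← integral_const_mul]
    refine integral_congr_ae (ae_of_all _ fun η => ?_)
    simp only [inner_A_sq, hfdef, hmdef]
    rw [mul_div_cancel₀ _ hM0.ne']
  simp only [hE, ← Finset.mul_sum]
  calc M * ∑ e, ∫ η, f e (observe (m e) n η) ∂stdGaussianSeq n
      ≤ M * ∑ e, (∫ x, f e x ∂stdGaussianSeq n + 1 / 4 +
          3 / 2 * ∫ x, driftEnergy (m e) n x ∂stdGaussianSeq n) := by
        gcongr with e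
        exact integral_comp_observe_le (hm e) (hmB e) n (hf e) (hf0 e) (hf1 e)
    _ = M * (∑ e, ∫ x, f e x ∂stdGaussianSeq n + 2 ^ d * (1 / 4) +
          3 / 2 * ∑ e, ∫ x, driftEnergy (m e) n x ∂stdGaussianSeq n) := by
        rw [Finset.sum_add_distrib, Finset.sum_add_distrib, ← Finset.mul_sum]
        simp
    _ ≤ M * (2 ^ d * (1 / 4) + 2 ^ d * (1 / 4) + 3 / 2 * (2 ^ d * (1 / 12))) := by gcongr
    _ = _ := by ring

lemma exists_signVector_regret_ge (π : Policy d n W) (hd : 4 ≤ d) (hn : 0 < n) {r : ℝ}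
    (hr : 0 < r) (hrn : 36 * n * (r ^ 2) ^ 2 = d ^ 2) :
    ∃ e : Fin d → Bool, 3 / 8 * (n * r ^ 2) ≤ π.regret (signVector d r e) r := by
  have := π.probW
  have hi := fun e => π.integrable_sum_inner_A_sq (signVector d r e)
  unfold μ at hi
  have hsum : ∑ e : Fin d → Bool,
      ∫ ω, ∑ t, ⟪π.A (signVector d r e) t ω, signVector d r e⟫ ^ 2 ∂π.μ ≤
        2 ^ d * (5 / 8 * (n * r ^ 2)) := by
    unfold μ
    simp only [fun e => integral_prod _ (hi e)]
    rw [← integral_finsetSum _ fun e _ => (hi e).integral_prod_left]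
    calc _ ≤ ∫ _w, 2 ^ d * (5 / 8 * (n * r ^ 2)) ∂π.μW :=
          integral_mono (integrable_finsetSum _ fun e _ => (hi e).integral_prod_left)
            (integrable_const _) fun w => π.sum_integral_reward_le w hd hn hr hrn
      _ = _ := by simp
  by_contra! h
  have hlt := Finset.sum_lt_sum_of_nonempty (Finset.univ_nonempty (α := Fin d → Bool))
    fun e _ => h e
  simp only [regret, Finset.sum_sub_distrib, Finset.sum_const, Finset.card_univ,
    Fintype.card_fun, Fintype.card_bool, Fintype.card_fin, nsmul_eq_mul] at hlt
  push_cast at hlt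
  linarith

end Policy

/-- **Minimax cumulative regret lower bound.**  There exist a universal constant `c > 0`
and a threshold `d₀` such that for every dimension `d ≥ d₀` there is an `n₀(d)` such that
for every horizon `n ≥ n₀(d)` there exists a radius `r ∈ [0,1]` such that for every
policy `π` there is a parameter `θ⋆` on the sphere of radius `r` with expected regret
`R_n(π, θ⋆) ≥ c · d · √n`. -/
theorem bandit_phase_retrieval_regret_lower_bound :
    ∃ c : ℝ, 0 < c ∧ ∃ d₀ : ℕ, ∀ d : ℕ, d₀ ≤ d → ∃ n₀ : ℕ, ∀ n : ℕ, n₀ ≤ n →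
      ∃ r ∈ Set.Icc (0 : ℝ) 1,
        ∀ (W : Type) (_ : MeasurableSpace W) (π : Policy d n W),
          ∃ θstar : EuclideanSpace ℝ (Fin d), ‖θstar‖ = r ∧
            c * d * Real.sqrt n ≤ π.regret θstar r := by
  refine ⟨1 / 16, by norm_num, 4, fun d hd => ⟨d ^ 2, fun n hn => ?_⟩⟩
  have hd0 : (0 : ℝ) < d := by exact_mod_cast (show 0 < d by omega)
  have hn0 : 0 < n := lt_of_lt_of_le (by positivity) hn
  have hn0' : (0 : ℝ) < n := by exact_mod_cast hn0
  have hs : √(n : ℝ) ^ 2 = n := Real.sq_sqrt hn0'.le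
  have hs0 : 0 < √(n : ℝ) := Real.sqrt_pos.2 hn0'
  have hds : (d : ℝ) ≤ √n := Real.le_sqrt_of_sq_le (by exact_mod_cast hn)
  have hr2 : √((d : ℝ) / (6 * √n)) ^ 2 = d / (6 * √n) := Real.sq_sqrt (by positivity)
  have hr0 : 0 < √((d : ℝ) / (6 * √n)) := Real.sqrt_pos.2 (by positivity)
  refine ⟨√(d / (6 * √n)), ⟨hr0.le, ?_⟩, fun W _ π => ?_⟩
  · refine Real.sqrt_le_one.2 ((div_le_one (by positivity)).2 ?_)
    linarith
  · obtain ⟨e, he⟩ := π.exists_signVector_regret_ge hd hn0 hr0 (by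
      rw [hr2, div_pow, mul_pow, hs]
      field_simp
      norm_num)
    refine ⟨_, norm_signVector (by omega) hr0.le e, le_trans (le_of_eq ?_) he⟩
    rw [hr2]
    nth_rewrite 2 [← hs]
    field_simp
    norm_num
end

section
/- There is a universal constant C > 0 such that for every dimension d ≥ 2, horizon n ≥ 2 and radius r ∈ [0,1], there exist a policy π and a prediction Â⋆ ∈ B^d_1 that is a measurable function of the full interaction history (W, A_1, X_1, …, A_n, X_n) such that for every parameter θ⋆ ∈ S^{d-1}_r the simple regret satisfies r² − E[⟨Â⋆, θ⋆⟩²] ≤ C · d · √(log(n) · log(d) / n). -/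
open MeasureTheory ProbabilityTheory
open scoped RealInnerProductSpace

theorem lintegral_min_one_div_sq_gaussianReal_le {Q : ℝ} (hQ : 0 ≤ Q) :
    ∫⁻ z, min 1 (ENNReal.ofReal Q / ENNReal.ofReal (z ^ 2)) ∂(gaussianReal 0 1)
      ≤ ENNReal.ofReal (3 * √Q) := by
  rcases hQ.eq_or_lt with rfl | hQ
  · simp
  have hs : 0 < √Q := Real.sqrt_pos.2 hQ
  have hpt : ∀ z : ℝ, gaussianPDF 0 1 z * min 1 (ENNReal.ofReal Q / ENNReal.ofReal (z ^ 2)) ≤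
      ENNReal.ofReal ((√(2 * Real.pi))⁻¹ * (2 * (1 + (z / √Q) ^ 2)⁻¹)) := by
    intro z
    rw [ENNReal.ofReal_mul (by positivity)]
    have hsq : (z / √Q) ^ 2 = z ^ 2 / Q := by rw [div_pow, Real.sq_sqrt hQ.le]
    gcongr
    · rw [gaussianPDF]
      apply ENNReal.ofReal_le_ofReal
      rw [gaussianPDFReal]
      simp only [NNReal.coe_one, mul_one, sub_zero]
      apply mul_le_of_le_one_right (by positivity)
      rw [Real.exp_le_one_iff]
      have := sq_nonneg z
      linarith
    · rw [hsq]
      rcases le_or_gt (z ^ 2) Q with h | h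
      · apply (min_le_left _ _).trans
        rw [← ENNReal.ofReal_one]
        apply ENNReal.ofReal_le_ofReal
        rw [← div_eq_mul_inv, le_div_iff₀ (by positivity)]
        have : z ^ 2 / Q ≤ 1 := (div_le_one hQ).2 h
        linarith
      · apply (min_le_right _ _).trans
        have hz : 0 < z ^ 2 := hQ.trans h
        rw [← ENNReal.ofReal_div_of_pos hz]
        apply ENNReal.ofReal_le_ofReal
        rw [← div_eq_mul_inv, div_le_div_iff₀ hz (by positivity)]
        have : Q * (1 + z ^ 2 / Q) = Q + z ^ 2 := by field_simp
        linarith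
  have h_int : Integrable fun z : ℝ => (√(2 * Real.pi))⁻¹ * (2 * (1 + (z / √Q) ^ 2)⁻¹) :=
    ((integrable_inv_one_add_sq.comp_div hs.ne').const_mul 2).const_mul _
  rw [gaussianReal_of_var_ne_zero _ one_ne_zero,
    lintegral_withDensity_eq_lintegral_mul₀ (measurable_gaussianPDF 0 1).aemeasurable
      (by fun_prop)]
  refine (lintegral_mono hpt).trans ?_
  rw [← ofReal_integral_eq_lintegral_ofReal h_int (ae_of_all _ fun z => by positivity)]
  apply ENNReal.ofReal_le_ofReal
  rw [integral_const_mul, integral_const_mul,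
    Measure.integral_comp_div (fun z : ℝ => (1 + z ^ 2)⁻¹), integral_univ_inv_one_add_sq,
    abs_of_pos hs, smul_eq_mul]
  have hp : √(2 * Real.pi) ^ 2 = 2 * Real.pi := Real.sq_sqrt (by positivity)
  have hp0 : 0 < √(2 * Real.pi) := by positivity
  have h3 : √(2 * Real.pi) ≤ 3 := by
    rw [Real.sqrt_le_left (by norm_num)]
    have := Real.pi_lt_d2
    linarith
  have : (√(2 * Real.pi))⁻¹ * (2 * (√Q * Real.pi)) = √(2 * Real.pi) * √Q := by
    field_simp
    linarith
  rw [this]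
  gcongr

/-- A uniformly random direction is unlikely to be nearly orthogonal to a fixed one. -/
theorem lintegral_min_one_norm_sq_div_inner_sq_stdGaussian_le {d : ℕ} (hd : 0 < d)
    (u : EuclideanSpace ℝ (Fin d)) (hu : ‖u‖ = 1) {q : ℝ} (hq : 0 < q) :
    ∫⁻ w, min 1 (ENNReal.ofReal (q * ‖w‖ ^ 2) / ENNReal.ofReal (⟪w, u⟫ ^ 2))
        ∂(stdGaussian (EuclideanSpace ℝ (Fin d)))
      ≤ ENNReal.ofReal (q + 3 * √(q * d)) := by
  obtain ⟨m, rfl⟩ : ∃ m, d = m + 1 := ⟨d - 1, by omega⟩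
  obtain ⟨b, hb⟩ := Orthonormal.exists_orthonormalBasis_extension_of_card_eq
    (𝕜 := ℝ) (E := EuclideanSpace ℝ (Fin (m + 1))) (ι := Fin (m + 1)) (by simp)
    (v := fun _ => u) (s := {0}) (by
      rw [orthonormal_iff_ite]
      rintro ⟨i, hi⟩ ⟨j, hj⟩
      simp only [Set.mem_singleton_iff] at hi hj
      subst hi hj
      simp [hu])
  have hb0 : b 0 = u := hb 0 (by simp)
  have hnorm : ∀ x : Fin (m + 1) → ℝ, ‖∑ i, x i • b i‖ ^ 2 = ∑ i, x i ^ 2 := by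
    intro x
    rw [← b.sum_sq_norm_inner_right]
    refine Finset.sum_congr rfl fun i _ => ?_
    rw [b.orthonormal.inner_right_fintype]
    simp
  have hin : ∀ x : Fin (m + 1) → ℝ, ⟪∑ i, x i • b i, u⟫ = x 0 := by
    intro x
    rw [← hb0, b.orthonormal.inner_left_fintype]
    simp
  rw [stdGaussian_eq_map_pi_orthonormalBasis b, lintegral_map (by fun_prop) (by fun_prop)]
  simp_rw [hnorm, hin]
  have hmp := (measurePreserving_piFinSuccAbove (fun _ : Fin (m + 1) => gaussianReal 0 1) 0).symm
  rw [← hmp.lintegral_comp_emb (MeasurableEquiv.measurableEmbedding _)]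
  simp only [MeasurableEquiv.piFinSuccAbove_symm_apply, Fin.insertNthEquiv_zero,
    Fin.consEquiv_apply, Fin.sum_univ_succ, Fin.cons_zero, Fin.cons_succ]
  rw [lintegral_prod_symm _ (by fun_prop)]
  set lam := √(q * (m + 1 : ℕ)) with hlam
  have hlam0 : 0 < lam := Real.sqrt_pos.2 (by positivity)
  have hlam2 : lam ^ 2 = q * (m + 1 : ℕ) := Real.sq_sqrt (by positivity)
  have hinner : ∀ y : Fin m → ℝ,
      ∫⁻ x : ℝ, min 1 (ENNReal.ofReal (q * (x ^ 2 + ∑ i, y i ^ 2)) / ENNReal.ofReal (x ^ 2))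
        ∂(gaussianReal 0 1)
      ≤ ENNReal.ofReal (q + 3 / 2 * (lam + q * (∑ i, y i ^ 2) / lam)) := by
    intro y
    set S := ∑ i, y i ^ 2 with hS
    have hS0 : 0 ≤ S := Finset.sum_nonneg fun i _ => sq_nonneg _
    have h1 : ∀ x : ℝ, min 1 (ENNReal.ofReal (q * (x ^ 2 + S)) / ENNReal.ofReal (x ^ 2)) ≤
        ENNReal.ofReal q + min 1 (ENNReal.ofReal (q * S) / ENNReal.ofReal (x ^ 2)) := by
      intro x
      rw [mul_add, ENNReal.ofReal_add (by positivity) (by positivity), ENNReal.add_div,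
        ENNReal.ofReal_mul hq.le, mul_div_assoc]
      rcases le_total (1 : ENNReal) (ENNReal.ofReal (q * S) / ENNReal.ofReal (x ^ 2)) with h | h
      · rw [min_eq_left h]
        exact (min_le_left _ _).trans le_add_self
      · rw [min_eq_right h]
        refine (min_le_right _ _).trans ?_
        gcongr
        exact mul_le_of_le_one_right' ENNReal.div_self_le_one
    refine (lintegral_mono h1).trans ?_
    rw [lintegral_add_left measurable_const, lintegral_const, measure_univ, mul_one,
      ENNReal.ofReal_add hq.le (by positivity)]
    gcongr
    refine (lintegral_min_one_div_sq_gaussianReal_le (by positivity)).trans ?_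
    apply ENNReal.ofReal_le_ofReal
    have h2 : √(q * S) ^ 2 = q * S := Real.sq_sqrt (by positivity)
    have : lam + √(q * S) ^ 2 / lam - 2 * √(q * S) = (lam - √(q * S)) ^ 2 / lam := by
      field_simp
      ring
    rw [h2] at this
    have h3 : 0 ≤ (lam - √(q * S)) ^ 2 / lam := by positivity
    linarith
  refine (lintegral_mono hinner).trans ?_
  have hsq : Integrable (fun x : ℝ => x ^ 2) (gaussianReal 0 1) :=
    (memLp_id_gaussianReal 2).integrable_sq
  have hsq1 : ∫ x : ℝ, x ^ 2 ∂(gaussianReal 0 1) = 1 := by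
    have := variance_id_gaussianReal (μ := 0) (v := 1)
    rw [variance_eq_sub (memLp_id_gaussianReal 2)] at this
    simpa using this
  have hev : ∀ i : Fin m, Integrable (fun y : Fin m → ℝ => y i ^ 2)
      (Measure.pi fun _ => gaussianReal 0 1) := fun i =>
    integrable_comp_eval (μ := fun _ : Fin m => gaussianReal 0 1) (i := i) hsq
  have hev1 : ∀ i : Fin m, ∫ y : Fin m → ℝ, y i ^ 2 ∂(Measure.pi fun _ => gaussianReal 0 1) = 1 :=
    fun i => (integral_comp_eval (μ := fun _ : Fin m => gaussianReal 0 1) (i := i)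
      hsq.aestronglyMeasurable).trans hsq1
  have hsum : Integrable (fun y : Fin m → ℝ => ∑ i, y i ^ 2)
      (Measure.pi fun _ => gaussianReal 0 1) := integrable_finsetSum _ fun i _ => hev i
  have hterm : Integrable (fun y : Fin m → ℝ => 3 / 2 * (lam + q * (∑ i, y i ^ 2) / lam))
      (Measure.pi fun _ => gaussianReal 0 1) :=
    ((integrable_const _).add ((hsum.const_mul q).div_const lam)).const_mul _
  have : ∀ y : Fin m → ℝ, 0 ≤ ∑ i, y i ^ 2 := fun y => Finset.sum_nonneg fun i _ => sq_nonneg _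
  have htot : Integrable (fun y : Fin m → ℝ => q + 3 / 2 * (lam + q * (∑ i, y i ^ 2) / lam))
      (Measure.pi fun _ => gaussianReal 0 1) := (integrable_const _).add hterm
  rw [← ofReal_integral_eq_lintegral_ofReal htot
    (ae_of_all _ fun y => by have := this y; simp only [Pi.zero_apply]; positivity)]
  apply ENNReal.ofReal_le_ofReal
  rw [integral_add (integrable_const _) hterm, integral_const_mul,
    integral_add (integrable_const _) ((hsum.const_mul q).div_const lam), integral_div,
    integral_const_mul, integral_finsetSum _ fun i _ => hev i]
  simp only [hev1, integral_const, probReal_univ, Finset.sum_const, Finset.card_univ,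
    Fintype.card_fin, smul_eq_mul, mul_one, nsmul_eq_mul]
  have h5 : q * m / lam ≤ lam := by
    rw [div_le_iff₀ hlam0, ← sq, hlam2]
    gcongr
    simp
  linarith

/-- A truncated bound by a ratio of independent variables may be averaged over the numerator
inside the truncation. -/
theorem lintegral_le_lintegral_min_one_of_indep {Ω : Type*} {m₁ m₂ mΩ : MeasurableSpace Ω}
    {P : Measure Ω} (hm₁ : m₁ ≤ mΩ) (hm₂ : m₂ ≤ mΩ)
    (hind : Indep m₁ m₂ P) {D Z V : Ω → ENNReal} {a b : ENNReal}
    (hD : Measurable[m₁] D) (hZ : Measurable[m₂] Z)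
    (hV1 : ∀ ω, V ω ≤ 1) (hV : ∀ ω, D ω ≠ 0 → V ω ≤ a + Z ω / D ω)
    (hb : ∫⁻ ω, Z ω ∂P ≤ b) (hb0 : b ≠ 0) :
    ∫⁻ ω, V ω ∂P ≤ ∫⁻ ω, min 1 (a + b / D ω) ∂P := by
  classical
  set S : Set Ω := {ω | 1 ≤ a + b / D ω} with hS
  have hSm : MeasurableSet[m₁] S :=
    measurableSet_le measurable_const (measurable_const.add (measurable_const.div hD))
  have hF : Measurable[m₁] (Sᶜ.indicator fun ω => (D ω)⁻¹) :=
    hD.inv.indicator hSm.compl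
  have hA : Measurable (S.indicator (fun _ => (1 : ENNReal)) + Sᶜ.indicator fun _ => a) :=
    (measurable_const.indicator (hm₁ _ hSm)).add (measurable_const.indicator (hm₁ _ hSm).compl)
  calc ∫⁻ ω, V ω ∂P
      ≤ ∫⁻ ω, (S.indicator (fun _ => (1 : ENNReal)) + Sᶜ.indicator fun _ => a) ω
          + Sᶜ.indicator (fun ω => (D ω)⁻¹) ω * Z ω ∂P := by
        refine lintegral_mono fun ω => ?_
        by_cases h : ω ∈ S
        · simpa [h] using hV1 ω
        · have hDω : D ω ≠ 0 := fun h0 => h (by simp [hS, h0, ENNReal.div_zero hb0])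
          simpa [h, ENNReal.div_eq_inv_mul] using hV ω hDω
    _ = ∫⁻ ω, (S.indicator (fun _ => (1 : ENNReal)) + Sᶜ.indicator fun _ => a) ω ∂P
          + (∫⁻ ω, Sᶜ.indicator (fun ω => (D ω)⁻¹) ω ∂P) * ∫⁻ ω, Z ω ∂P := by
        rw [lintegral_add_left hA,
          lintegral_mul_eq_lintegral_mul_lintegral_of_independent_measurableSpace hm₁ hm₂ hind hF hZ]
    _ ≤ ∫⁻ ω, (S.indicator (fun _ => (1 : ENNReal)) + Sᶜ.indicator fun _ => a) ω ∂P
          + (∫⁻ ω, Sᶜ.indicator (fun ω => (D ω)⁻¹) ω ∂P) * b := by gcongr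
    _ = ∫⁻ ω, (S.indicator (fun _ => (1 : ENNReal)) + Sᶜ.indicator fun _ => a) ω
          + Sᶜ.indicator (fun ω => (D ω)⁻¹) ω * b ∂P := by
        rw [lintegral_add_left hA, lintegral_mul_const _ (hF.mono hm₁ le_rfl)]
    _ ≤ ∫⁻ ω, min 1 (a + b / D ω) ∂P := by
        refine lintegral_mono fun ω => ?_
        by_cases h : ω ∈ S
        · have : 1 ≤ a + b / D ω := h
          simp [h, this]
        · have : a + b / D ω ≤ 1 := (not_le.1 h).le
          rw [min_eq_right this]
          simp [h, ENNReal.div_eq_inv_mul]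

section Normalize

variable {E : Type*} [NormedAddCommGroup E] [InnerProductSpace ℝ E]

theorem norm_normalize_le_one (y : E) : ‖‖y‖⁻¹ • y‖ ≤ 1 := by
  rw [norm_smul, norm_inv, norm_norm]
  exact inv_mul_le_one

theorem inner_sq_le_of_norm_le_one {x : E} (hx : ‖x‖ ≤ 1) (θ : E) : ⟪x, θ⟫ ^ 2 ≤ ‖θ‖ ^ 2 := by
  rw [← sq_abs]
  gcongr
  exact (abs_real_inner_le_norm _ _).trans (mul_le_of_le_one_left (norm_nonneg _) hx)

theorem norm_sq_sub_inner_normalize_sq_mul_le (c : ℝ) (θ ξ : E) :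
    (‖θ‖ ^ 2 - ⟪‖c • θ + ξ‖⁻¹ • (c • θ + ξ), θ⟫ ^ 2) * c ^ 2 ≤ ‖ξ‖ ^ 2 := by
  obtain ⟨y, hy⟩ : ∃ y, y = c • θ + ξ := ⟨_, rfl⟩
  rw [← hy]
  obtain ⟨x, hx⟩ : ∃ x, x = ‖y‖⁻¹ • y := ⟨_, rfl⟩
  rw [← hx]
  have hyx : y = ‖y‖ • x := by
    rcases eq_or_ne y 0 with h | h
    · simp [h]
    · rw [hx, smul_smul, mul_inv_cancel₀ (norm_ne_zero_iff.2 h), one_smul]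
  have hξ : ξ = ‖y‖ • x - c • θ := by rw [← hyx, hy]; abel
  have hx1 : ‖y‖ ^ 2 * ‖x‖ ^ 2 = ‖y‖ ^ 2 := by
    have := congrArg norm hyx
    rw [norm_smul, norm_norm] at this
    rw [← mul_pow, ← this]
  rw [hξ, norm_sub_sq_real, norm_smul, norm_smul, inner_smul_left, inner_smul_right, mul_pow,
    mul_pow, norm_norm, hx1, Real.norm_eq_abs, sq_abs]
  simp only [conj_trivial]
  nlinarith [sq_nonneg (‖y‖ - c * ⟪x, θ⟫)]

theorem ofReal_one_sub_inner_normalize_sq_div_le {c : ℝ} (hc : c ≠ 0) {θ : E} (hθ : θ ≠ 0)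
    (ξ : E) :
    ENNReal.ofReal (1 - ⟪‖c • θ + ξ‖⁻¹ • (c • θ + ξ), θ⟫ ^ 2 / ‖θ‖ ^ 2) ≤
      ENNReal.ofReal (‖ξ‖ ^ 2) / ENNReal.ofReal (c ^ 2 * ‖θ‖ ^ 2) := by
  have hr : 0 < ‖θ‖ := norm_pos_iff.2 hθ
  have key := norm_sq_sub_inner_normalize_sq_mul_le c θ ξ
  have hc2 : 0 < c ^ 2 * ‖θ‖ ^ 2 := by positivity
  rw [← ENNReal.ofReal_div_of_pos hc2]
  apply ENNReal.ofReal_le_ofReal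
  rw [le_div_iff₀ hc2]
  refine le_of_eq_of_le ?_ key
  field_simp

/-- One step of the noisy power iteration: the inverse squared correlation with `θ` of the
normalized iterate `c • θ + ξ` is controlled by the size of the noise `ξ` relative to the
signal. -/
theorem min_one_div_inner_normalize_sq_le {c : ℝ} (hc : c ≠ 0) {θ : E} (hθ : θ ≠ 0)
    (ξ : E) {α β : ℝ} (hα : 0 ≤ α) (hβ : 0 < β) :
    min 1 (ENNReal.ofReal α + ENNReal.ofReal (β * ‖θ‖ ^ 2) /
        ENNReal.ofReal (⟪‖c • θ + ξ‖⁻¹ • (c • θ + ξ), θ⟫ ^ 2)) ≤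
      ENNReal.ofReal (α + 8 * β) + ENNReal.ofReal (8 * β * ‖ξ‖ ^ 2 + 4 * (⟪ξ, θ⟫ ^ 2 / ‖θ‖ ^ 2)) /
        ENNReal.ofReal (c ^ 2 * ‖θ‖ ^ 2) := by
  have hr : 0 < ‖θ‖ := norm_pos_iff.2 hθ
  have hc2 : 0 < c ^ 2 * ‖θ‖ ^ 2 := by positivity
  rw [← ENNReal.ofReal_div_of_pos hc2]
  set T := c * ‖θ‖ ^ 2 with hT
  have hT2 : 0 < T ^ 2 := by positivity
  rcases le_or_gt (T ^ 2) (4 * ⟪ξ, θ⟫ ^ 2) with h | h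
  · refine (min_le_left _ _).trans (le_trans ?_ le_add_self)
    rw [← ENNReal.ofReal_one]
    apply ENNReal.ofReal_le_ofReal
    rw [le_div_iff₀ hc2, one_mul]
    have h1 : c ^ 2 * ‖θ‖ ^ 2 ≤ 4 * (⟪ξ, θ⟫ ^ 2 / ‖θ‖ ^ 2) := by
      rw [← mul_div_assoc, le_div_iff₀ (by positivity)]
      refine le_trans (le_of_eq ?_) h
      rw [hT]; ring
    have : 0 ≤ 8 * β * ‖ξ‖ ^ 2 := by positivity
    linarith
  · obtain ⟨y, hy⟩ : ∃ y, y = c • θ + ξ := ⟨_, rfl⟩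
    rw [← hy]
    have hin : ⟪y, θ⟫ = T + ⟪ξ, θ⟫ := by
      rw [hy, inner_add_left, inner_smul_left, real_inner_self_eq_norm_sq]; simp [hT]
    have hin2 : T ^ 2 ≤ 4 * ⟪y, θ⟫ ^ 2 := by
      rw [hin]
      have h2 : |2 * ⟪ξ, θ⟫| < |T| := by
        rw [← sq_lt_sq]; linarith
      have h3 : |T| ≤ |2 * (T + ⟪ξ, θ⟫)| := by
        have : 2 * (T + ⟪ξ, θ⟫) = T + (T + 2 * ⟪ξ, θ⟫) := by ring
        rcases abs_cases T with hh | hh <;> rcases abs_cases (2 * ⟪ξ, θ⟫) with h' | h' <;>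
          rcases abs_cases (2 * (T + ⟪ξ, θ⟫)) with h'' | h'' <;> linarith
      have := sq_le_sq.2 h3
      linarith
    have hyn : ‖y‖ ^ 2 ≤ 2 * (c ^ 2 * ‖θ‖ ^ 2) + 2 * ‖ξ‖ ^ 2 := by
      have h1 := parallelogram_law_with_norm ℝ (c • θ) ξ
      have h2 : ‖c • θ‖ ^ 2 = c ^ 2 * ‖θ‖ ^ 2 := by
        rw [norm_smul, mul_pow, Real.norm_eq_abs, sq_abs]
      rw [← h2, hy]
      nlinarith [mul_self_nonneg ‖c • θ - ξ‖]
    have hiy : 0 < ⟪y, θ⟫ ^ 2 := by linarith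
    have hy0 : 0 < ‖y‖ := norm_pos_iff.2 fun h0 => by simp [h0] at hiy
    have hx2 : ⟪‖y‖⁻¹ • y, θ⟫ ^ 2 = ⟪y, θ⟫ ^ 2 / ‖y‖ ^ 2 := by
      rw [inner_smul_left]; simp [mul_pow]; field_simp
    refine (min_le_right _ _).trans ?_
    rw [hx2, ← ENNReal.ofReal_div_of_pos (by positivity), ← ENNReal.ofReal_add hα (by positivity),
      ← ENNReal.ofReal_add (by positivity) (by positivity)]
    apply ENNReal.ofReal_le_ofReal
    have e1 : β * ‖θ‖ ^ 2 / (⟪y, θ⟫ ^ 2 / ‖y‖ ^ 2) = β * (‖θ‖ ^ 2 * ‖y‖ ^ 2 / ⟪y, θ⟫ ^ 2) := by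
      field_simp
    have e2 : ‖θ‖ ^ 2 * ‖y‖ ^ 2 / ⟪y, θ⟫ ^ 2 ≤ 8 + 8 * (‖ξ‖ ^ 2 / (c ^ 2 * ‖θ‖ ^ 2)) := by
      rw [div_le_iff₀ hiy]
      have : (8 + 8 * (‖ξ‖ ^ 2 / (c ^ 2 * ‖θ‖ ^ 2))) * ⟪y, θ⟫ ^ 2 ≥
          (8 + 8 * (‖ξ‖ ^ 2 / (c ^ 2 * ‖θ‖ ^ 2))) * (T ^ 2 / 4) := by
        gcongr; linarith
      refine le_trans ?_ this
      have e3 : (8 + 8 * (‖ξ‖ ^ 2 / (c ^ 2 * ‖θ‖ ^ 2))) * (T ^ 2 / 4) =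
          ‖θ‖ ^ 2 * (2 * (c ^ 2 * ‖θ‖ ^ 2) + 2 * ‖ξ‖ ^ 2) := by
        rw [hT]; field_simp; ring
      rw [e3]
      gcongr
    have e4 : 0 ≤ 4 * (⟪ξ, θ⟫ ^ 2 / ‖θ‖ ^ 2) / (c ^ 2 * ‖θ‖ ^ 2) := by positivity
    rw [e1, add_div]
    have e5 : β * (‖θ‖ ^ 2 * ‖y‖ ^ 2 / ⟪y, θ⟫ ^ 2) ≤
        β * (8 + 8 * (‖ξ‖ ^ 2 / (c ^ 2 * ‖θ‖ ^ 2))) := by gcongr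
    have e6 : β * (8 + 8 * (‖ξ‖ ^ 2 / (c ^ 2 * ‖θ‖ ^ 2))) =
      8 * β + 8 * β * ‖ξ‖ ^ 2 / (c ^ 2 * ‖θ‖ ^ 2) := by ring
    linarith

end Normalize

/-- Extension of a finite sequence by zero. -/
def zeroExtend {n : ℕ} (h : Fin n → ℝ) (t : ℕ) : ℝ := if ht : t < n then h ⟨t, ht⟩ else 0

theorem measurable_zeroExtend {n : ℕ} (t : ℕ) :
    Measurable fun h : Fin n → ℝ => zeroExtend h t := by
  unfold zeroExtend
  split_ifs <;> fun_prop

theorem integrable_mul_zeroExtend {n : ℕ} (s t : ℕ) :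
    Integrable (fun η : Fin n → ℝ => zeroExtend η s * zeroExtend η t)
      (Measure.pi fun _ => gaussianReal 0 1) := by
  have h : ∀ t, MemLp (fun η : Fin n → ℝ => zeroExtend η t) 2
      (Measure.pi fun _ => gaussianReal 0 1) := by
    intro t
    unfold zeroExtend
    split_ifs with ht
    · exact (memLp_id_gaussianReal 2).comp_measurePreserving
        (measurePreserving_eval (fun _ : Fin n => gaussianReal 0 1) ⟨t, ht⟩)
    · simp
  exact (h s).integrable_mul (h t)

theorem integral_mul_zeroExtend {n : ℕ} {s t : ℕ} (hs : s < n) (ht : t < n) :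
    ∫ η : Fin n → ℝ, zeroExtend η s * zeroExtend η t ∂(Measure.pi fun _ => gaussianReal 0 1)
      = if s = t then 1 else 0 := by
  simp only [zeroExtend, hs, ht, dif_pos]
  split_ifs with h
  · subst h
    have := integral_comp_eval (μ := fun _ : Fin n => gaussianReal 0 1) (i := ⟨s, hs⟩)
      (f := fun x : ℝ => x * x) (by fun_prop)
    rw [this]
    have := variance_id_gaussianReal (μ := 0) (v := 1)
    rw [variance_eq_sub (memLp_id_gaussianReal 2)] at this
    simpa [sq] using this
  · have hind := (iIndepFun_pi (μ := fun _ : Fin n => gaussianReal 0 1) (X := fun _ => id)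
      (fun _ => aemeasurable_id)).indepFun (i := ⟨s, hs⟩) (j := ⟨t, ht⟩) (by simpa using h)
    have := hind.integral_fun_mul_eq_mul_integral
      (measurable_pi_apply (X := fun _ : Fin n => ℝ) _).aestronglyMeasurable
      (measurable_pi_apply (X := fun _ : Fin n => ℝ) _).aestronglyMeasurable
    simp only [id] at this
    rw [this, integral_comp_eval (μ := fun _ : Fin n => gaussianReal 0 1) (i := ⟨s, hs⟩)
      (f := fun x : ℝ => x) (by fun_prop)]
    simp

theorem integral_sum_mul_zeroExtend_sq {n : ℕ} {ι : Type*} (F : Finset ι) (a : ι → ℝ) (τ : ι → ℕ)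
    (hτ : ∀ p ∈ F, τ p < n) (hinj : Set.InjOn τ F) :
    Integrable (fun η : Fin n → ℝ => (∑ p ∈ F, a p * zeroExtend η (τ p)) ^ 2)
      (Measure.pi fun _ => gaussianReal 0 1) ∧
    ∫ η : Fin n → ℝ, (∑ p ∈ F, a p * zeroExtend η (τ p)) ^ 2
      ∂(Measure.pi fun _ => gaussianReal 0 1) = ∑ p ∈ F, a p ^ 2 := by
  classical
  have hexp : ∀ η : Fin n → ℝ, (∑ p ∈ F, a p * zeroExtend η (τ p)) ^ 2 =
      ∑ p ∈ F, ∑ q ∈ F, (a p * a q) * (zeroExtend η (τ p) * zeroExtend η (τ q)) := by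
    intro η
    rw [sq, Finset.sum_mul_sum]
    refine Finset.sum_congr rfl fun p _ => Finset.sum_congr rfl fun q _ => by ring
  have hi : ∀ p q, Integrable (fun η : Fin n → ℝ =>
      (a p * a q) * (zeroExtend η (τ p) * zeroExtend η (τ q)))
      (Measure.pi fun _ => gaussianReal 0 1) :=
    fun p q => (integrable_mul_zeroExtend _ _).const_mul _
  simp_rw [hexp]
  refine ⟨integrable_finsetSum _ fun p _ => integrable_finsetSum _ fun q _ => hi p q, ?_⟩
  rw [integral_finsetSum _ fun p _ => integrable_finsetSum _ fun q _ => hi p q]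
  refine Finset.sum_congr rfl fun p hp => ?_
  rw [integral_finsetSum _ fun q _ => hi p q]
  have : ∀ q ∈ F, ∫ η : Fin n → ℝ, (a p * a q) * (zeroExtend η (τ p) * zeroExtend η (τ q))
      ∂(Measure.pi fun _ => gaussianReal 0 1) = if p = q then a p * a q else 0 := by
    intro q hq
    rw [integral_const_mul, integral_mul_zeroExtend (hτ p hp) (hτ q hq)]
    simp [hinj.eq_iff hp hq]
  rw [Finset.sum_congr rfl this, Finset.sum_ite_eq, if_pos hp, sq]

/-- The time at which the algorithm plays, in round `j`, for the `l`-th time, the action probing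
coordinate `i` with sign `(-1) ^ s`. -/
def slot (d k j i l s : ℕ) : ℕ := ((j * d + i) * k + l) * 2 + s

theorem slot_div_two_div {d k j i l s : ℕ} (hl : l < k) (hs : s < 2) :
    slot d k j i l s / 2 / k = j * d + i := by
  have h1 : slot d k j i l s / 2 = (j * d + i) * k + l := by unfold slot; omega
  rw [h1, mul_comm, Nat.mul_add_div (by omega), Nat.div_eq_of_lt hl, add_zero]

theorem slot_lt {d k j i l s : ℕ} (hi : i < d) (hl : l < k) (hs : s < 2) :
    slot d k j i l s < 2 * d * k * (j + 1) := by
  have h1 : (j * d + i) * k + l < (j * d + i + 1) * k := by rw [add_mul _ 1]; omega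
  have h2 : (j * d + i + 1) * k ≤ ((j + 1) * d) * k := by gcongr; rw [add_mul]; omega
  have h3 : 2 * d * k * (j + 1) = ((j + 1) * d * k) * 2 := by ring
  unfold slot
  omega

theorem le_slot (d k j i l s : ℕ) : 2 * d * k * j ≤ slot d k j i l s := by
  have h1 : j * d * k ≤ (j * d + i) * k + l := by rw [add_mul]; omega
  have h3 : 2 * d * k * j = (j * d * k) * 2 := by ring
  unfold slot
  omega

/-- The estimator of round `j`, for a given reward sequence. -/
noncomputable def roundEstimate (d k j : ℕ) (X : ℕ → ℝ) : EuclideanSpace ℝ (Fin d) :=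
  WithLp.toLp 2 fun i => (k : ℝ)⁻¹ *
    ∑ l ∈ Finset.range k, (X (slot d k j i l 0) - X (slot d k j i l 1))

theorem roundEstimate_congr {d k j : ℕ} {X Y : ℕ → ℝ}
    (h : ∀ t < 2 * d * k * (j + 1), X t = Y t) : roundEstimate d k j X = roundEstimate d k j Y := by
  unfold roundEstimate
  congr 1
  funext i
  congr 1
  refine Finset.sum_congr rfl fun l hl => ?_
  rw [Finset.mem_range] at hl
  rw [h _ (slot_lt i.2 hl (by norm_num)), h _ (slot_lt i.2 hl (by norm_num))]

theorem measurable_roundEstimate {Ω : Type*} [MeasurableSpace Ω] {d k j : ℕ} {X : Ω → ℕ → ℝ}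
    (h : ∀ t, 2 * d * k * j ≤ t → t < 2 * d * k * (j + 1) → Measurable fun ω => X ω t) :
    Measurable fun ω => roundEstimate d k j (X ω) := by
  refine (WithLp.measurable_toLp 2 _).comp (measurable_pi_lambda _ fun i => ?_)
  refine (Finset.measurable_sum _ fun l hl => ?_).const_mul _
  rw [Finset.mem_range] at hl
  exact (h _ (le_slot _ _ _ _ _ _) (slot_lt i.2 hl (by norm_num))).sub
    (h _ (le_slot _ _ _ _ _ _) (slot_lt i.2 hl (by norm_num)))

theorem inner_roundEstimate {d k j : ℕ} (X : ℕ → ℝ) (v : EuclideanSpace ℝ (Fin d)) :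
    ⟪roundEstimate d k j X, v⟫ =
      ∑ p ∈ Finset.univ ×ˢ (Finset.range k ×ˢ Finset.range 2),
        (v p.1 * (k : ℝ)⁻¹ * (-1) ^ p.2.2) * X (slot d k j (p.1 : Fin d) p.2.1 p.2.2) := by
  simp only [Finset.sum_product, Finset.sum_range_succ, Finset.range_zero, Finset.sum_empty,
    PiLp.inner_apply, roundEstimate]
  refine Finset.sum_congr rfl fun i _ => ?_
  simp only [RCLike.inner_apply, conj_trivial, Finset.mul_sum]
  refine Finset.sum_congr rfl fun l _ => ?_
  simp
  ring

theorem integral_inner_roundEstimate_sq {d k j n : ℕ} (hk : 0 < k) (hn : 2 * d * k * (j + 1) ≤ n)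
    (v : EuclideanSpace ℝ (Fin d)) :
    Integrable (fun η : Fin n → ℝ => ⟪roundEstimate d k j (zeroExtend η), v⟫ ^ 2)
      (Measure.pi fun _ => gaussianReal 0 1) ∧
    ∫ η : Fin n → ℝ, ⟪roundEstimate d k j (zeroExtend η), v⟫ ^ 2
      ∂(Measure.pi fun _ => gaussianReal 0 1) = 2 / k * ‖v‖ ^ 2 := by
  simp_rw [inner_roundEstimate]
  have := integral_sum_mul_zeroExtend_sq (n := n)
    (Finset.univ ×ˢ (Finset.range k ×ˢ Finset.range 2))
    (fun p : Fin d × ℕ × ℕ => v p.1 * (k : ℝ)⁻¹ * (-1) ^ p.2.2)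
    (fun p => slot d k j (p.1 : Fin d) p.2.1 p.2.2) ?_ ?_
  · refine ⟨this.1, this.2.trans ?_⟩
    simp only [Finset.sum_product, Finset.sum_range_succ, Finset.range_zero, Finset.sum_empty]
    rw [EuclideanSpace.norm_sq_eq, Finset.mul_sum]
    refine Finset.sum_congr rfl fun i _ => ?_
    simp
    field_simp
    ring
  · rintro ⟨i, l, s⟩ hp
    simp only [Finset.mem_product, Finset.mem_univ, Finset.mem_range, true_and] at hp
    exact (slot_lt i.2 hp.1 hp.2).trans_le hn
  · rintro ⟨i, l, s⟩ hp ⟨i', l', s'⟩ hp' h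
    simp only [Finset.coe_product, Set.mem_prod, Finset.mem_coe, Finset.mem_univ,
      Finset.mem_range, true_and] at hp hp' h
    have h1 : j * d + (i : ℕ) = j * d + i' := by
      rw [← slot_div_two_div (d := d) (j := j) hp.1 hp.2, h, slot_div_two_div hp'.1 hp'.2]
    have h2 : (i : ℕ) = i' := by omega
    unfold slot at h
    rw [h2] at h
    have h3 : l = l' ∧ s = s' := by
      constructor <;> omega
    simp [Fin.ext h2, h3]

theorem integral_norm_roundEstimate_sq {d k j n : ℕ} (hk : 0 < k) (hn : 2 * d * k * (j + 1) ≤ n) :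
    Integrable (fun η : Fin n → ℝ => ‖roundEstimate d k j (zeroExtend η)‖ ^ 2)
      (Measure.pi fun _ => gaussianReal 0 1) ∧
    ∫ η : Fin n → ℝ, ‖roundEstimate d k j (zeroExtend η)‖ ^ 2
      ∂(Measure.pi fun _ => gaussianReal 0 1) = 2 * d / k := by
  have h := fun i : Fin d => integral_inner_roundEstimate_sq hk hn (EuclideanSpace.single i (1 : ℝ))
  have he : ∀ x : EuclideanSpace ℝ (Fin d),
      ‖x‖ ^ 2 = ∑ i, ⟪x, EuclideanSpace.single i (1 : ℝ)⟫ ^ 2 := by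
    intro x
    rw [EuclideanSpace.norm_sq_eq]
    simp [EuclideanSpace.inner_single_right]
  simp_rw [he]
  refine ⟨integrable_finsetSum _ fun i _ => (h i).1, ?_⟩
  rw [integral_finsetSum _ fun i _ => (h i).1]
  simp only [(h _).2]
  simp
  ring

/-- The normalized iterates of the noisy power iteration: the normalized seed, followed by the
normalized estimators of the successive rounds. -/
noncomputable def powerIterate (d k : ℕ) (w : EuclideanSpace ℝ (Fin d)) (X : ℕ → ℝ) :
    ℕ → EuclideanSpace ℝ (Fin d)
  | 0 => ‖w‖⁻¹ • w
  | j + 1 => ‖roundEstimate d k j X‖⁻¹ • roundEstimate d k j X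

theorem norm_powerIterate_le_one (d k : ℕ) (w : EuclideanSpace ℝ (Fin d)) (X : ℕ → ℝ) (j : ℕ) :
    ‖powerIterate d k w X j‖ ≤ 1 := by
  cases j <;> exact norm_normalize_le_one _

theorem powerIterate_congr {d k j : ℕ} (w : EuclideanSpace ℝ (Fin d)) {X Y : ℕ → ℝ}
    (h : ∀ t < 2 * d * k * j, X t = Y t) : powerIterate d k w X j = powerIterate d k w Y j := by
  cases j with
  | zero => rfl
  | succ j => simp only [powerIterate, roundEstimate_congr h]

theorem measurable_powerIterate {Ω : Type*} [MeasurableSpace Ω] {d k j : ℕ}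
    {w : Ω → EuclideanSpace ℝ (Fin d)} {X : Ω → ℕ → ℝ} (hw : Measurable w)
    (h : ∀ t < 2 * d * k * j, Measurable fun ω => X ω t) :
    Measurable fun ω => powerIterate d k (w ω) (X ω) j := by
  cases j with
  | zero => exact hw.norm.inv.smul hw
  | succ j =>
    have := measurable_roundEstimate (d := d) (k := k) (j := j) (X := X) fun t _ ht => h t ht
    exact this.norm.inv.smul this

/-- The policy running the noisy power iteration with `2 * d * k` samples per round, started at
a uniformly random direction. -/
noncomputable def powerPolicy (d k n : ℕ) [NeZero d] :
    Policy d n (EuclideanSpace ℝ (Fin d)) where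
  μW := stdGaussian _
  probW := inferInstance
  act t p := (2⁻¹ : ℝ) • (powerIterate d k p.1 (zeroExtend p.2) ((t : ℕ) / 2 / k / d) +
    (-1 : ℝ) ^ (t : ℕ) • EuclideanSpace.single (Fin.ofNat d ((t : ℕ) / 2 / k)) (1 : ℝ))
  act_meas t := by
    have h : Measurable fun p : EuclideanSpace ℝ (Fin d) × (Fin t → ℝ) =>
        powerIterate d k p.1 (zeroExtend p.2) ((t : ℕ) / 2 / k / d) :=
      measurable_powerIterate measurable_fst fun s _ =>
        (measurable_zeroExtend s).comp measurable_snd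
    exact (h.add_const _).const_smul (2⁻¹ : ℝ)
  act_mem t p := by
    rw [norm_smul]
    have h1 := norm_powerIterate_le_one d k p.1 (zeroExtend p.2) ((t : ℕ) / 2 / k / d)
    have h2 : ‖(-1 : ℝ) ^ (t : ℕ) • EuclideanSpace.single (Fin.ofNat d ((t : ℕ) / 2 / k)) (1 : ℝ)‖
        = 1 := by simp [norm_smul]
    have h3 := norm_add_le (powerIterate d k p.1 (zeroExtend p.2) ((t : ℕ) / 2 / k / d))
      ((-1 : ℝ) ^ (t : ℕ) • EuclideanSpace.single (Fin.ofNat d ((t : ℕ) / 2 / k)) (1 : ℝ))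
    rw [Real.norm_of_nonneg (by norm_num)]
    linarith

theorem Policy.X_of_lt_s2 {d n : ℕ} {W : Type} [MeasurableSpace W] {π : Policy d n W}
    {θ : EuclideanSpace ℝ (Fin d)} {t : ℕ} (h : t < n) {ω : W × (Fin n → ℝ)} :
    π.X θ t ω =
      ⟪π.act ⟨t, h⟩ (ω.1, fun s : Fin t => π.X θ s.val ω), θ⟫ ^ 2 + ω.2 ⟨t, h⟩ := by
  rw [Policy.X]
  exact dif_pos h

theorem Policy.X_of_not_lt {d n : ℕ} {W : Type} [MeasurableSpace W] {π : Policy d n W}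
    {θ : EuclideanSpace ℝ (Fin d)} {t : ℕ} (h : ¬ t < n) {ω : W × (Fin n → ℝ)} :
    π.X θ t ω = 0 := by
  rw [Policy.X]
  exact dif_neg h

theorem Policy.measurable_X_s2 {d n : ℕ} {W : Type} [MeasurableSpace W] (π : Policy d n W)
    (θ : EuclideanSpace ℝ (Fin d)) {Ω : Type*} [MeasurableSpace Ω] {w : Ω → W}
    (hw : Measurable w) {η : Ω → Fin n → ℝ} {N : ℕ}
    (hη : ∀ t : Fin n, (t : ℕ) < N → Measurable fun ω => η ω t) (t : ℕ) (ht : t < N) :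
    Measurable fun ω => π.X θ t (w ω, η ω) := by
  induction t using Nat.strong_induction_on with
  | _ t ih =>
    by_cases h : t < n
    · have : (fun ω => π.X θ t (w ω, η ω)) = fun ω =>
          ⟪π.act ⟨t, h⟩ (w ω, fun s : Fin t => π.X θ s.val (w ω, η ω)), θ⟫ ^ 2 + η ω ⟨t, h⟩ := by
        funext ω
        rw [Policy.X_of_lt_s2 h]
      rw [this]
      have h1 : Measurable fun ω => (w ω, fun s : Fin t => π.X θ s.val (w ω, η ω)) :=
        hw.prodMk (measurable_pi_lambda _ fun s => ih s s.2 (s.2.trans ht))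
      have h2 := (π.act_meas ⟨t, h⟩).comp h1
      exact ((h2.inner_const).pow_const 2).add (hη _ ht)
    · have : (fun ω => π.X θ t (w ω, η ω)) = fun ω => 0 := by
        funext ω
        exact Policy.X_of_not_lt h
      rw [this]
      exact measurable_const

section PowerPolicy

variable {d k n : ℕ} [NeZero d]

theorem powerPolicy_X_slot (θ w : EuclideanSpace ℝ (Fin d)) (η : Fin n → ℝ) {j l s : ℕ}
    (i : Fin d) (hl : l < k) (hs : s < 2) (hn : slot d k j i l s < n) :
    (powerPolicy d k n).X θ (slot d k j i l s) (w, η) =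
      (⟪powerIterate d k w (fun t => (powerPolicy d k n).X θ t (w, η)) j, θ⟫
        + (-1) ^ s * θ i) ^ 2 / 4 + zeroExtend η (slot d k j i l s) := by
  rw [Policy.X_of_lt_s2 hn]
  simp only [zeroExtend, hn, dif_pos, add_left_inj]
  have hd : 0 < d := Nat.pos_of_ne_zero (NeZero.ne d)
  have h1 := slot_div_two_div (d := d) (j := j) (i := i) hl hs
  have h2 : slot d k j i l s / 2 / k / d = j := by
    rw [h1, mul_comm, Nat.mul_add_div hd, Nat.div_eq_of_lt i.2, add_zero]
  have h3 : Fin.ofNat d (slot d k j i l s / 2 / k) = i := by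
    ext
    simp [h1, Nat.mod_eq_of_lt i.2]
  have h4 : (-1 : ℝ) ^ slot d k j i l s = (-1) ^ s := by
    rw [slot, pow_add, pow_mul']
    simp
  simp only [powerPolicy, h2, h3, h4]
  have h5 := powerIterate_congr (d := d) (k := k) (j := j) w
    (X := zeroExtend fun t : Fin (slot d k j i l s) => (powerPolicy d k n).X θ t (w, η))
    (Y := fun t => (powerPolicy d k n).X θ t (w, η)) (by
      intro t ht
      simp [zeroExtend, ht.trans_le (le_slot d k j i l s)])
  simp only [powerPolicy] at h5
  rw [h5, inner_smul_left, inner_add_left, inner_smul_left, EuclideanSpace.inner_single_left]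
  simp only [conj_trivial, map_inv₀, map_pow, map_neg, map_one, one_mul]
  norm_num
  ring

theorem roundEstimate_powerPolicy (hk : 0 < k) (θ w : EuclideanSpace ℝ (Fin d)) (η : Fin n → ℝ)
    {j : ℕ} (hn : 2 * d * k * (j + 1) ≤ n) :
    roundEstimate d k j (fun t => (powerPolicy d k n).X θ t (w, η)) =
      ⟪powerIterate d k w (fun t => (powerPolicy d k n).X θ t (w, η)) j, θ⟫ • θ +
        roundEstimate d k j (zeroExtend η) := by
  ext i
  have hk' : (k : ℝ) ≠ 0 := by positivity
  simp only [roundEstimate, PiLp.add_apply, PiLp.smul_apply, smul_eq_mul]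
  set c := ⟪powerIterate d k w (fun t => (powerPolicy d k n).X θ t (w, η)) j, θ⟫
  have h : ∀ l ∈ Finset.range k, (powerPolicy d k n).X θ (slot d k j i l 0) (w, η) -
      (powerPolicy d k n).X θ (slot d k j i l 1) (w, η) = c * θ i +
      (zeroExtend η (slot d k j i l 0) - zeroExtend η (slot d k j i l 1)) := by
    intro l hl
    rw [Finset.mem_range] at hl
    rw [powerPolicy_X_slot θ w η i hl (by norm_num)
        ((slot_lt i.2 hl (by norm_num)).trans_le hn),
      powerPolicy_X_slot θ w η i hl (by norm_num) ((slot_lt i.2 hl (by norm_num)).trans_le hn)]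
    ring
  rw [Finset.sum_congr rfl h, Finset.sum_add_distrib]
  simp
  field_simp

end PowerPolicy

section PowerIteration

variable {d k n : ℕ} [NeZero d]

/-- One round of the noisy power iteration, integrated over the noise. -/
theorem lintegral_powerIterate_succ_le (hk : 0 < k) {j : ℕ} (hn : 2 * d * k * (j + 1) ≤ n)
    (θ w : EuclideanSpace ℝ (Fin d)) {F Z : EuclideanSpace ℝ (Fin d) → ENNReal} {a b : ENNReal}
    (hZ : Measurable Z) (hF1 : ∀ x, F x ≤ 1)
    (hF : ∀ c : ℝ, c ≠ 0 → ∀ ξ, F (‖c • θ + ξ‖⁻¹ • (c • θ + ξ)) ≤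
      a + Z ξ / ENNReal.ofReal (c ^ 2 * ‖θ‖ ^ 2))
    (hb : ∫⁻ η : Fin n → ℝ, Z (roundEstimate d k j (zeroExtend η))
      ∂(Measure.pi fun _ => gaussianReal 0 1) ≤ b) (hb0 : b ≠ 0) :
    ∫⁻ η : Fin n → ℝ,
        F (powerIterate d k w (fun t => (powerPolicy d k n).X θ t (w, η)) (j + 1))
        ∂(Measure.pi fun _ => gaussianReal 0 1) ≤
      ∫⁻ η : Fin n → ℝ, min 1 (a + b / ENNReal.ofReal
        (⟪powerIterate d k w (fun t => (powerPolicy d k n).X θ t (w, η)) j, θ⟫ ^ 2 * ‖θ‖ ^ 2))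
        ∂(Measure.pi fun _ => gaussianReal 0 1) := by
  let m : Fin n → MeasurableSpace (Fin n → ℝ) := fun s =>
    MeasurableSpace.comap (fun η => η s) inferInstance
  let S : Set (Fin n) := {s | (s : ℕ) < 2 * d * k * j}
  have hm : ∀ s, m s ≤ MeasurableSpace.pi := fun s => (measurable_pi_apply s).comap_le
  have hms : ∀ s, Measurable[m s] fun η : Fin n → ℝ => η s := fun s => comap_measurable _
  have hind : Indep (⨆ s ∈ S, m s) (⨆ s ∈ Sᶜ, m s) (Measure.pi fun _ : Fin n => gaussianReal 0 1) :=
    indep_iSup_of_disjoint hm (iIndepFun_pi (μ := fun _ : Fin n => gaussianReal 0 1)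
      (X := fun _ => id) fun _ => aemeasurable_id) disjoint_compl_right
  have hD : Measurable[⨆ s ∈ S, m s] fun η : Fin n → ℝ => ENNReal.ofReal
      (⟪powerIterate d k w (fun t => (powerPolicy d k n).X θ t (w, η)) j, θ⟫ ^ 2 * ‖θ‖ ^ 2) := by
    let _ : MeasurableSpace (Fin n → ℝ) := ⨆ s ∈ S, m s
    have h1 : Measurable fun η : Fin n → ℝ =>
        powerIterate d k w (fun t => (powerPolicy d k n).X θ t (w, η)) j :=
      measurable_powerIterate measurable_const fun t ht =>
        Policy.measurable_X_s2 _ θ measurable_const (η := fun η => η)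
          (fun s hs => (hms s).mono (le_biSup m (show s ∈ S from hs)) le_rfl) t ht
    exact ((h1.inner_const.pow_const 2).mul_const _).ennreal_ofReal
  have hZ' : Measurable[⨆ s ∈ Sᶜ, m s] fun η : Fin n → ℝ =>
      Z (roundEstimate d k j (zeroExtend η)) := by
    let _ : MeasurableSpace (Fin n → ℝ) := ⨆ s ∈ Sᶜ, m s
    refine hZ.comp (measurable_roundEstimate fun t ht1 ht2 => ?_)
    simp only [zeroExtend, ht2.trans_le hn, dif_pos]
    exact (hms _).mono (le_biSup m (show (⟨t, ht2.trans_le hn⟩ : Fin n) ∈ Sᶜ from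
      not_lt.2 ht1)) le_rfl
  refine lintegral_le_lintegral_min_one_of_indep (iSup₂_le fun s _ => hm s)
    (iSup₂_le fun s _ => hm s) hind hD hZ' (fun η => hF1 _) (fun η hη => ?_) hb hb0
  have hc : ⟪powerIterate d k w (fun t => (powerPolicy d k n).X θ t (w, η)) j, θ⟫ ≠ 0 := by
    intro h0
    simp [h0] at hη
  simp only [powerIterate]
  rw [roundEstimate_powerPolicy hk θ w η hn]
  exact hF _ hc _

theorem ofReal_div_ofReal_mul_eq {b c r : ℝ} (hb : 0 < b) (hr : 0 < r) :
    ENNReal.ofReal (b * r ^ 4) / ENNReal.ofReal (c ^ 2 * r ^ 2) =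
      ENNReal.ofReal (b * r ^ 2) / ENNReal.ofReal (c ^ 2) := by
  rcases eq_or_ne c 0 with rfl | hc
  · have h1 : 0 < b * r ^ 4 := by positivity
    have h2 : 0 < b * r ^ 2 := by positivity
    simp [ENNReal.div_zero, h1, h2]
  · rw [← ENNReal.ofReal_div_of_pos (by positivity), ← ENNReal.ofReal_div_of_pos (by positivity)]
    congr 1
    field_simp

theorem lintegral_one_sub_powerIterate_succ_le (hk : 0 < k) {j : ℕ}
    (hn : 2 * d * k * (j + 1) ≤ n) {θ : EuclideanSpace ℝ (Fin d)} (hθ : θ ≠ 0)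
    (w : EuclideanSpace ℝ (Fin d)) {κ : ℝ} (hκ : κ * ‖θ‖ ^ 4 = 2 * d / k) :
    ∫⁻ η : Fin n → ℝ, ENNReal.ofReal (1 -
        ⟪powerIterate d k w (fun t => (powerPolicy d k n).X θ t (w, η)) (j + 1), θ⟫ ^ 2 / ‖θ‖ ^ 2)
        ∂(Measure.pi fun _ => gaussianReal 0 1) ≤
      ∫⁻ η : Fin n → ℝ, min 1 (ENNReal.ofReal 0 + ENNReal.ofReal (κ * ‖θ‖ ^ 2) / ENNReal.ofReal
        (⟪powerIterate d k w (fun t => (powerPolicy d k n).X θ t (w, η)) j, θ⟫ ^ 2))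
        ∂(Measure.pi fun _ => gaussianReal 0 1) := by
  have hd : 0 < d := Nat.pos_of_ne_zero (NeZero.ne d)
  have hr : 0 < ‖θ‖ := norm_pos_iff.2 hθ
  have hb : 0 < κ * ‖θ‖ ^ 4 := by rw [hκ]; positivity
  have hκ0 : 0 < κ := pos_of_mul_pos_left hb (by positivity)
  simp_rw [← ofReal_div_ofReal_mul_eq hκ0 hr]
  have hξ := integral_norm_roundEstimate_sq hk hn
  refine lintegral_powerIterate_succ_le hk hn θ w
    (F := fun x => ENNReal.ofReal (1 - ⟪x, θ⟫ ^ 2 / ‖θ‖ ^ 2))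
    (Z := fun ξ => ENNReal.ofReal (‖ξ‖ ^ 2)) (by fun_prop) (fun x => ?_) (fun c hc ξ => ?_)
    ?_ (by simpa using hb)
  · rw [← ENNReal.ofReal_one]
    apply ENNReal.ofReal_le_ofReal
    have : 0 ≤ ⟪x, θ⟫ ^ 2 / ‖θ‖ ^ 2 := by positivity
    linarith
  · exact (ofReal_one_sub_inner_normalize_sq_div_le hc hθ ξ).trans le_add_self
  · rw [← ofReal_integral_eq_lintegral_ofReal hξ.1 (ae_of_all _ fun η => by positivity), hξ.2, hκ]

theorem lintegral_min_one_powerIterate_succ_le (hk : 0 < k) {j : ℕ}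
    (hn : 2 * d * k * (j + 1) ≤ n) {θ : EuclideanSpace ℝ (Fin d)} (hθ : θ ≠ 0)
    (w : EuclideanSpace ℝ (Fin d)) {κ α β : ℝ} (hκ : κ * ‖θ‖ ^ 4 = 2 * d / k)
    (hα : 0 ≤ α) (hβ : 0 < β) :
    ∫⁻ η : Fin n → ℝ, min 1 (ENNReal.ofReal α + ENNReal.ofReal (β * ‖θ‖ ^ 2) / ENNReal.ofReal
        (⟪powerIterate d k w (fun t => (powerPolicy d k n).X θ t (w, η)) (j + 1), θ⟫ ^ 2))
        ∂(Measure.pi fun _ => gaussianReal 0 1) ≤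
      ∫⁻ η : Fin n → ℝ, min 1 (ENNReal.ofReal (α + 8 * β) +
        ENNReal.ofReal (κ * (8 * β + 4 / d) * ‖θ‖ ^ 2) / ENNReal.ofReal
        (⟪powerIterate d k w (fun t => (powerPolicy d k n).X θ t (w, η)) j, θ⟫ ^ 2))
        ∂(Measure.pi fun _ => gaussianReal 0 1) := by
  have hd : 0 < d := Nat.pos_of_ne_zero (NeZero.ne d)
  have hr : 0 < ‖θ‖ := norm_pos_iff.2 hθ
  have hb : 0 < κ * ‖θ‖ ^ 4 := by rw [hκ]; positivity
  have hκ0 : 0 < κ := pos_of_mul_pos_left hb (by positivity)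
  have hβ' : 0 < κ * (8 * β + 4 / d) := by positivity
  have hb' : 0 < κ * (8 * β + 4 / d) * ‖θ‖ ^ 4 := by positivity
  simp_rw [← ofReal_div_ofReal_mul_eq hβ' hr]
  have hξ := integral_norm_roundEstimate_sq hk hn
  have hξθ := integral_inner_roundEstimate_sq hk hn θ
  refine lintegral_powerIterate_succ_le hk hn θ w
    (F := fun x => min 1 (ENNReal.ofReal α + ENNReal.ofReal (β * ‖θ‖ ^ 2) /
      ENNReal.ofReal (⟪x, θ⟫ ^ 2)))
    (Z := fun ξ => ENNReal.ofReal (8 * β * ‖ξ‖ ^ 2 + 4 * (⟪ξ, θ⟫ ^ 2 / ‖θ‖ ^ 2))) (by fun_prop)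
    (fun x => min_le_left _ _) (fun c hc ξ => min_one_div_inner_normalize_sq_le hc hθ ξ hα hβ)
    ?_ (by simpa using hb')
  have htot : Integrable (fun η : Fin n → ℝ => 8 * β * ‖roundEstimate d k j (zeroExtend η)‖ ^ 2 +
      4 * (⟪roundEstimate d k j (zeroExtend η), θ⟫ ^ 2 / ‖θ‖ ^ 2))
      (Measure.pi fun _ => gaussianReal 0 1) :=
    (hξ.1.const_mul _).add ((hξθ.1.div_const _).const_mul _)
  rw [← ofReal_integral_eq_lintegral_ofReal htot
      (ae_of_all _ fun η => by simp only [Pi.zero_apply]; positivity)]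
  apply ENNReal.ofReal_le_ofReal
  rw [integral_add (hξ.1.const_mul _) ((hξθ.1.div_const _).const_mul _), integral_const_mul,
    integral_const_mul, integral_div, hξ.2, hξθ.2,
    mul_right_comm κ, hκ]
  apply le_of_eq
  field_simp

theorem lintegral_one_sub_powerIterate_le_of_le (hk : 0 < k) {J : ℕ}
    (hn : 2 * d * k * (J + 1) ≤ n) {θ : EuclideanSpace ℝ (Fin d)} (hθ : θ ≠ 0)
    (w : EuclideanSpace ℝ (Fin d)) {κ : ℝ} (hκ : κ * ‖θ‖ ^ 4 = 2 * d / k) (hκ1 : κ ≤ 1 / 16)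
    (i : ℕ) (hi : i ≤ J) :
    ∫⁻ η : Fin n → ℝ, ENNReal.ofReal (1 -
        ⟪powerIterate d k w (fun t => (powerPolicy d k n).X θ t (w, η)) (J + 1), θ⟫ ^ 2 / ‖θ‖ ^ 2)
        ∂(Measure.pi fun _ => gaussianReal 0 1) ≤
      ∫⁻ η : Fin n → ℝ, min 1 (ENNReal.ofReal ((16 * (1 - (1 / 2) ^ i) + 64 * i / d) * κ) +
        ENNReal.ofReal ((((1 / 2) ^ i + 8 / d) * κ) * ‖θ‖ ^ 2) / ENNReal.ofReal
        (⟪powerIterate d k w (fun t => (powerPolicy d k n).X θ t (w, η)) (J - i), θ⟫ ^ 2))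
        ∂(Measure.pi fun _ => gaussianReal 0 1) := by
  have hd : 0 < d := Nat.pos_of_ne_zero (NeZero.ne d)
  have hr : 0 < ‖θ‖ := norm_pos_iff.2 hθ
  have hb : 0 < κ * ‖θ‖ ^ 4 := by rw [hκ]; positivity
  have hκ0 : 0 < κ := pos_of_mul_pos_left hb (by positivity)
  induction i with
  | zero =>
    refine (lintegral_one_sub_powerIterate_succ_le hk hn hθ w hκ).trans ?_
    refine lintegral_mono fun η => ?_
    refine min_le_min le_rfl (add_le_add (ENNReal.ofReal_le_ofReal ?_)
      (ENNReal.div_le_div_right (ENNReal.ofReal_le_ofReal ?_) _))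
    · simp
    · have : (0 : ℝ) ≤ 8 / d := by positivity
      refine mul_le_mul_of_nonneg_right ?_ (by positivity)
      rw [pow_zero]
      nlinarith
  | succ i ih =>
    have hJ : J - i = (J - (i + 1)) + 1 := by omega
    have hp : (0 : ℝ) < (1 / 2) ^ i := by positivity
    have hp1 : (1 / 2 : ℝ) ^ i ≤ 1 := pow_le_one₀ (by norm_num) (by norm_num)
    refine (ih (by omega)).trans ?_
    rw [hJ]
    have hα : 0 ≤ (16 * (1 - (1 / 2) ^ i) + 64 * i / d) * κ :=
      mul_nonneg (add_nonneg (by linarith) (by positivity)) hκ0.le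
    have hJn : 2 * d * k * (J - (i + 1) + 1) ≤ n := by
      refine le_trans ?_ hn
      gcongr
      omega
    refine (lintegral_min_one_powerIterate_succ_le hk hJn hθ w hκ hα (by positivity)).trans ?_
    refine lintegral_mono fun η => ?_
    refine min_le_min le_rfl (add_le_add (ENNReal.ofReal_le_ofReal ?_)
      (ENNReal.div_le_div_right (ENNReal.ofReal_le_ofReal ?_) _))
    · apply le_of_eq
      push_cast
      rw [pow_succ]
      ring
    · refine mul_le_mul_of_nonneg_right ?_ (by positivity)
      rw [mul_comm κ]
      refine mul_le_mul_of_nonneg_right ?_ hκ0.le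
      have h1 : (0 : ℝ) < 1 / d := by positivity
      have h2 : 8 * (((1 / 2) ^ i + 8 / d) * κ) ≤ 8 * (((1 / 2 : ℝ) ^ i + 8 / d) * (1 / 16)) := by
        gcongr
      rw [pow_succ]
      have h3 : (8 : ℝ) / d = 8 * (1 / d) := by ring
      have h4 : (4 : ℝ) / d = 4 * (1 / d) := by ring
      rw [h3] at h2 ⊢
      rw [h4]
      linarith

end PowerIteration

theorem ae_ne_zero_stdGaussian {d : ℕ} [NeZero d] :
    ∀ᵐ w ∂(stdGaussian (EuclideanSpace ℝ (Fin d))), w ≠ 0 := by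
  have := nullSingletonClass_gaussianReal (μ := 0) (v := 1) one_ne_zero
  have h0 : ∀ᵐ x ∂(gaussianReal 0 1), x ≠ 0 := compl_mem_ae_iff.2 (measure_singleton _)
  rw [← map_pi_eq_stdGaussian]
  refine (ae_map_iff (by fun_prop) (measurableSet_singleton _).compl).2 ?_
  have h := (measurePreserving_eval (fun _ : Fin d => gaussianReal 0 1) 0).quasiMeasurePreserving.ae
    h0
  filter_upwards [h] with x hx h
  exact hx (by simpa using congrArg (fun v : EuclideanSpace ℝ (Fin d) => v 0) h)

theorem measurable_powerIterate_X {d k n : ℕ} {W : Type} [MeasurableSpace W] (π : Policy d n W)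
    (θ : EuclideanSpace ℝ (Fin d)) {w : W → EuclideanSpace ℝ (Fin d)} (hw : Measurable w) (j : ℕ) :
    Measurable fun ω : W × (Fin n → ℝ) => powerIterate d k (w ω.1) (fun t => π.X θ t ω) j :=
  measurable_powerIterate (hw.comp measurable_fst) fun t ht =>
    π.measurable_X_s2 θ measurable_fst (fun s _ => (measurable_pi_apply s).comp measurable_snd) t ht

/-- Error of the noisy power iteration when the signal dominates the noise. -/
theorem lintegral_one_sub_powerIterate_clog_le {d k n : ℕ} [NeZero d] (hk : 0 < k)
    (hn : 2 * d * k * (Nat.clog 2 d + 1) ≤ n) {θ : EuclideanSpace ℝ (Fin d)} (hθ : θ ≠ 0) {κ : ℝ}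
    (hκ : κ * ‖θ‖ ^ 4 = 2 * d / k) (hκ1 : κ ≤ 1 / 16) :
    ∫⁻ ω, ENNReal.ofReal (1 - ⟪powerIterate d k ω.1 (fun t => (powerPolicy d k n).X θ t ω)
        (Nat.clog 2 d + 1), θ⟫ ^ 2 / ‖θ‖ ^ 2) ∂(powerPolicy d k n).μ ≤ ENNReal.ofReal (40 * √κ) := by
  have hd : 0 < d := Nat.pos_of_ne_zero (NeZero.ne d)
  have hd1 : (1 : ℝ) ≤ d := by exact_mod_cast hd
  have hr : 0 < ‖θ‖ := norm_pos_iff.2 hθ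
  have hb : 0 < κ * ‖θ‖ ^ 4 := by rw [hκ]; positivity
  have hκ0 : 0 < κ := pos_of_mul_pos_left hb (by positivity)
  have hmeas : Measurable fun ω => ENNReal.ofReal (1 - ⟪powerIterate d k ω.1
      (fun t => (powerPolicy d k n).X θ t ω) (Nat.clog 2 d + 1), θ⟫ ^ 2 / ‖θ‖ ^ 2) :=
    (measurable_const.sub
      (((measurable_powerIterate_X (powerPolicy d k n) θ measurable_id
        _).inner_const.pow_const 2).div_const _)).ennreal_ofReal
  rw [Policy.μ, lintegral_prod _ hmeas.aemeasurable]
  set J := Nat.clog 2 d with hJ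
  have hJd : (1 / 2 : ℝ) ^ J ≤ 1 / d := by
    rw [one_div_pow]
    apply one_div_le_one_div_of_le (by positivity)
    exact_mod_cast Nat.le_pow_clog (by norm_num) d
  have hJd' : (J : ℝ) ≤ d := by
    exact_mod_cast Nat.clog_le_of_le_pow Nat.lt_two_pow_self.le
  set u : EuclideanSpace ℝ (Fin d) := ‖θ‖⁻¹ • θ with hu
  have hα : (16 * (1 - (1 / 2) ^ J) + 64 * J / d) * κ ≤ 80 * κ := by
    have h1 : 64 * (J : ℝ) / d ≤ 64 := by
      rw [div_le_iff₀ (by positivity)]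
      linarith
    have h2 : (0 : ℝ) < (1 / 2) ^ J := by positivity
    gcongr
    linarith
  have hβ : ((1 / 2) ^ J + 8 / d) * κ ≤ 9 * κ / d := by
    have : (9 : ℝ) * κ / d = (1 / d + 8 / d) * κ := by ring
    rw [this]
    gcongr
  have hpt : ∀ᵐ w ∂(stdGaussian (EuclideanSpace ℝ (Fin d))),
      ∫⁻ η : Fin n → ℝ, ENNReal.ofReal (1 - ⟪powerIterate d k w
        (fun t => (powerPolicy d k n).X θ t (w, η)) (J + 1), θ⟫ ^ 2 / ‖θ‖ ^ 2)
        ∂(Measure.pi fun _ => gaussianReal 0 1) ≤ ENNReal.ofReal (80 * κ) +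
      min 1 (ENNReal.ofReal (9 * κ / d * ‖w‖ ^ 2) / ENNReal.ofReal (⟪w, u⟫ ^ 2)) := by
    filter_upwards [ae_ne_zero_stdGaussian] with w hw
    have hw0 : 0 < ‖w‖ := norm_pos_iff.2 hw
    refine (lintegral_one_sub_powerIterate_le_of_le hk hn hθ w hκ hκ1 J le_rfl).trans ?_
    simp only [Nat.sub_self, powerIterate, lintegral_const, measure_univ, mul_one]
    have hwu : ENNReal.ofReal (9 * κ / d * ‖θ‖ ^ 2) / ENNReal.ofReal (⟪‖w‖⁻¹ • w, θ⟫ ^ 2) =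
        ENNReal.ofReal (9 * κ / d * ‖w‖ ^ 2) / ENNReal.ofReal (⟪w, u⟫ ^ 2) := by
      have hq : 0 < 9 * κ / d := by positivity
      rw [hu, inner_smul_left, inner_smul_right]
      simp only [conj_trivial]
      rcases eq_or_ne ⟪w, θ⟫ 0 with h | h
      · rw [h]
        have h1 : 0 < 9 * κ / d * ‖θ‖ ^ 2 := by positivity
        have h2 : 0 < 9 * κ / d * ‖w‖ ^ 2 := by positivity
        simp [ENNReal.div_zero, h1, h2]
      · rw [← ENNReal.ofReal_div_of_pos (by positivity),
          ← ENNReal.ofReal_div_of_pos (by positivity)]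
        congr 1
        field_simp
    rw [← hwu]
    rcases le_total 1 (ENNReal.ofReal (9 * κ / d * ‖θ‖ ^ 2) /
      ENNReal.ofReal (⟪‖w‖⁻¹ • w, θ⟫ ^ 2)) with h | h
    · rw [min_eq_left h]
      exact (min_le_left _ _).trans le_add_self
    · rw [min_eq_right h]
      exact (min_le_right _ _).trans (add_le_add (ENNReal.ofReal_le_ofReal hα)
        (ENNReal.div_le_div_right (ENNReal.ofReal_le_ofReal
          (mul_le_mul_of_nonneg_right hβ (by positivity))) _))
  refine (lintegral_mono_ae hpt).trans ?_
  rw [lintegral_add_left measurable_const, lintegral_const, measure_univ, mul_one]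
  have hu1 : ‖u‖ = 1 := norm_smul_inv_norm hθ
  have hA := lintegral_min_one_norm_sq_div_inner_sq_stdGaussian_le hd u hu1
    (q := 9 * κ / d) (by positivity)
  refine (add_le_add le_rfl hA).trans ?_
  rw [← ENNReal.ofReal_add (by positivity) (by positivity)]
  apply ENNReal.ofReal_le_ofReal
  have h1 : 9 * κ / d * d = 3 ^ 2 * κ := by field_simp; norm_num
  have h2 : 9 * κ / d ≤ 9 * κ := div_le_self (by positivity) hd1
  have h3 : κ ≤ √κ / 4 := by
    have : √κ ≤ 1 / 4 := Real.sqrt_le_iff.2 ⟨by norm_num, by linarith⟩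
    nlinarith [Real.sq_sqrt hκ0.le, Real.sqrt_nonneg κ]
  rw [h1, Real.sqrt_mul (by positivity), Real.sqrt_sq (by norm_num)]
  linarith

theorem sub_integral_inner_sq_le {Ω : Type*} [MeasurableSpace Ω] {P : Measure Ω}
    [IsProbabilityMeasure P] {d : ℕ} {G : Ω → EuclideanSpace ℝ (Fin d)} (hG : Measurable G)
    (hG1 : ∀ ω, ‖G ω‖ ≤ 1) {θ : EuclideanSpace ℝ (Fin d)} (hθ : θ ≠ 0) {b : ℝ} (hb : 0 ≤ b)
    (h : ∫⁻ ω, ENNReal.ofReal (1 - ⟪G ω, θ⟫ ^ 2 / ‖θ‖ ^ 2) ∂P ≤ ENNReal.ofReal b) :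
    ‖θ‖ ^ 2 - ∫ ω, ⟪G ω, θ⟫ ^ 2 ∂P ≤ b * ‖θ‖ ^ 2 := by
  have hr : 0 < ‖θ‖ := norm_pos_iff.2 hθ
  have hle : ∀ ω, ⟪G ω, θ⟫ ^ 2 ≤ ‖θ‖ ^ 2 := fun ω => inner_sq_le_of_norm_le_one (hG1 ω) θ
  have hm : Measurable fun ω => ⟪G ω, θ⟫ ^ 2 := hG.inner_const.pow_const 2
  have h_int : Integrable (fun ω => ⟪G ω, θ⟫ ^ 2) P :=
    Integrable.of_bound hm.aestronglyMeasurable (‖θ‖ ^ 2) (ae_of_all _ fun ω => by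
      rw [Real.norm_of_nonneg (sq_nonneg _)]
      exact hle ω)
  have h_int' : Integrable (fun ω => 1 - ⟪G ω, θ⟫ ^ 2 / ‖θ‖ ^ 2) P :=
    (integrable_const (1 : ℝ)).sub (h_int.div_const (‖θ‖ ^ 2))
  have h1 : ∫ ω, (1 - ⟪G ω, θ⟫ ^ 2 / ‖θ‖ ^ 2) ∂P ≤ b := by
    rw [integral_eq_lintegral_of_nonneg_ae (ae_of_all _ fun ω => ?_) h_int'.aestronglyMeasurable]
    · exact ENNReal.toReal_le_of_le_ofReal hb h
    · exact sub_nonneg.2 (div_le_one_of_le₀ (hle ω) (by positivity))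
  rw [integral_sub (integrable_const _) (h_int.div_const _), integral_div, integral_const] at h1
  simp only [probReal_univ, smul_eq_mul, mul_one] at h1
  have h2 := mul_le_mul_of_nonneg_right h1 (sq_nonneg ‖θ‖)
  rwa [sub_mul, one_mul, div_mul_cancel₀ _ (by positivity)] at h2

/-- Simple regret of the noisy power iteration with `2 * d * k` samples per round. -/
theorem sq_sub_integral_inner_powerIterate_le {d k n : ℕ} [NeZero d] (hk : 0 < k)
    (hn : 2 * d * k * (Nat.clog 2 d + 1) ≤ n) (θ : EuclideanSpace ℝ (Fin d)) :
    ‖θ‖ ^ 2 - ∫ ω, ⟪powerIterate d k ω.1 (fun t => (powerPolicy d k n).X θ t ω)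
      (Nat.clog 2 d + 1), θ⟫ ^ 2 ∂(powerPolicy d k n).μ ≤ 40 * √(2 * d / k) := by
  have hd : 0 < d := Nat.pos_of_ne_zero (NeZero.ne d)
  have h_int : 0 ≤ ∫ ω, ⟪powerIterate d k ω.1 (fun t => (powerPolicy d k n).X θ t ω)
      (Nat.clog 2 d + 1), θ⟫ ^ 2 ∂(powerPolicy d k n).μ := integral_nonneg fun ω => sq_nonneg _
  rcases eq_or_ne θ 0 with rfl | hθ
  · rw [norm_zero, zero_pow two_ne_zero]
    have : 0 ≤ √(2 * d / k : ℝ) := Real.sqrt_nonneg _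
    linarith
  have hr : 0 < ‖θ‖ := norm_pos_iff.2 hθ
  obtain ⟨κ, hκ⟩ : ∃ κ : ℝ, κ * ‖θ‖ ^ 4 = 2 * d / k :=
    ⟨2 * d / k / ‖θ‖ ^ 4, div_mul_cancel₀ _ (by positivity)⟩
  have hs : √(2 * d / k : ℝ) = √κ * ‖θ‖ ^ 2 := by
    rw [← hκ, Real.sqrt_mul' _ (by positivity), show ‖θ‖ ^ 4 = (‖θ‖ ^ 2) ^ 2 by ring,
      Real.sqrt_sq (by positivity)]
  rw [hs, ← mul_assoc]
  rcases le_or_gt κ (1 / 16) with hκ1 | hκ1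
  · have : IsProbabilityMeasure (powerPolicy d k n).μ := by
      have := (powerPolicy d k n).probW
      unfold Policy.μ
      infer_instance
    exact sub_integral_inner_sq_le
      (measurable_powerIterate_X (powerPolicy d k n) θ measurable_id _)
      (fun ω => norm_powerIterate_le_one _ _ _ _ _) hθ (by positivity)
      (lintegral_one_sub_powerIterate_clog_le hk hn hθ hκ hκ1)
  · have : 1 / 4 ≤ √κ := Real.le_sqrt_of_sq_le (by linarith)
    nlinarith [sq_nonneg ‖θ‖]

theorem clog_two_add_one_le {d : ℕ} (hd : 2 ≤ d) : (Nat.clog 2 d + 1 : ℝ) ≤ 5 * Real.log d := by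
  have h1 : (2 : ℝ) ^ (Nat.clog 2 d - 1) < d := by
    exact_mod_cast Nat.pow_pred_clog_lt_self (b := 2) (by norm_num) (by omega : 1 < d)
  have h2 : ((Nat.clog 2 d - 1 : ℕ) : ℝ) * Real.log 2 ≤ Real.log d := by
    rw [← Real.log_pow]
    exact Real.log_le_log (by positivity) h1.le
  have h3 : Real.log 2 ≤ Real.log d := Real.log_le_log (by norm_num) (by exact_mod_cast hd)
  have h4 := Real.log_two_gt_d9
  have h5 : 1 ≤ Nat.clog 2 d := Nat.clog_pos (by norm_num) hd
  push_cast [h5] at h2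
  have h6 : (1 : ℝ) ≤ Nat.clog 2 d := by exact_mod_cast h5
  nlinarith

/-- **Simple regret upper bound.**  There is a universal constant `C > 0` such that for
every dimension `d ≥ 2`, horizon `n ≥ 2` and radius `r ∈ [0,1]`, there exist a policy `π`
and a prediction map `g` — a measurable function of the full interaction history
(the seed `W` together with the rewards `X_1, …, X_n`, which also determine the actions
`A_1, …, A_n`), with values in the unit ball — such that for every parameter `θ⋆` on the
sphere of radius `r` the simple regret satisfies
`r² − E[⟪Â⋆, θ⋆⟫²] ≤ C · d · √(log n · log d / n)`, where `Â⋆` is the prediction `g`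
evaluated on the realized history. -/
theorem bandit_phase_retrieval_simple_regret_upper_bound :
    ∃ C : ℝ, 0 < C ∧ ∀ d n : ℕ, 2 ≤ d → 2 ≤ n → ∀ r ∈ Set.Icc (0 : ℝ) 1,
      ∃ (W : Type) (_ : MeasurableSpace W) (π : Policy d n W)
        (g : W × (Fin n → ℝ) → EuclideanSpace ℝ (Fin d)),
        Measurable g ∧ (∀ p, ‖g p‖ ≤ 1) ∧
        ∀ θstar : EuclideanSpace ℝ (Fin d), ‖θstar‖ = r →
          r ^ 2 - ∫ ω, (⟪g (ω.1, fun t : Fin n => π.X θstar t.val ω), θstar⟫) ^ 2 ∂π.μ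
            ≤ C * d * Real.sqrt (Real.log n * Real.log d / n) := by
  refine ⟨400, by norm_num, fun d n hd hn r hr => ?_⟩
  have : NeZero d := ⟨by omega⟩
  set J := Nat.clog 2 d with hJ
  set k := n / (2 * d * (J + 1)) with hk
  refine ⟨_, _, powerPolicy d k n, fun p => powerIterate d k p.1 (zeroExtend p.2) (J + 1),
    measurable_powerIterate measurable_fst fun t _ =>
      (measurable_zeroExtend t).comp measurable_snd,
    fun p => norm_powerIterate_le_one _ _ _ _ _, fun θ hθ => ?_⟩
  have hn0 : (0 : ℝ) < n := by positivity
  have hkn : 2 * d * k * (J + 1) ≤ n := by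
    calc 2 * d * k * (J + 1) = n / (2 * d * (J + 1)) * (2 * d * (J + 1)) := by rw [hk]; ring
      _ ≤ n := Nat.div_mul_le_self _ _
  have hlt : n < 2 * d * (J + 1) * (k + 1) := Nat.lt_mul_div_succ n (by positivity)
  have hlog : √(8 * (J + 1) / n : ℝ) ≤ 10 * √(Real.log n * Real.log d / n) := by
    have h1 := clog_two_add_one_le hd
    have h2 : 1 / 2 ≤ Real.log n := by
      have := Real.log_le_log (by norm_num) (show (2 : ℝ) ≤ n by exact_mod_cast hn)
      linarith [Real.log_two_gt_d9]
    have h3 : 0 ≤ Real.log d := by linarith [(Nat.cast_nonneg J : (0 : ℝ) ≤ J)]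
    rw [show (10 : ℝ) = √(10 ^ 2) from (Real.sqrt_sq (by norm_num)).symm,
      ← Real.sqrt_mul (by norm_num), ← mul_div_assoc]
    refine Real.sqrt_le_sqrt (div_le_div_of_nonneg_right ?_ hn0.le)
    nlinarith
  have hbound : r ^ 2 - ∫ ω, ⟪powerIterate d k ω.1
      (zeroExtend fun t : Fin n => (powerPolicy d k n).X θ t.val ω) (J + 1), θ⟫ ^ 2
      ∂(powerPolicy d k n).μ ≤ 40 * (d * √(8 * (J + 1) / n : ℝ)) := by
    have hsq : (d : ℝ) * √(8 * (J + 1) / n : ℝ) = √(d ^ 2 * (8 * (J + 1) / n)) := by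
      rw [Real.sqrt_mul (by positivity), Real.sqrt_sq (by positivity)]
    rw [hsq]
    rcases Nat.eq_zero_or_pos k with h0 | hk0
    · have h_int : 0 ≤ ∫ ω, ⟪powerIterate d k ω.1
        (zeroExtend fun t : Fin n => (powerPolicy d k n).X θ t.val ω) (J + 1), θ⟫ ^ 2
        ∂(powerPolicy d k n).μ := integral_nonneg fun ω => sq_nonneg _
      have hr2 : r ^ 2 ≤ 1 := pow_le_one₀ hr.1 hr.2
      have : (1 : ℝ) ≤ √(d ^ 2 * (8 * (J + 1) / n)) := by
        rw [Real.one_le_sqrt, ← mul_div_assoc, one_le_div hn0]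
        rw [h0] at hlt
        have h1 : (n : ℝ) ≤ 2 * d * (J + 1) := by exact_mod_cast (by simpa using hlt.le)
        have h2 : (1 : ℝ) ≤ d := by exact_mod_cast (by omega : 1 ≤ d)
        have h3 : 2 * d * (J + 1 : ℝ) ≤ 2 * d * (J + 1) * (4 * d) :=
          le_mul_of_one_le_right (by positivity) (by linarith)
        linarith
      linarith
    · have hcongr : ∀ ω : EuclideanSpace ℝ (Fin d) × (Fin n → ℝ), powerIterate d k ω.1
          (zeroExtend fun t : Fin n => (powerPolicy d k n).X θ t.val ω) (J + 1) =
          powerIterate d k ω.1 (fun t => (powerPolicy d k n).X θ t ω) (J + 1) := fun ω =>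
        powerIterate_congr _ fun t ht => by simp [zeroExtend, ht.trans_le hkn]
      simp_rw [hcongr]
      rw [← hθ]
      refine (sq_sub_integral_inner_powerIterate_le hk0 hkn θ).trans ?_
      gcongr
      rw [← mul_div_assoc, div_le_div_iff₀ (by positivity) hn0]
      have h1 : (n : ℝ) ≤ 2 * d * (J + 1) * (k + 1) := by exact_mod_cast hlt.le
      have h2 : (k + 1 : ℝ) ≤ 2 * k := by
        have : (1 : ℝ) ≤ k := by exact_mod_cast hk0
        linarith
      calc (2 * d * n : ℝ) ≤ 2 * d * (2 * d * (J + 1) * (2 * k)) := by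
            gcongr
            exact h1.trans (by gcongr)
        _ = d ^ 2 * (8 * (J + 1)) * k := by ring
  calc _ ≤ 40 * (d * √(8 * (J + 1) / n : ℝ)) := hbound
    _ ≤ 40 * (d * (10 * √(Real.log n * Real.log d / n))) := by gcongr
    _ = _ := by ring
end
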